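/- Let k be any integer with k ≤ 12 and let m > 3 be a prime. Then every subset S of the dihedral group D_{2m} with |S| = k and id ∉ S is sequenceable, i.e., the elements of S can be ordered so that the partial sums s_0 = id, s_1, …, s_k are pairwise distinct except possibly s_0 = s_k. -/

import Mathlib

open scoped Classical

/-- The `i`-th partial sum (partial product) of a list in a group: `s_i = x_1 ⋯ x_i`, `s_0 = 1`. -/
noncomputable def PartialSum {G : Type*} [Group G] (l : List G) (i : ℕ) : G := (l.take i).prod

/-- A finite set `S` of non-identity elements of a group is sequenceable if its elements admit
an ordering whose partial sums `s_0, …, s_k` are pairwise distinct, except possibly `s_0 = s_k`. -/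
def Sequenceable {G : Type*} [Group G] (S : Finset G) : Prop :=
  ∃ l : List G, l.Nodup ∧ l.toFinset = S ∧
    ∀ i j : ℕ, i < j → j ≤ l.length → ¬(i = 0 ∧ j = l.length) →
      PartialSum l i ≠ PartialSum l j

theorem sum_range_card_le_sum (n : ℕ) : ∀ s : Finset ℕ, s.card = n →
    ∑ i ∈ Finset.range n, i ≤ ∑ i ∈ s, i ∧
      (∑ i ∈ s, i ≤ ∑ i ∈ Finset.range n, i → s = Finset.range n) := by
  induction n with
  | zero => intro s hs; rw [Finset.card_eq_zero] at hs; simp [hs]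
  | succ n ih =>
    intro s hs
    have hne : s.Nonempty := by rw [← Finset.card_pos]; omega
    have hm := s.max'_mem hne
    set m := s.max' hne with hmdef
    have hc : (s.erase m).card = n := by rw [Finset.card_erase_of_mem hm]; omega
    obtain ⟨h1, h2⟩ := ih _ hc
    have hsub : s ⊆ Finset.range (m + 1) := fun x hx => by
      have := s.le_max' x hx
      simp only [Finset.mem_range]; omega
    have hmn : n ≤ m := by
      have := Finset.card_le_card hsub
      rw [hs, Finset.card_range] at this; omega
    have hsum := Finset.add_sum_erase s (fun i => i) hm
    rw [Finset.sum_range_succ]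
    refine ⟨by omega, fun hle => ?_⟩
    have hmn' : m = n := by omega
    have := h2 (by omega)
    rw [← Finset.insert_erase hm, this, hmn', Finset.range_add_one]

section Vandermonde
open Equiv Matrix

/-- The sign of `u` when it is a permutation of `0, …, n-1`, and zero otherwise. -/
noncomputable def permSign {n : ℕ} (u : Fin n → ℕ) : ℤ :=
  ∑ π : Perm (Fin n), if (u = fun i => (π i : ℕ)) then (Perm.sign π : ℤ) else 0

theorem exists_perm_of_sum_le {n : ℕ} (u : Fin n → ℕ) (hu : Function.Injective u)
    (h : ∑ i, u i ≤ ∑ i ∈ Finset.range n, i) : ∃ π : Perm (Fin n), u = fun i => (π i : ℕ) := by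
  have hs : (Finset.univ.image u).card = n := by
    rw [Finset.card_image_of_injective _ hu]; simp
  have hr := (sum_range_card_le_sum n _ hs).2 (by
    rw [Finset.sum_image (fun x _ y _ h => hu h)]; exact h)
  have hlt : ∀ i, u i < n := fun i => by
    have : u i ∈ Finset.univ.image u := Finset.mem_image_of_mem _ (Finset.mem_univ i)
    rw [hr] at this; simpa using this
  have hinj : Function.Injective (fun i => (⟨u i, hlt i⟩ : Fin n)) := fun a b hab => by
    apply hu; simpa using hab
  exact ⟨Equiv.ofBijective _ (Finite.injective_iff_bijective.mp hinj), rfl⟩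

theorem permSign_val {n : ℕ} (π : Perm (Fin n)) :
    permSign (fun i => (π i : ℕ)) = Perm.sign π := by
  unfold permSign
  rw [Finset.sum_eq_single π]
  · simp
  · intro b _ hb
    rw [if_neg]
    intro h; apply hb; ext i; exact (congrFun h i).symm
  · simp

/-- A generalized Vandermonde determinant of minimal degree is zero or a Vandermonde determinant. -/
theorem det_pow_eq {K : Type*} [CommRing K] {n : ℕ} (l : Fin n → K) (u : Fin n → ℕ)
    (h : ∑ i, u i ≤ ∑ i ∈ Finset.range n, i) :
    (Matrix.of fun i j => l i ^ u j).det = (permSign u : K) * (vandermonde l).det := by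
  by_cases hu : Function.Injective u
  · obtain ⟨π, rfl⟩ := exists_perm_of_sum_le u hu h
    rw [permSign_val]
    have := det_permute' π (vandermonde l)
    rw [← this]; rfl
  · have h0 : permSign u = 0 := by
      refine Finset.sum_eq_zero fun π _ => if_neg fun hπ => hu ?_
      rw [hπ]; exact Fin.val_injective.comp π.injective
    rw [h0]
    simp only [Function.Injective, not_forall] at hu
    obtain ⟨a, b, hab, hne⟩ := hu
    rw [det_zero_of_column_eq hne (fun k => by simp [hab])]
    simp

theorem permSign_eq_zero {n : ℕ} (u : Fin n → ℕ) (h : ∑ i, u i < ∑ i ∈ Finset.range n, i) :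
    permSign u = 0 := by
  refine Finset.sum_eq_zero fun π _ => if_neg fun hπ => ?_
  have h2 : ∑ i, u i = ∑ i : Fin n, (i : ℕ) := by
    rw [hπ]; exact Equiv.sum_comp π (fun i : Fin n => (i : ℕ))
  rw [h2, Fin.sum_univ_eq_sum_range (fun i => i)] at h
  exact lt_irrefl _ h

theorem sum_sign_prod_pow {K : Type*} [CommRing K] {n : ℕ} (l : Fin n → K) (u : Fin n → ℕ) :
    ∑ π : Perm (Fin n), (Perm.sign π : ℤ) • ∏ i, l (π i) ^ u i =
      (Matrix.of fun i j => l i ^ u j).det := by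
  rw [det_apply]; rfl

end Vandermonde

/-- Letters of a word: variable or constant rotations, variable or constant reflections. -/
inductive Slot | rot | ref | frot | fref

/-- Distribute rotations, reflections and constants over the letters of a word. -/
def fill {α : Type*} : List Slot → List α → List α → List α → List α
  | .rot :: w, a :: R, T, C => a :: fill w R T C
  | .ref :: w, R, b :: T, C => b :: fill w R T C
  | .frot :: w, R, T, c :: C => c :: fill w R T C
  | .fref :: w, R, T, c :: C => c :: fill w R T C
  | _, _, _, _ => []

def nRot : List Slot → ℕ
  | [] => 0
  | .rot :: w => nRot w + 1
  | _ :: w => nRot w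

def nRef : List Slot → ℕ
  | [] => 0
  | .ref :: w => nRef w + 1
  | _ :: w => nRef w

def nCon : List Slot → ℕ
  | [] => 0
  | .frot :: w => nCon w + 1
  | .fref :: w => nCon w + 1
  | _ :: w => nCon w

theorem length_fill {α : Type*} (w : List Slot) : ∀ R T C : List α, R.length = nRot w →
    T.length = nRef w → C.length = nCon w → (fill w R T C).length = w.length := by
  induction w with
  | nil => intros; rfl
  | cons x w ih =>
    intro R T C hR hT hC
    cases x
    · cases R with
      | nil => simp [nRot] at hR
      | cons a R => simpa [fill] using ih R T C (by simpa [nRot] using hR) hT hC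
    · cases T with
      | nil => simp [nRef] at hT
      | cons a T => simpa [fill] using ih R T C hR (by simpa [nRef] using hT) hC
    · cases C with
      | nil => simp [nCon] at hC
      | cons a C => simpa [fill] using ih R T C hR hT (by simpa [nCon] using hC)
    · cases C with
      | nil => simp [nCon] at hC
      | cons a C => simpa [fill] using ih R T C hR hT (by simpa [nCon] using hC)

theorem map_fill {α β : Type*} (f : α → β) (w : List Slot) : ∀ R T C : List α,
    (fill w R T C).map f = fill w (R.map f) (T.map f) (C.map f) := by
  induction w with
  | nil => intros; rfl
  | cons x w ih =>
    intro R T C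
    cases x
    · cases R <;> simp [fill, ih]
    · cases T <;> simp [fill, ih]
    · cases C <;> simp [fill, ih]
    · cases C <;> simp [fill, ih]

section Monomials
variable {K : Type*} [CommRing K]

def monoVal (u : ℕ → ℕ) : List K → K
  | [] => 1
  | x :: xs => x ^ u 0 * monoVal (fun i => u (i + 1)) xs

theorem monoVal_eq_prod (xs : List K) : ∀ u : ℕ → ℕ,
    monoVal u xs = ∏ i ∈ Finset.range xs.length, xs.getD i 0 ^ u i := by
  induction xs with
  | nil => intro u; simp [monoVal]
  | cons x xs ih =>
    intro u
    simp [monoVal, Finset.prod_range_succ', ih, mul_comm]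

def expR : List Slot → (ℕ → ℕ) → List ℕ
  | [], _ => []
  | .rot :: w, u => u 0 :: expR w (fun i => u (i + 1))
  | _ :: w, u => expR w (fun i => u (i + 1))

def expT : List Slot → (ℕ → ℕ) → List ℕ
  | [], _ => []
  | .ref :: w, u => u 0 :: expT w (fun i => u (i + 1))
  | _ :: w, u => expT w (fun i => u (i + 1))

def expC : List Slot → (ℕ → ℕ) → List ℕ
  | [], _ => []
  | .frot :: w, u => u 0 :: expC w (fun i => u (i + 1))
  | .fref :: w, u => u 0 :: expC w (fun i => u (i + 1))
  | _ :: w, u => expC w (fun i => u (i + 1))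

def listPow (l : List K) (e : List ℕ) : K := (List.zipWith (· ^ ·) l e).prod

theorem length_expR (w : List Slot) : ∀ u, (expR w u).length = nRot w := by
  induction w with
  | nil => intro; rfl
  | cons x w ih => intro u; cases x <;> simp [expR, nRot, ih]

theorem length_expT (w : List Slot) : ∀ u, (expT w u).length = nRef w := by
  induction w with
  | nil => intro; rfl
  | cons x w ih => intro u; cases x <;> simp [expT, nRef, ih]

theorem sum_exps (w : List Slot) : ∀ u, (expR w u).sum + (expT w u).sum + (expC w u).sum =
    ∑ i ∈ Finset.range w.length, u i := by
  induction w with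
  | nil => intro; rfl
  | cons x w ih =>
    intro u
    have := ih (fun i => u (i + 1))
    cases x <;> simp [expR, expT, expC, Finset.sum_range_succ', ← this] <;> ring

theorem monoVal_fill (w : List Slot) : ∀ (R T C : List K) (u : ℕ → ℕ), R.length = nRot w →
    T.length = nRef w → C.length = nCon w → monoVal u (fill w R T C) =
      listPow R (expR w u) * listPow T (expT w u) * listPow C (expC w u) := by
  induction w with
  | nil =>
    intro R T C u hR hT hC
    simp only [nRot, nRef, nCon, List.length_eq_zero_iff] at hR hT hC
    subst hR hT hC; simp [fill, monoVal, listPow]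
  | cons x w ih =>
    intro R T C u hR hT hC
    cases x
    · cases R with
      | nil => simp [nRot] at hR
      | cons a R =>
        simp only [fill, monoVal, expR, expT, expC]
        rw [ih R T C _ (by simpa [nRot] using hR) hT hC]
        simp only [listPow, List.zipWith_cons_cons, List.prod_cons]; ring
    · cases T with
      | nil => simp [nRef] at hT
      | cons a T =>
        simp only [fill, monoVal, expR, expT, expC]
        rw [ih R T C _ hR (by simpa [nRef] using hT) hC]
        simp only [listPow, List.zipWith_cons_cons, List.prod_cons]; ring
    · cases C with
      | nil => simp [nCon] at hC
      | cons a C =>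
        simp only [fill, monoVal, expR, expT, expC]
        rw [ih R T C _ hR hT (by simpa [nCon] using hC)]
        simp only [listPow, List.zipWith_cons_cons, List.prod_cons]; ring
    · cases C with
      | nil => simp [nCon] at hC
      | cons a C =>
        simp only [fill, monoVal, expR, expT, expC]
        rw [ih R T C _ hR hT (by simpa [nCon] using hC)]
        simp only [listPow, List.zipWith_cons_cons, List.prod_cons]; ring

theorem listPow_ofFn (n : ℕ) : ∀ (f : Fin n → K) (e : List ℕ), e.length = n →
    listPow (List.ofFn f) e = ∏ i, f i ^ e.getD i 0 := by
  induction n with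
  | zero => intro f e _; simp [listPow]
  | succ n ih =>
    intro f e he
    cases e with
    | nil => simp at he
    | cons a e =>
      have := ih (fun i => f i.succ) e (by simpa using he)
      simp only [listPow] at this
      simp [listPow, Fin.prod_univ_succ, List.ofFn_succ, this]

theorem sum_getD (n : ℕ) (e : List ℕ) (he : e.length = n) : ∑ i : Fin n, e.getD i 0 = e.sum := by
  subst he
  rw [← List.sum_ofFn]
  congr 1
  apply List.ext_get
  · simp
  · intro i h1 h2; simp

theorem listPow_eq_one (C : List K) : ∀ e : List ℕ, e.sum = 0 → listPow C e = 1 := by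
  induction C with
  | nil => intro e _; simp [listPow]
  | cons c C ih =>
    intro e he
    cases e with
    | nil => simp [listPow]
    | cons a e =>
      simp only [List.sum_cons, Nat.add_eq_zero_iff] at he
      have := ih e he.2
      simp only [listPow] at this
      simp [listPow, he.1, this]

end Monomials

open Equiv Matrix

/-- The two-fold alternating sum of `F` over the fillings of a word. -/
noncomputable def altSum {K M : Type*} [AddCommGroup M] (w : List Slot) {r f : ℕ}
    (R : Fin r → K) (T : Fin f → K) (C : List K) (F : List K → M) : M :=
  ∑ σ : Perm (Fin r), ∑ τ : Perm (Fin f), ((Perm.sign σ : ℤ) * (Perm.sign τ : ℤ)) •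
    F (fill w (List.ofFn fun i => R (σ i)) (List.ofFn fun i => T (τ i)) C)

theorem altSum_monoVal {K : Type*} [CommRing K] (w : List Slot) (R : Fin (nRot w) → K)
    (T : Fin (nRef w) → K) (C : List K) (hC : C.length = nCon w) (u : ℕ → ℕ) :
    altSum w R T C (monoVal u) =
      (Matrix.of fun (i j : Fin (nRot w)) => R i ^ (expR w u).getD (j : ℕ) 0).det *
      (Matrix.of fun (i j : Fin (nRef w)) => T i ^ (expT w u).getD (j : ℕ) 0).det *
          listPow C (expC w u) := by
  rw [← sum_sign_prod_pow, ← sum_sign_prod_pow, altSum, Finset.sum_mul_sum, Finset.sum_mul]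
  refine Finset.sum_congr rfl fun σ _ => ?_
  rw [Finset.sum_mul]
  refine Finset.sum_congr rfl fun τ _ => ?_
  rw [monoVal_fill w _ _ _ _ (by simp) (by simp) hC, listPow_ofFn _ _ _ (length_expR w u),
    listPow_ofFn _ _ _ (length_expT w u)]
  simp only [zsmul_eq_mul]; push_cast; ring

noncomputable def monoCoeff (w : List Slot) (u : ℕ → ℕ) : ℤ :=
  if (expC w u).sum = 0 then permSign (fun i : Fin (nRot w) => (expR w u).getD i 0) *
    permSign (fun i : Fin (nRef w) => (expT w u).getD i 0) else 0

theorem altSum_monoVal_eq {K : Type*} [CommRing K] (w : List Slot) (R : Fin (nRot w) → K)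
    (T : Fin (nRef w) → K) (C : List K) (hC : C.length = nCon w) (u : ℕ → ℕ)
    (hu : ∑ i ∈ Finset.range w.length, u i ≤
      ∑ i ∈ Finset.range (nRot w), i + ∑ i ∈ Finset.range (nRef w), i) :
    altSum w R T C (monoVal u) =
      (monoCoeff w u : K) * ((vandermonde R).det * (vandermonde T).det) := by
  rw [altSum_monoVal w R T C hC, monoCoeff]
  rw [← sum_exps] at hu
  have hR := sum_getD _ _ (length_expR w u)
  have hT := sum_getD _ _ (length_expT w u)
  have key : ∀ {n : ℕ} (l : Fin n → K) (v : Fin n → ℕ),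
      ∑ i, v i < ∑ i ∈ Finset.range n, i → (Matrix.of fun i j => l i ^ v j).det = 0 := by
    intro n l v h
    rw [det_pow_eq l v h.le, permSign_eq_zero v h]; simp
  by_cases h1 : ∑ i ∈ Finset.range (nRot w), i < (expR w u).sum
  · rw [key T _ (by rw [hT]; omega)]
    rw [permSign_eq_zero (fun i : Fin (nRef w) => (expT w u).getD i 0) (by rw [hT]; omega)]
    simp
  by_cases h2 : ∑ i ∈ Finset.range (nRef w), i < (expT w u).sum
  · rw [key R _ (by rw [hR]; omega)]
    rw [permSign_eq_zero (fun i : Fin (nRot w) => (expR w u).getD i 0) (by rw [hR]; omega)]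
    simp
  split_ifs with h3
  · rw [det_pow_eq R _ (by rw [hR]; omega), det_pow_eq T _ (by rw [hT]; omega),
      listPow_eq_one _ _ h3]
    push_cast; ring
  · by_cases h4 : (expR w u).sum < ∑ i ∈ Finset.range (nRot w), i
    · rw [key R _ (by rw [hR]; omega)]; simp
    · rw [key T _ (by rw [hT]; omega)]; simp

theorem altSum_sum {K M ι : Type*} [AddCommGroup M] (w : List Slot) {r f : ℕ}
    (R : Fin r → K) (T : Fin f → K) (C : List K) (s : Finset ι) (F : ι → List K → M) :
    altSum w R T C (fun x => ∑ i ∈ s, F i x) = ∑ i ∈ s, altSum w R T C (F i) := by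
  simp only [altSum, Finset.smul_sum]
  exact (Finset.sum_congr rfl fun σ _ => Finset.sum_comm).trans Finset.sum_comm

/-- Alternating sums of polynomials of minimal degree are integer multiples of products of
Vandermonde determinants. -/
theorem exists_altSum_eq (w : List Slot) (P : MvPolynomial ℕ ℤ) (hP : P.totalDegree ≤
      ∑ i ∈ Finset.range (nRot w), i + ∑ i ∈ Finset.range (nRef w), i) :
    ∃ c : ℤ, ∀ (K : Type) [CommRing K] (R : Fin (nRot w) → K) (T : Fin (nRef w) → K) (C : List K),
      C.length = nCon w → altSum w R T C (fun x => MvPolynomial.aeval (fun i => x.getD i 0) P) =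
        (c : K) * ((vandermonde R).det * (vandermonde T).det) := by
  refine ⟨∑ v ∈ P.support, if v.support ⊆ Finset.range w.length then
    MvPolynomial.coeff v P * monoCoeff w v else 0, fun K _ R T C hC => ?_⟩
  have hval : ∀ x : List K, MvPolynomial.aeval (fun i => x.getD i 0) P =
      ∑ v ∈ P.support, ((MvPolynomial.coeff v P : ℤ) : K) * ∏ i ∈ v.support, x.getD i 0 ^ v i := by
    intro x
    rw [MvPolynomial.aeval_def, MvPolynomial.eval₂_eq]
    rfl
  simp only [hval]
  rw [altSum_sum]
  push_cast
  rw [Finset.sum_mul]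
  refine Finset.sum_congr rfl fun v hv => ?_
  have hlen : ∀ (σ : Perm (Fin (nRot w))) (τ : Perm (Fin (nRef w))),
    (fill w (List.ofFn fun i => R (σ i)) (List.ofFn fun i => T (τ i)) C).length = w.length :=
    fun σ τ => length_fill w _ _ _ (by simp) (by simp) hC
  split_ifs with hsub
  · have hsum : ∑ i ∈ Finset.range w.length, v i ≤ P.totalDegree := by
      refine le_trans (le_of_eq ?_) (MvPolynomial.le_totalDegree hv)
      rw [Finsupp.sum]
      symm
      exact Finset.sum_subset hsub (fun i _ hi => by simpa using hi)
    have := altSum_monoVal_eq w R T C hC v (hsum.trans hP)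
    rw [mul_assoc, ← this, altSum, altSum, Finset.mul_sum]
    refine Finset.sum_congr rfl fun σ _ => ?_
    rw [Finset.mul_sum]
    refine Finset.sum_congr rfl fun τ _ => ?_
    rw [monoVal_eq_prod, hlen, Finset.prod_subset hsub (fun i _ hi => by
      rw [Finsupp.notMem_support_iff.mp hi, pow_zero])]
    simp only [zsmul_eq_mul]; ring
  · rw [zero_mul, altSum]
    refine Finset.sum_eq_zero fun σ _ => Finset.sum_eq_zero fun τ _ => ?_
    obtain ⟨i, hi, hi2⟩ := Finset.not_subset.mp hsub
    rw [Finset.prod_eq_zero hi]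
    · simp
    · rw [List.getD_eq_default _ _ (by rw [hlen]; simpa using hi2), zero_pow]
      exact Finsupp.mem_support_iff.mp hi

/-- A letter of a program: its slot, the power of the letter to multiply by, and whether the
first and the last of the previously visited points of its class are skipped. -/
structure Instr where
  slot : Slot
  pad : ℕ
  dropFst : Bool
  dropLst : Bool

def Slot.isRef : Slot → Bool
  | .rot => false
  | .ref => true
  | .frot => false
  | .fref => true

/-- `l`, without its first element when `b` holds. -/
def cutFst {α : Type*} (b : Bool) (l : List α) : List α := bif b then l.tail else l

/-- `l`, without its last element when `b` holds. -/
def cutLst {α : Type*} (b : Bool) (l : List α) : List α := bif b then l.dropLast else l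

section Walk
variable {K : Type*} [CommRing K]

/-- The product of differences of visited points along a walk in a dihedral group. The lists `own`
and `other` hold the points visited in the class of the current point and in the other class. -/
def walk : List Instr → List K → List K → List K → K
  | i :: q, x :: xs, own, other =>
    bif i.slot.isRef then
      x ^ i.pad * ((cutLst i.dropLst (cutFst i.dropFst other)).map
        (fun u => x - own.headD 0 - u)).prod * walk q xs ((x - own.headD 0) :: other) own
    else
      x ^ i.pad * ((cutLst i.dropLst own.tail).map (fun u => own.headD 0 + x - u)).prod *
        walk q xs ((own.headD 0 + x) :: own) other
  | _, _, _, _ => 1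

theorem map_cutFst {α β : Type*} (f : α → β) (b : Bool) (l : List α) :
    (cutFst b l).map f = cutFst b (l.map f) := by cases b <;> simp [cutFst]

theorem map_cutLst {α β : Type*} (f : α → β) (b : Bool) (l : List α) :
    (cutLst b l).map f = cutLst b (l.map f) := by cases b <;> simp [cutLst, List.map_dropLast]

theorem length_cutFst {α : Type*} (b : Bool) (l : List α) :
    (cutFst b l).length = l.length - b.toNat := by cases b <;> simp [cutFst]

theorem length_cutLst {α : Type*} (b : Bool) (l : List α) :
    (cutLst b l).length = l.length - b.toNat := by cases b <;> simp [cutLst]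

theorem mem_of_mem_cutFst {α : Type*} {b : Bool} {l : List α} {x : α} (h : x ∈ cutFst b l) :
    x ∈ l := by
  cases b
  · exact h
  · exact List.mem_of_mem_tail h

theorem mem_of_mem_cutLst {α : Type*} {b : Bool} {l : List α} {x : α} (h : x ∈ cutLst b l) :
    x ∈ l := by
  cases b
  · exact h
  · exact List.mem_of_mem_dropLast h

theorem walk_map {L : Type*} [CommRing L] (φ : K →+* L) (q : List Instr) :
    ∀ xs own other : List K, φ (walk q xs own other) =
      walk q (xs.map φ) (own.map φ) (other.map φ) := by
  induction q with
  | nil => intros; simp [walk]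
  | cons i q ih =>
    intro xs own other
    cases xs with
    | nil => simp [walk]
    | cons x xs =>
      have hh : (own.map φ).headD 0 = φ (own.headD 0) := by cases own <;> simp
      cases h : i.slot.isRef
      · simp only [walk, h, cond_false, List.map_cons, map_mul, map_pow, map_list_prod, ih, hh,
          map_add, ← List.map_tail, ← map_cutLst, List.map_map]
        simp [Function.comp_def]
      · simp only [walk, h, cond_true, List.map_cons, map_mul, map_pow, map_list_prod, ih, hh,
          map_sub, ← map_cutFst, ← map_cutLst, List.map_map]
        simp [Function.comp_def]

/-- A bound for the degree of `walk`. -/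
def walkDeg : List Instr → ℕ → ℕ → ℕ
  | i :: q, a, b =>
    bif i.slot.isRef then i.pad + (b - i.dropFst.toNat - i.dropLst.toNat) + walkDeg q (b + 1) a
    else i.pad + (a - 1 - i.dropLst.toNat) + walkDeg q (a + 1) b
  | [], _, _ => 0

theorem totalDegree_prod_le (l : List (MvPolynomial ℕ ℤ)) (h : ∀ p ∈ l, p.totalDegree ≤ 1) :
    l.prod.totalDegree ≤ l.length := by
  refine (MvPolynomial.totalDegree_list_prod l).trans ?_
  have := List.sum_le_card_nsmul (l.map MvPolynomial.totalDegree) 1 (by simpa using h)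
  simpa using this

theorem totalDegree_walk_le (q : List Instr) : ∀ xs own other : List (MvPolynomial ℕ ℤ),
    (∀ p ∈ xs, p.totalDegree ≤ 1) → (∀ p ∈ own, p.totalDegree ≤ 1) →
    (∀ p ∈ other, p.totalDegree ≤ 1) →
    (walk q xs own other).totalDegree ≤ walkDeg q own.length other.length := by
  induction q with
  | nil => intros; simp [walk]
  | cons i q ih =>
    intro xs own other hx ho ho'
    cases xs with
    | nil => simp [walk]
    | cons x xs =>
      have hh : (own.headD 0).totalDegree ≤ 1 := by
        cases own with
        | nil => simp
        | cons a l => exact ho a (by simp)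
      have hx0 : x.totalDegree ≤ 1 := hx x (by simp)
      have hx1 : ∀ p ∈ xs, p.totalDegree ≤ 1 := fun p hp => hx p (by simp [hp])
      have hpow : (x ^ i.pad).totalDegree ≤ i.pad :=
        (MvPolynomial.totalDegree_pow _ _).trans (by nlinarith)
      have hsub : ∀ p q : MvPolynomial ℕ ℤ, p.totalDegree ≤ 1 → q.totalDegree ≤ 1 →
          (p - q).totalDegree ≤ 1 := fun p q hp hq =>
        (MvPolynomial.totalDegree_sub _ _).trans (max_le hp hq)
      cases h : i.slot.isRef
      · have hv : (own.headD 0 + x).totalDegree ≤ 1 :=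
          (MvPolynomial.totalDegree_add _ _).trans (max_le hh hx0)
        simp only [walk, walkDeg, h, cond_false]
        refine (MvPolynomial.totalDegree_mul _ _).trans (add_le_add
          ((MvPolynomial.totalDegree_mul _ _).trans (add_le_add hpow ?_)) ?_)
        · refine (totalDegree_prod_le _ ?_).trans ?_
          · intro p hp
            obtain ⟨u, hu, rfl⟩ := List.mem_map.mp hp
            exact hsub _ _ hv (ho u (List.mem_of_mem_tail (mem_of_mem_cutLst hu)))
          · simp [length_cutLst]
        · refine (ih xs _ _ hx1 ?_ ho').trans (by simp)
          exact fun p hp => (List.mem_cons.mp hp).elim (fun e => e ▸ hv) (ho p)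
      · have hv : (x - own.headD 0).totalDegree ≤ 1 := hsub _ _ hx0 hh
        simp only [walk, walkDeg, h, cond_true]
        refine (MvPolynomial.totalDegree_mul _ _).trans (add_le_add
          ((MvPolynomial.totalDegree_mul _ _).trans (add_le_add hpow ?_)) ?_)
        · refine (totalDegree_prod_le _ ?_).trans ?_
          · intro p hp
            obtain ⟨u, hu, rfl⟩ := List.mem_map.mp hp
            exact hsub _ _ hv (ho' u (mem_of_mem_cutFst (mem_of_mem_cutLst hu)))
          · simp [length_cutLst, length_cutFst]
        · refine (ih xs _ _ hx1 ?_ ho).trans (by simp)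
          exact fun p hp => (List.mem_cons.mp hp).elim (fun e => e ▸ hv) (ho' p)

end Walk

/-- `exists_altSum_eq` for walks. -/
theorem exists_altSum_walk_eq (q : List Instr) (hq : walkDeg q 1 0 ≤
      ∑ i ∈ Finset.range (nRot (q.map Instr.slot)), i +
      ∑ i ∈ Finset.range (nRef (q.map Instr.slot)), i) :
    ∃ c : ℤ, ∀ (K : Type) [CommRing K] (R : Fin (nRot (q.map Instr.slot)) → K)
      (T : Fin (nRef (q.map Instr.slot)) → K) (C : List K), C.length = nCon (q.map Instr.slot) →
      altSum (q.map Instr.slot) R T C (fun xs => walk q xs [0] []) =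
        (c : K) * ((Matrix.vandermonde R).det * (Matrix.vandermonde T).det) := by
  set P : MvPolynomial ℕ ℤ := walk q (List.ofFn fun i : Fin q.length => MvPolynomial.X i) [0] []
    with hPdef
  have hP : P.totalDegree ≤ walkDeg q 1 0 := by
    refine totalDegree_walk_le q _ _ _ ?_ (by simp) (by simp)
    simp [List.mem_ofFn, MvPolynomial.totalDegree_X]
  obtain ⟨c, hc⟩ := exists_altSum_eq (q.map Instr.slot) P (hP.trans hq)
  refine ⟨c, fun K _ R T C hC => ?_⟩
  rw [← hc K R T C hC, altSum, altSum]
  refine Finset.sum_congr rfl fun σ _ => Finset.sum_congr rfl fun τ _ => ?_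
  congr 1
  set xs := fill (q.map Instr.slot) (List.ofFn fun i => R (σ i)) (List.ofFn fun i => T (τ i)) C
    with hxs
  have hlen : xs.length = q.length := by
    rw [hxs, length_fill _ _ _ _ (by simp) (by simp) hC, List.length_map]
  have := walk_map (MvPolynomial.aeval (R := ℤ) (fun i => xs.getD i 0)).toRingHom q
    (List.ofFn fun i : Fin q.length => MvPolynomial.X i) [0] []
  simp only [AlgHom.toRingHom_eq_coe, RingHom.coe_coe, List.map_cons, map_zero, List.map_nil]
      at this
  rw [hPdef, this]
  congr 1
  apply List.ext_getElem
  · simp [hlen]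
  · intro i h1 h2
    simp [h1]

/-! ### From nonvanishing walks to sequencings -/

section Glue

/-- Continuing from the point `g` with the letters `l`, no point of `V` is visited, except that
the last point may be the identity, and no point is visited twice. -/
def Avoids {G : Type*} [Group G] : List G → G → List G → Prop
  | _, _, [] => True
  | V, g, x :: l => (g * x ∈ V → l = [] ∧ g * x = 1) ∧ Avoids (g * x :: V) (g * x) l

theorem Avoids.ne {G : Type*} [Group G] (l : List G) : ∀ (V : List G) (g : G), Avoids V g l →
    (∀ j, 1 ≤ j → j ≤ l.length → g * PartialSum l j ∈ V →
      j = l.length ∧ g * PartialSum l j = 1) ∧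
    ∀ i j, 1 ≤ i → i < j → j ≤ l.length → g * PartialSum l i = g * PartialSum l j →
      j = l.length ∧ g * PartialSum l j = 1 := by
  induction l with
  | nil => intro V g _; exact ⟨fun j h1 h2 => by simp at h2; omega,
      fun i j h1 h2 h3 => by simp at h3; omega⟩
  | cons x l ih =>
    rintro V g ⟨h1, h2⟩
    obtain ⟨i1, i2⟩ := ih _ _ h2
    have hs : ∀ j, g * PartialSum (x :: l) (j + 1) = g * x * PartialSum l j := fun j => by
      simp [PartialSum, mul_assoc]
    have hs0 : PartialSum l 0 = 1 := by simp [PartialSum]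
    constructor
    · intro j hj1 hj2 hj
      obtain ⟨j, rfl⟩ : ∃ j', j = j' + 1 := ⟨j - 1, by omega⟩
      rw [hs] at hj ⊢
      rcases Nat.eq_zero_or_pos j with rfl | hp
      · rw [hs0, mul_one] at hj ⊢
        obtain ⟨rfl, h⟩ := h1 hj
        exact ⟨rfl, h⟩
      · obtain ⟨h, h'⟩ := i1 j hp (by simpa using hj2) (List.mem_cons_of_mem _ hj)
        exact ⟨by simp [h], h'⟩
    · intro i j hi hij hj he
      obtain ⟨j, rfl⟩ : ∃ j', j = j' + 1 := ⟨j - 1, by omega⟩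
      obtain ⟨i, rfl⟩ : ∃ j', i = j' + 1 := ⟨i - 1, by omega⟩
      rw [hs] at he ⊢
      rw [hs] at he
      rcases Nat.eq_zero_or_pos i with rfl | hp
      · rw [hs0, mul_one] at he
        obtain ⟨h, h'⟩ := i1 j (by omega) (by simpa using hj) (by rw [← he]; simp)
        exact ⟨by simp [h], h'⟩
      · obtain ⟨h, h'⟩ := i2 i j hp (by omega) (by simpa using hj) he
        exact ⟨by simp [h], h'⟩

theorem sequenceable_of_avoids {G : Type*} [Group G] {S : Finset G} (l : List G) (hl : l.Nodup)
    (hS : ∀ g, g ∈ l ↔ g ∈ S) (h : Avoids [1] 1 l) : Sequenceable S := by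
  refine ⟨l, hl, by ext g; simp [hS], fun i j hij hj hn he => ?_⟩
  obtain ⟨a, b⟩ := h.ne
  simp only [one_mul] at a b
  have hs0 : PartialSum l 0 = 1 := by simp [PartialSum]
  rcases Nat.eq_zero_or_pos i with rfl | hi
  · obtain ⟨h, -⟩ := a j hij hj (by rw [← he, hs0]; simp)
    exact hn ⟨rfl, h⟩
  · obtain ⟨h, h'⟩ := b i j hi hij hj he
    -- the last partial sum is the identity, and so is an earlier one
    obtain ⟨h2, -⟩ := a i hi (by omega) (by rw [he, h']; simp)
    omega

/-- Skipping is only allowed at points known to be different for other reasons. -/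
def validProg : List Instr → Bool → Bool → Bool
  | [], _, _ => true
  | i :: q, same, prev =>
    bif i.slot.isRef then (!i.dropFst || prev) && (!i.dropLst || (q.isEmpty && !same)) &&
      validProg q (!same) true
    else (!i.dropLst || (q.isEmpty && same)) && validProg q same false

variable {m : ℕ}

def dVal : DihedralGroup m → ZMod m
  | .r a => a
  | .sr a => a

def dRef : DihedralGroup m → Bool
  | .r _ => false
  | .sr _ => true

/-- The point with value `v`, in the class of the rotations if `b` holds. -/
def dPoint (b : Bool) (v : ZMod m) : DihedralGroup m := bif b then .r v else .sr v

theorem dPoint_injective {b : Bool} {u v : ZMod m} (h : dPoint b u = dPoint b v) : u = v := by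
  cases b <;> simpa [dPoint] using h

theorem dPoint_eq_one {b : Bool} {u : ZMod m} : dPoint b u = 1 ↔ b = true ∧ u = 0 := by
  cases b
  · simp only [dPoint, cond_false, Bool.false_eq_true, false_and, iff_false]
    exact fun h => nomatch h
  · simp only [dPoint, cond_true, true_and]
    exact ⟨fun h => DihedralGroup.r.inj h, fun h => by rw [h]; rfl⟩

theorem walk_ne_zero_imp [Fact m.Prime] (q : List Instr) :
    ∀ (l : List (DihedralGroup m)) (same prev : Bool) (v : ZMod m) (own other : List (ZMod m)),
    validProg q same prev = true → List.Forall₂ (fun i g => dRef g = i.slot.isRef) q l →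
    l.Nodup → 1 ∉ l → walk q (l.map dVal) (v :: own) other ≠ 0 →
    (prev = true → ∃ u o, other = u :: o ∧ .sr (u + v) ∉ l) →
    (∃ o, bif same then v :: own = o ++ [0] else other = o ++ [0]) →
    ∀ V : List (DihedralGroup m),
      (∀ u, dPoint same u ∈ V → u ∈ v :: own) → (∀ u, dPoint (!same) u ∈ V → u ∈ other) →
      Avoids V (dPoint same v) l := by
  induction q with
  | nil =>
    intro l _ _ _ _ _ _ hf
    cases hf
    intros; trivial
  | cons i q ih =>
    intro l same prev v own other hval hf hnd h1 hw hprev hend V hV hV'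
    cases hf with
    | @cons _ g _ l hg hf =>
    have hend' : ∀ L : List (ZMod m), (∃ o, L = o ++ [0]) → ∀ u ∈ L, u ∉ L.dropLast → u = 0 := by
      rintro L ⟨o, rfl⟩ u hu hu'
      simp only [List.dropLast_concat, List.mem_append, List.mem_singleton] at hu hu'
      tauto
    obtain ⟨hnd1, hnd2⟩ := List.nodup_cons.mp hnd
    have h1' : 1 ∉ l := fun h => h1 (List.mem_cons_of_mem _ h)
    cases g with
    | r a =>
      have hr : i.slot.isRef = false := hg.symm
      have ha : a ≠ 0 := by
        rintro rfl; exact h1 (List.mem_cons_self ..)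
      simp only [List.map_cons, walk, hr, cond_false, dVal, List.headD_cons, List.tail_cons] at hw
      simp only [validProg, hr, cond_false, Bool.and_eq_true] at hval
      have hw1 := left_ne_zero_of_mul hw
      have hw2 := right_ne_zero_of_mul hw
      have hw3 := right_ne_zero_of_mul hw1
      have hnot : v + a ∉ cutLst i.dropLst own := fun hm => hw3 (List.prod_eq_zero
        (List.mem_map.mpr ⟨_, hm, sub_self _⟩))
      have hp : dPoint same v * .r a = dPoint same (v + a) := by cases same <;> simp [dPoint]
      refine ⟨fun hmem => ?_, ?_⟩
      · rw [hp] at hmem ⊢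
        have hm2 := hV _ hmem
        have hm3 : v + a ∈ own := by
          rcases List.mem_cons.mp hm2 with h | h
          · exact absurd (by simpa using h) ha
          · exact h
        cases hd : i.dropLst with
        | false => exact absurd hm3 (by simpa [cutLst, hd] using hnot)
        | true =>
          simp only [hd, Bool.not_true, Bool.false_or, Bool.and_eq_true, List.isEmpty_iff] at hval
          obtain ⟨⟨rfl, rfl⟩, -⟩ := hval
          cases hf
          refine ⟨rfl, dPoint_eq_one.mpr ⟨rfl, ?_⟩⟩
          obtain ⟨o, ho⟩ := hend
          simp only [cond_true] at ho
          refine hend' _ ⟨o, ho⟩ _ hm2 ?_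
          have hne : own ≠ [] := List.ne_nil_of_mem hm3
          rw [List.dropLast_cons_of_ne_nil hne, List.mem_cons, not_or]
          exact ⟨by simpa using ha, by simpa [cutLst, hd] using hnot⟩
      · rw [hp]
        refine ih l same false (v + a) (v :: own) other hval.2 hf hnd2 h1' hw2 (by simp) ?_ _ ?_ ?_
        · obtain ⟨o, ho⟩ := hend
          cases same
          · exact ⟨o, ho⟩
          · exact ⟨(v + a) :: o, by simpa using ho⟩
        · intro u hu
          rcases List.mem_cons.mp hu with h | h
          · rw [dPoint_injective h]; simp
          · exact List.mem_cons_of_mem _ (hV _ h)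
        · intro u hu
          rcases List.mem_cons.mp hu with h | h
          · cases same <;> simp [dPoint] at h
          · exact hV' _ h
    | sr b =>
      have hr : i.slot.isRef = true := hg.symm
      simp only [List.map_cons, walk, hr, cond_true, dVal, List.headD_cons] at hw
      simp only [validProg, hr, cond_true, Bool.and_eq_true] at hval
      have hw1 := left_ne_zero_of_mul hw
      have hw2 := right_ne_zero_of_mul hw
      have hw3 := right_ne_zero_of_mul hw1
      have hnot : b - v ∉ cutLst i.dropLst (cutFst i.dropFst other) := fun hm => hw3
        (List.prod_eq_zero (List.mem_map.mpr ⟨_, hm, sub_self _⟩))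
      have hp : dPoint same v * .sr b = dPoint (!same) (b - v) := by cases same <;> simp [dPoint]
      refine ⟨fun hmem => ?_, ?_⟩
      · rw [hp] at hmem ⊢
        have hm2 := hV' _ hmem
        have hfst : b - v ∈ cutFst i.dropFst other ∧ ∀ z, z ∉ (cutFst i.dropFst other).dropLast →
            z = b - v → z ∉ other.dropLast := by
          cases hd : i.dropFst with
          | false => exact ⟨hm2, fun z hz _ => hz⟩
          | true =>
            simp only [hd, Bool.not_true, Bool.false_or] at hval
            obtain ⟨u, o, rfl, huv⟩ := hprev hval.1.1
            have hne : b - v ≠ u := by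
              rintro rfl; exact huv (by simp)
            have hmo : b - v ∈ o := by
              rcases List.mem_cons.mp hm2 with h | h
              · exact absurd h hne
              · exact h
            refine ⟨by simpa [cutFst] using hmo, ?_⟩
            rintro z hz rfl
            rw [List.dropLast_cons_of_ne_nil (List.ne_nil_of_mem hmo), List.mem_cons, not_or]
            exact ⟨hne, by simpa [cutFst] using hz⟩
        cases hd : i.dropLst with
        | false => exact absurd hfst.1 (by simpa [cutLst, hd] using hnot)
        | true =>
          simp only [hd, Bool.not_true, Bool.false_or, Bool.and_eq_true, List.isEmpty_iff,
            Bool.not_eq_true'] at hval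
          obtain ⟨⟨-, rfl, rfl⟩, -⟩ := hval
          cases hf
          refine ⟨rfl, dPoint_eq_one.mpr ⟨rfl, ?_⟩⟩
          obtain ⟨o, ho⟩ := hend
          simp only [cond_false] at ho
          refine hend' _ ⟨o, ho⟩ _ hm2 (hfst.2 _ ?_ rfl)
          simpa [cutLst, hd] using hnot
      · rw [hp]
        refine ih l (!same) true (b - v) other (v :: own) hval.2 hf hnd2 h1' hw2 ?_ ?_ _ ?_ ?_
        · exact fun _ => ⟨v, own, rfl, by simpa using hnd1⟩
        · obtain ⟨o, ho⟩ := hend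
          cases same
          · exact ⟨(b - v) :: o, by simpa using ho⟩
          · exact ⟨o, by simpa using ho⟩
        · intro u hu
          rcases List.mem_cons.mp hu with h | h
          · rw [dPoint_injective h]; simp
          · exact List.mem_cons_of_mem _ (hV' _ h)
        · intro u hu
          rw [Bool.not_not] at hu
          rcases List.mem_cons.mp hu with h | h
          · cases same <;> simp [dPoint] at h
          · exact hV _ h

theorem sequenceable_of_walk_ne_zero [Fact m.Prime] {S : Finset (DihedralGroup m)}
    (q : List Instr) (l : List (DihedralGroup m)) (hval : validProg q true false = true)
    (hf : List.Forall₂ (fun i g => dRef g = i.slot.isRef) q l) (hnd : l.Nodup)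
    (hS : ∀ g, g ∈ l ↔ g ∈ S) (h1 : 1 ∉ S) (hw : walk q (l.map dVal) [0] [] ≠ 0) :
    Sequenceable S := by
  refine sequenceable_of_avoids l hnd hS ?_
  have h1l : 1 ∉ l := by rwa [hS]
  have := walk_ne_zero_imp q l true false 0 [] [] hval hf hnd h1l hw (by simp) ⟨[], rfl⟩ [1]
    (by intro u hu; simp only [List.mem_singleton] at hu ⊢; exact (dPoint_eq_one.mp hu).2)
    (by intro u hu; simp only [List.mem_singleton] at hu; exact absurd (dPoint_eq_one.mp hu).1
          (by simp))
  simpa [dPoint] using this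

end Glue

/-! ### Expanding alternating sums along the first letter -/

section Expansion
open Equiv

theorem sum_sign_smul_succ {α M : Type*} [AddCommGroup M] {n : ℕ} (G : (Fin (n + 1) → α) → M)
    (R : Fin (n + 1) → α) :
    ∑ σ : Perm (Fin (n + 1)), (Perm.sign σ : ℤ) • G (fun i => R (σ i)) =
      ∑ τ : Perm (Fin n), (Perm.sign τ : ℤ) •
        G (Fin.cons (R 0) fun i => R (τ i).succ) -
      ∑ j : Fin n, ∑ τ : Perm (Fin n), (Perm.sign τ : ℤ) •
        G (Fin.cons (R j.succ) fun i => Function.update (fun i => R i.succ) j (R 0) (τ i)) := by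
  rw [← Equiv.sum_comp Perm.decomposeFin.symm, Fintype.sum_prod_type, Fin.sum_univ_succ,
    sub_eq_add_neg, ← Finset.sum_neg_distrib]
  congr 1
  · refine Finset.sum_congr rfl fun τ _ => ?_
    rw [Perm.decomposeFin.symm_sign]
    simp only [if_true, one_mul]
    congr 2
    funext i
    refine Fin.cases ?_ (fun i => ?_) i <;> simp
  · refine Finset.sum_congr rfl fun j _ => ?_
    rw [← Finset.sum_neg_distrib]
    refine Finset.sum_congr rfl fun τ _ => ?_
    rw [Perm.decomposeFin.symm_sign, if_neg (Fin.succ_ne_zero j)]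
    simp only [Units.val_neg, neg_mul, one_mul, neg_smul]
    congr 3
    funext i
    refine Fin.cases ?_ (fun i => ?_) i
    · simp
    · rw [Perm.decomposeFin_symm_apply_succ, Fin.cons_succ]
      by_cases h : τ i = j
      · subst h; simp
      · rw [Function.update_of_ne h, swap_apply_of_ne_of_ne (Fin.succ_ne_zero _)]
        simpa using h

theorem altSum_rot {α M : Type*} [AddCommGroup M] (w : List Slot) {r f : ℕ}
    (R : Fin (r + 1) → α) (T : Fin f → α) (C : List α) (F : List α → M) :
    altSum (.rot :: w) R T C F = altSum w (fun i => R i.succ) T C (fun xs => F (R 0 :: xs)) -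
      ∑ j : Fin r, altSum w (Function.update (fun i => R i.succ) j (R 0)) T C
        (fun xs => F (R j.succ :: xs)) := by
  have := sum_sign_smul_succ (fun R' => ∑ τ : Perm (Fin f), (Perm.sign τ : ℤ) •
    F (fill (.rot :: w) (List.ofFn R') (List.ofFn fun i => T (τ i)) C)) R
  simp only [Finset.smul_sum, smul_smul] at this
  rw [altSum, this]
  simp only [List.ofFn_succ, Fin.cons_zero, Fin.cons_succ]
  rfl

theorem altSum_ref {α M : Type*} [AddCommGroup M] (w : List Slot) {r f : ℕ}
    (R : Fin r → α) (T : Fin (f + 1) → α) (C : List α) (F : List α → M) :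
    altSum (.ref :: w) R T C F = altSum w R (fun i => T i.succ) C (fun xs => F (T 0 :: xs)) -
      ∑ j : Fin f, altSum w R (Function.update (fun i => T i.succ) j (T 0)) C
        (fun xs => F (T j.succ :: xs)) := by
  have key : ∀ σ : Perm (Fin r), _ := fun σ => sum_sign_smul_succ (fun T' =>
    (Perm.sign σ : ℤ) • F (fill (.ref :: w) (List.ofFn fun i => R (σ i)) (List.ofFn T') C)) T
  simp only [smul_smul] at key
  have hc : ∀ {f' : ℕ} (w' : List Slot) (T' : Fin f' → α) (F' : List α → M),
      altSum w' R T' C F' = ∑ σ : Perm (Fin r), ∑ τ : Perm (Fin f'),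
        ((Perm.sign τ : ℤ) * (Perm.sign σ : ℤ)) •
          F' (fill w' (List.ofFn fun i => R (σ i)) (List.ofFn fun i => T' (τ i)) C) :=
    fun w' T' F' => Finset.sum_congr rfl fun σ _ => Finset.sum_congr rfl fun τ _ => by
      rw [mul_comm]
  simp only [hc]
  rw [Finset.sum_congr rfl fun σ _ => key σ, Finset.sum_sub_distrib]
  congr 1
  · simp [List.ofFn_succ, fill]
  · rw [Finset.sum_comm]
    simp [List.ofFn_succ, fill]

theorem altSum_const_mul {α : Type*} (w : List Slot) {r f : ℕ}
    (R : Fin r → α) (T : Fin f → α) (C : List α) (a : ℤ) (F : List α → ℤ) :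
    altSum w R T C (fun xs => a * F xs) = a * altSum w R T C F := by
  simp only [altSum, Finset.mul_sum, smul_eq_mul]
  exact Finset.sum_congr rfl fun σ _ => Finset.sum_congr rfl fun τ _ => by ring

end Expansion

/-! ### An evaluator for alternating sums of walks

The evaluator only uses recursors and natural numbers. Integers are stored with offset `64`.
A running total `acc` is threaded through; the value zero signals a failure. -/

section Evaluator

noncomputable def kForce (x : ℕ) (f : ℕ → ℕ) : ℕ :=
  Nat.rec (motive := fun _ => ℕ) 0 (fun n _ => f n.succ) x

noncomputable def kHead (l : List ℕ) : ℕ :=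
  List.rec (motive := fun _ => ℕ) 64 (fun a _ _ => a) l

noncomputable def kTail (l : List ℕ) : List ℕ :=
  List.rec (motive := fun _ => List ℕ) [] (fun _ l _ => l) l

noncomputable def kDropLast (l : List ℕ) : List ℕ :=
  List.rec (motive := fun _ => List ℕ) []
    (fun a l ih => List.rec (motive := fun _ => List ℕ) [] (fun _ _ _ => a :: ih) l) l

noncomputable def kCut (g : List ℕ → List ℕ) (b : Bool) (l : List ℕ) : List ℕ :=
  Bool.rec (motive := fun _ => List ℕ) l (g l) b

/-- Multiply the weight by `a - b`. -/
noncomputable def kFactor (a b acc : ℕ) (k : ℕ → ℕ → ℕ) (w s : ℕ) : ℕ :=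
  Bool.rec (motive := fun _ => ℕ) (k (Nat.mul w (Nat.sub b a)) (Nat.succ s))
    (Bool.rec (motive := fun _ => ℕ) (k (Nat.mul w (Nat.sub a b)) s) acc (Nat.ble a b))
    (Nat.ble b a)

noncomputable def kProd (v acc : ℕ) (k : ℕ → ℕ → ℕ) (us : List ℕ) : ℕ → ℕ → ℕ :=
  List.rec (motive := fun _ => ℕ → ℕ → ℕ) k (fun u _ ih => kFactor v u acc ih) us

noncomputable def kPow (a acc : ℕ) (k : ℕ → ℕ → ℕ) (n : ℕ) : ℕ → ℕ → ℕ :=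
  Nat.rec (motive := fun _ => ℕ → ℕ → ℕ) k (fun _ ih => kFactor a 64 acc ih) n

noncomputable def kPickTail (f : ℕ → List ℕ → ℕ → ℕ → ℕ) (a s : ℕ) (l : List ℕ) :
    List ℕ → ℕ → ℕ :=
  List.rec (motive := fun _ => List ℕ → ℕ → ℕ) (fun _ acc => acc)
    (fun b l ih pre acc => kForce (f b (List.reverseAux pre (a :: l)) s acc) (ih (b :: pre))) l

/-- Sum over all choices of an element of a list; a chosen element is replaced by the head. -/
noncomputable def kPick (f : ℕ → List ℕ → ℕ → ℕ → ℕ) (l : List ℕ) (s acc : ℕ) : ℕ :=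
  List.rec (motive := fun _ => ℕ) acc
    (fun a l _ => kForce (f a l s acc) (kPickTail f a (Nat.succ s) l [])) l

noncomputable def kLeaf (w s acc : ℕ) : ℕ :=
  Bool.rec (motive := fun _ => ℕ) (Nat.sub acc w) (kForce acc fun a => Nat.add a w)
    (Nat.beq (Nat.mod s 2) 0)

noncomputable def kStep (v a acc pad : ℕ) (us : List ℕ) (k : ℕ → ℕ → ℕ → ℕ) (w s : ℕ) : ℕ :=
  kForce v fun v => kPow a acc (kProd v acc (fun w s => kForce w fun w => kForce s fun s =>
    k v w s) us) pad w s

/-- Evaluate the alternating sum of a walk. -/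
noncomputable def kEval (q : List Instr) :
    List ℕ → List ℕ → List ℕ → List ℕ → List ℕ → ℕ → ℕ → ℕ → ℕ :=
  List.rec (motive := fun _ =>
      List ℕ → List ℕ → List ℕ → List ℕ → List ℕ → ℕ → ℕ → ℕ → ℕ)
    (fun _ _ _ _ _ w s acc => kLeaf w s acc)
    (fun i _ ih own other R T C w s acc => Instr.rec (motive := fun _ => ℕ)
      (fun slot pad d d' => Slot.rec (motive := fun _ => ℕ)
        (kPick (fun a R s acc => kStep (Nat.sub (Nat.add (kHead own) a) 64) a acc pad
          (kCut kDropLast d' (kTail own))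
          (fun v w s => ih (v :: own) other R T C w s acc) w s) R s acc)
        (kPick (fun a T s acc => kStep (Nat.sub (Nat.add 64 a) (kHead own)) a acc pad
          (kCut kDropLast d' (kCut kTail d other))
          (fun v w s => ih (v :: other) own R T C w s acc) w s) T s acc)
        (kStep (Nat.sub (Nat.add (kHead own) (kHead C)) 64) (kHead C) acc pad
          (kCut kDropLast d' (kTail own))
          (fun v w s => ih (v :: own) other R T (kTail C) w s acc) w s)
        (kStep (Nat.sub (Nat.add 64 (kHead C)) (kHead own)) (kHead C) acc pad
          (kCut kDropLast d' (kCut kTail d other))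
          (fun v w s => ih (v :: other) own R T (kTail C) w s acc) w s)
        slot) i) q

def dec (n : ℕ) : ℤ := (n : ℤ) - 64

/-- Unless the result signals a failure, `x` was added to the running total. -/
def Adds (res acc : ℕ) (x : ℤ) : Prop := res ≠ 0 → acc ≠ 0 ∧ (res : ℤ) = acc + x

/-- The continuation `k` multiplies the signed weight by `x` and adds it to the total. -/
def AddsMul (k : ℕ → ℕ → ℕ) (acc : ℕ) (x : ℤ) : Prop :=
  ∀ w s, Adds (k w s) acc ((-1) ^ s * w * x)

theorem Adds.zero (acc : ℕ) : Adds acc acc 0 := fun h => ⟨h, by simp⟩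

theorem Adds.kForce {x acc : ℕ} {f : ℕ → ℕ} {y : ℤ} (h : x ≠ 0 → Adds (f x) acc y) :
    Adds (_root_.kForce x f) acc y := by
  cases x with
  | zero => exact fun h => absurd rfl h
  | succ n => exact h (by simp)

theorem Adds.trans {res mid acc : ℕ} {x y : ℤ} (h : Adds mid acc x) (h' : Adds res mid y) :
    Adds res acc (x + y) := fun hr => by
  obtain ⟨a, b⟩ := h' hr
  obtain ⟨c, d⟩ := h a
  exact ⟨c, by rw [b, d]; ring⟩

theorem Adds.kForce_seq {mid acc : ℕ} {f : ℕ → ℕ} {x y : ℤ} (h : Adds mid acc x)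
    (h' : Adds (f mid) mid y) : Adds (_root_.kForce mid f) acc (x + y) :=
  Adds.kForce fun _ => h.trans h'

theorem Adds.congr {res acc : ℕ} {x y : ℤ} (h : Adds res acc x) (e : x = y) : Adds res acc y :=
  e ▸ h

theorem AddsMul.congr {k : ℕ → ℕ → ℕ} {acc : ℕ} {x y : ℤ} (h : AddsMul k acc x) (e : x = y) :
    AddsMul k acc y :=
  e ▸ h

theorem kHead_eq (l : List ℕ) : dec (kHead l) = (l.map dec).headD 0 := by
  cases l <;> simp [kHead, dec]

theorem kTail_eq (l : List ℕ) : kTail l = l.tail := by cases l <;> rfl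

theorem kDropLast_eq (l : List ℕ) : kDropLast l = l.dropLast := by
  induction l with
  | nil => rfl
  | cons a l ih =>
    cases l with
    | nil => rfl
    | cons b l => rw [List.dropLast_cons_of_ne_nil (by simp), ← ih]; rfl

theorem kCut_dropLast (b : Bool) (l : List ℕ) : kCut kDropLast b l = cutLst b l := by
  cases b
  · rfl
  · exact kDropLast_eq l

theorem kCut_tail (b : Bool) (l : List ℕ) : kCut kTail b l = cutFst b l := by
  cases b
  · rfl
  · exact kTail_eq l

theorem addsMul_kFactor {a b acc : ℕ} {k : ℕ → ℕ → ℕ} {x : ℤ} (h : AddsMul k acc x) :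
    AddsMul (kFactor a b acc k) acc ((dec a - dec b) * x) := by
  intro w s
  have hab : dec a - dec b = (a : ℤ) - b := by simp [dec]
  rw [hab]
  unfold kFactor
  cases h1 : Nat.ble b a
  · have hlt : ¬ b ≤ a := fun h => by rw [Nat.ble_eq_true_of_le h] at h1; simp at h1
    have := h (w * (b - a)) (s + 1)
    rw [Nat.cast_mul, Nat.cast_sub (by omega)] at this
    exact this.congr (by ring)
  · have hle := Nat.le_of_ble_eq_true h1
    cases h2 : Nat.ble a b
    · have := h (w * (a - b)) s
      rw [Nat.cast_mul, Nat.cast_sub hle] at this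
      exact this.congr (by ring)
    · have : a = b := le_antisymm (Nat.le_of_ble_eq_true h2) hle
      subst this
      simpa using Adds.zero acc

theorem addsMul_kProd {v acc : ℕ} {k : ℕ → ℕ → ℕ} {x : ℤ} (h : AddsMul k acc x) (us : List ℕ) :
    AddsMul (kProd v acc k us) acc (((us.map dec).map (fun u => dec v - u)).prod * x) := by
  induction us with
  | nil => exact h.congr (by simp)
  | cons u us ih =>
    rw [List.map_cons, List.map_cons, List.prod_cons, mul_assoc]
    exact addsMul_kFactor ih

theorem addsMul_kPow {a acc : ℕ} {k : ℕ → ℕ → ℕ} {x : ℤ} (h : AddsMul k acc x) (n : ℕ) :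
    AddsMul (kPow a acc k n) acc (dec a ^ n * x) := by
  induction n with
  | zero => exact h.congr (by simp)
  | succ n ih =>
    exact (addsMul_kFactor (a := a) (b := 64) ih).congr (by simp only [dec]; push_cast; ring)

theorem addsMul_kStep {v a acc pad : ℕ} {us : List ℕ} {k : ℕ → ℕ → ℕ → ℕ} {x : ℤ}
    {z : ℤ} (hz : v ≠ 0 → dec v = z) (h : v ≠ 0 → AddsMul (k v) acc x) :
    AddsMul (kStep v a acc pad us k) acc
      (dec a ^ pad * ((us.map dec).map (fun u => z - u)).prod * x) := by
  intro w s
  refine Adds.kForce fun hv => ?_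
  rw [← hz hv]
  rw [mul_assoc (dec a ^ pad)]
  refine addsMul_kPow (addsMul_kProd (fun w s => ?_) us) pad w s
  exact Adds.kForce fun _ => Adds.kForce fun _ => h hv w s

theorem adds_kLeaf (w s acc : ℕ) : Adds (kLeaf w s acc) acc ((-1) ^ s * w) := by
  unfold kLeaf
  rcases Nat.mod_two_eq_zero_or_one s with h | h
  · have h' : (-1 : ℤ) ^ s = 1 := (Nat.even_iff.mpr h).neg_one_pow
    rw [show Nat.mod s 2 = 0 from h, h', one_mul]
    exact Adds.kForce fun ha _ => ⟨ha, by simp⟩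
  · have h' : (-1 : ℤ) ^ s = -1 := (Nat.odd_iff.mpr h).neg_one_pow
    rw [show Nat.mod s 2 = 1 from h, h']
    intro (hr : acc - w ≠ 0)
    refine ⟨by omega, ?_⟩
    change ((acc - w : ℕ) : ℤ) = _
    rw [Nat.cast_sub (by omega)]; ring

theorem adds_kPickTail {n : ℕ} {f : ℕ → List ℕ → ℕ → ℕ → ℕ} {a s : ℕ} {g : ℕ → List ℕ → ℤ}
    (h : ∀ b l acc, l.length = n → Adds (f b l s acc) acc (g b l)) (l : List ℕ) :
    ∀ (pre : List ℕ) (acc : ℕ), pre.length + l.length = n →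
    Adds (kPickTail f a s l pre acc) acc
      (∑ j : Fin l.length, g l[j] (pre.reverse ++ l.set j a)) := by
  induction l with
  | nil => intro pre acc _; exact (Adds.zero acc).congr (by simp)
  | cons b l ih =>
    intro pre acc hn
    simp only [List.length_cons] at hn
    have := Adds.kForce_seq (h b (List.reverseAux pre (a :: l)) acc
      (by simp [List.reverseAux_eq]; omega)) (ih (b :: pre) _ (by simp; omega))
    refine Adds.congr (res := kPickTail f a s (b :: l) pre acc) this ?_
    refine Eq.trans ?_ (Fin.sum_univ_succ (n := l.length) _).symm
    simp [List.reverseAux_eq]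

theorem adds_kPick {f : ℕ → List ℕ → ℕ → ℕ → ℕ} {a s acc : ℕ} {l : List ℕ} {g : ℕ → List ℕ → ℤ}
    (h : ∀ b l' s acc, l'.length = l.length → Adds (f b l' s acc) acc ((-1) ^ s * g b l')) :
    Adds (kPick f (a :: l) s acc) acc
      ((-1) ^ s * (g a l - ∑ j : Fin l.length, g l[j] (l.set j a))) := by
  have := Adds.kForce_seq (h a l s acc rfl)
    (adds_kPickTail (a := a) (fun b l' => h b l' (s + 1)) l [] (f a l s acc) (by simp))
  refine Adds.congr (res := kPick f (a :: l) s acc) this ?_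
  rw [mul_sub, pow_succ, ← Finset.mul_sum]
  simp
  ring

theorem dec_rot {u a : ℕ} (h : Nat.sub (Nat.add u a) 64 ≠ 0) :
    dec (Nat.sub (Nat.add u a) 64) = dec u + dec a := by
  change (u + a) - 64 ≠ 0 at h
  change (((u + a) - 64 : ℕ) : ℤ) - 64 = ((u : ℤ) - 64) + ((a : ℤ) - 64)
  omega

theorem dec_ref {u a : ℕ} (h : Nat.sub (Nat.add 64 a) u ≠ 0) :
    dec (Nat.sub (Nat.add 64 a) u) = dec a - dec u := by
  change (64 + a) - u ≠ 0 at h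
  change (((64 + a) - u : ℕ) : ℤ) - 64 = ((a : ℤ) - 64) - ((u : ℤ) - 64)
  omega

def decFun (n : ℕ) (l : List ℕ) : Fin n → ℤ := fun i => dec (l.getD i 64)

theorem decFun_set {n : ℕ} (l : List ℕ) (hl : l.length = n) (a : ℕ) (j : Fin n) :
    decFun n (l.set j a) = Function.update (decFun n l) j (dec a) := by
  subst hl
  funext i
  by_cases h : i = j
  · subst h; simp [decFun]
  · have h' : (j : ℕ) ≠ i := fun e => h (Fin.ext e.symm)
    simp [decFun, Function.update_of_ne h, h']

theorem altSum_nil {α M : Type*} [AddCommGroup M] (R T : Fin 0 → α) (C : List α)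
    (F : List α → M) : altSum [] R T C F = F [] := by
  simp [altSum, fill]

section StepValues
variable {w : List Slot} {r f : ℕ} (R : Fin r → ℤ) (T : Fin f → ℤ) (C : List ℤ)
  (pad : ℕ) (d d' : Bool) (q : List Instr)

theorem altSum_walk_of_not_isRef {s : Slot} (hs : s.isRef = false) (x : ℤ) (own other : List ℕ) :
    altSum w R T C (fun xs => walk (⟨s, pad, d, d'⟩ :: q) (x :: xs) (own.map dec)
      (other.map dec)) = x ^ pad * (((kCut kDropLast d' (kTail own)).map dec).map
        (fun u => dec (kHead own) + x - u)).prod * altSum w R T C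
          (fun xs => walk q xs ((dec (kHead own) + x) :: own.map dec) (other.map dec)) := by
  rw [← altSum_const_mul]
  simp only [walk, hs, cond_false, kCut_dropLast, kTail_eq, kHead_eq, map_cutLst, List.map_tail]

theorem altSum_walk_of_isRef {s : Slot} (hs : s.isRef = true) (x : ℤ) (own other : List ℕ) :
    altSum w R T C (fun xs => walk (⟨s, pad, d, d'⟩ :: q) (x :: xs) (own.map dec)
      (other.map dec)) = x ^ pad * (((kCut kDropLast d' (kCut kTail d other)).map dec).map
        (fun u => x - dec (kHead own) - u)).prod * altSum w R T C
          (fun xs => walk q xs ((x - dec (kHead own)) :: other.map dec) (own.map dec)) := by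
  rw [← altSum_const_mul]
  simp only [walk, hs, cond_true, kCut_dropLast, kCut_tail, kHead_eq, map_cutLst, map_cutFst]

end StepValues

theorem altSum_rot_dec {M : Type*} [AddCommGroup M] (w : List Slot) {n f : ℕ} (a : ℕ) (l : List ℕ)
    (hl : l.length = n) (T : Fin f → ℤ) (C : List ℤ) (F : List ℤ → M) :
    altSum (.rot :: w) (decFun (n + 1) (a :: l)) T C F =
      altSum w (decFun n l) T C (fun xs => F (dec a :: xs)) -
        ∑ j : Fin l.length, altSum w (decFun n (l.set j a)) T C (fun xs => F (dec l[j] :: xs)) := by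
  subst hl
  rw [altSum_rot]
  congr 1
  refine Finset.sum_congr rfl fun j _ => ?_
  rw [decFun_set l rfl]
  have hd : decFun l.length l = fun i : Fin l.length => dec l[(i : ℕ)] := by funext i; simp [decFun]
  rw [hd]
  simp [decFun]

theorem altSum_ref_dec {M : Type*} [AddCommGroup M] (w : List Slot) {n r : ℕ} (a : ℕ) (l : List ℕ)
    (hl : l.length = n) (R : Fin r → ℤ) (C : List ℤ) (F : List ℤ → M) :
    altSum (.ref :: w) R (decFun (n + 1) (a :: l)) C F =
      altSum w R (decFun n l) C (fun xs => F (dec a :: xs)) -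
        ∑ j : Fin l.length, altSum w R (decFun n (l.set j a)) C (fun xs => F (dec l[j] :: xs)) := by
  subst hl
  rw [altSum_ref]
  congr 1
  refine Finset.sum_congr rfl fun j _ => ?_
  rw [decFun_set l rfl]
  have hd : decFun l.length l = fun i : Fin l.length => dec l[(i : ℕ)] := by funext i; simp [decFun]
  rw [hd]
  simp [decFun]

theorem adds_kEval (q : List Instr) : ∀ (own other R T C : List ℕ) (acc : ℕ),
    R.length = nRot (q.map Instr.slot) → T.length = nRef (q.map Instr.slot) →
    C.length = nCon (q.map Instr.slot) →
    AddsMul (fun w s => kEval q own other R T C w s acc) acc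
      (altSum (q.map Instr.slot) (decFun (nRot (q.map Instr.slot)) R)
        (decFun (nRef (q.map Instr.slot)) T) (C.map dec)
        (fun xs => walk q xs (own.map dec) (other.map dec))) := by
  induction q with
  | nil =>
    intro own other R T C acc hR hT hC w s
    exact (adds_kLeaf w s acc).congr (by rw [List.map_nil]; erw [altSum_nil]; simp [walk])
  | cons i q ih =>
    intro own other R T C acc hR hT hC
    obtain ⟨slot, pad, d, d'⟩ := i
    cases slot
    · cases R with
      | nil => simp [nRot] at hR
      | cons a R =>
      have hR' : R.length = nRot (q.map Instr.slot) := by simpa [nRot] using hR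
      intro w s
      let g : ℕ → List ℕ → ℤ := fun b l => altSum (q.map Instr.slot)
        (decFun (nRot (q.map Instr.slot)) l) (decFun (nRef (q.map Instr.slot)) T) (C.map dec)
        (fun xs => walk (⟨.rot, pad, d, d'⟩ :: q) (dec b :: xs) (own.map dec) (other.map dec))
      refine Adds.congr (adds_kPick (a := a) (l := R) (g := fun b l => w * g b l)
        fun b l s acc hl => ?_) ?_
      · rw [← mul_assoc]
        simp only [g]
        rw [altSum_walk_of_not_isRef _ _ _ _ _ _ _ rfl]
        exact addsMul_kStep (k := fun v w s => kEval q (v :: own) other l T C w s acc)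
          dec_rot (fun hv => dec_rot hv ▸ ih _ _ _ _ _ _ (hl.trans hR') hT hC) w s
      · have := altSum_rot_dec (q.map Instr.slot) a R hR'
          (decFun (nRef (q.map Instr.slot)) T) (C.map dec)
          (fun xs => walk (⟨.rot, pad, d, d'⟩ :: q) xs (own.map dec) (other.map dec))
        refine Eq.trans ?_ (congrArg (fun z => (-1 : ℤ) ^ s * w * z) this.symm)
        rw [mul_assoc, ← Finset.mul_sum, ← mul_sub]
    · cases T with
      | nil => simp [nRef] at hT
      | cons a T =>
      have hT' : T.length = nRef (q.map Instr.slot) := by simpa [nRef] using hT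
      intro w s
      let g : ℕ → List ℕ → ℤ := fun b l => altSum (q.map Instr.slot)
        (decFun (nRot (q.map Instr.slot)) R) (decFun (nRef (q.map Instr.slot)) l) (C.map dec)
        (fun xs => walk (⟨.ref, pad, d, d'⟩ :: q) (dec b :: xs) (own.map dec) (other.map dec))
      refine Adds.congr (adds_kPick (a := a) (l := T) (g := fun b l => w * g b l)
        fun b l s acc hl => ?_) ?_
      · rw [← mul_assoc]
        simp only [g]
        rw [altSum_walk_of_isRef _ _ _ _ _ _ _ rfl]
        exact addsMul_kStep (k := fun v w s => kEval q (v :: other) own R l C w s acc)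
          dec_ref (fun hv => dec_ref hv ▸ ih _ _ _ _ _ _ hR (hl.trans hT') hC) w s
      · have := altSum_ref_dec (q.map Instr.slot) a T hT'
          (decFun (nRot (q.map Instr.slot)) R) (C.map dec)
          (fun xs => walk (⟨.ref, pad, d, d'⟩ :: q) xs (own.map dec) (other.map dec))
        refine Eq.trans ?_ (congrArg (fun z => (-1 : ℤ) ^ s * w * z) this.symm)
        rw [mul_assoc, ← Finset.mul_sum, ← mul_sub]
    · cases C with
      | nil => simp [nCon] at hC
      | cons c C =>
      have hC' : C.length = nCon (q.map Instr.slot) := by simpa [nCon] using hC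
      refine AddsMul.congr ?_ (altSum_walk_of_not_isRef (w := q.map Instr.slot)
        (decFun (nRot (q.map Instr.slot)) R) (decFun (nRef (q.map Instr.slot)) T) (C.map dec)
        pad d d' q (s := .frot) rfl (dec c) own other).symm
      exact addsMul_kStep (k := fun v w s => kEval q (v :: own) other R T C w s acc)
        dec_rot (fun hv => dec_rot hv ▸ ih _ _ _ _ _ _ hR hT hC')
    · cases C with
      | nil => simp [nCon] at hC
      | cons c C =>
      have hC' : C.length = nCon (q.map Instr.slot) := by simpa [nCon] using hC
      refine AddsMul.congr ?_ (altSum_walk_of_isRef (w := q.map Instr.slot)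
        (decFun (nRot (q.map Instr.slot)) R) (decFun (nRef (q.map Instr.slot)) T) (C.map dec)
        pad d d' q (s := .fref) rfl (dec c) own other).symm
      exact addsMul_kStep (k := fun v w s => kEval q (v :: other) own R T C w s acc)
        dec_ref (fun hv => dec_ref hv ▸ ih _ _ _ _ _ _ hR hT hC')

end Evaluator

/-! ### Certificates -/

section Certificates

def nFrot : List Slot → ℕ
  | [] => 0
  | .frot :: w => nFrot w + 1
  | _ :: w => nFrot w

def nFref : List Slot → ℕ
  | [] => 0
  | .fref :: w => nFref w + 1
  | _ :: w => nFref w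

theorem nCon_eq (w : List Slot) : nCon w = nFrot w + nFref w := by
  induction w with
  | nil => rfl
  | cons s w ih => cases s <;> simp [nCon, nFrot, nFref, ih] <;> omega

theorem fill_perm {α : Type*} (w : List Slot) : ∀ R T C : List α, R.length = nRot w →
    T.length = nRef w → C.length = nCon w → (fill w R T C).Perm (R ++ (T ++ C)) := by
  induction w with
  | nil =>
    intro R T C hR hT hC
    simp only [nRot, nRef, nCon, List.length_eq_zero_iff] at hR hT hC
    subst hR hT hC
    simp [fill]
  | cons s w ih =>
    intro R T C hR hT hC
    cases s
    · cases R with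
      | nil => simp [nRot] at hR
      | cons a R => simpa [fill] using ih R T C (by simpa [nRot] using hR) hT hC
    · cases T with
      | nil => simp [nRef] at hT
      | cons a T =>
        refine ((ih R T C hR (by simpa [nRef] using hT) hC).cons a).trans ?_
        simpa using (List.perm_middle (l₁ := R)).symm
    · cases C with
      | nil => simp [nCon] at hC
      | cons a C =>
        refine ((ih R T C hR hT (by simpa [nCon] using hC)).cons a).trans ?_
        simpa using (List.perm_middle (l₁ := R ++ T)).symm
    · cases C with
      | nil => simp [nCon] at hC
      | cons a C =>
        refine ((ih R T C hR hT (by simpa [nCon] using hC)).cons a).trans ?_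
        simpa using (List.perm_middle (l₁ := R ++ T)).symm

theorem exists_constants {α : Type*} (b : α → Bool) (w : List Slot) : ∀ A B : List α,
    A.length = nFrot w → B.length = nFref w → (∀ g ∈ A, b g = false) → (∀ g ∈ B, b g = true) →
    ∃ C : List α, C.Perm (A ++ B) ∧ ∀ R T : List α, R.length = nRot w → T.length = nRef w →
      (∀ g ∈ R, b g = false) → (∀ g ∈ T, b g = true) →
      List.Forall₂ (fun s g => b g = s.isRef) w (fill w R T C) := by
  induction w with
  | nil =>
    intro A B hA hB _ _
    simp only [nFrot, nFref, List.length_eq_zero_iff] at hA hB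
    subst hA hB
    exact ⟨[], List.Perm.refl _, fun R T _ _ _ _ => List.Forall₂.nil⟩
  | cons s w ih =>
    intro A B hA hB hbA hbB
    cases s
    · obtain ⟨C, hC, h⟩ := ih A B hA hB hbA hbB
      refine ⟨C, hC, fun R T hR hT hbR hbT => ?_⟩
      cases R with
      | nil => simp [nRot] at hR
      | cons a R =>
        exact .cons (hbR a (by simp)) (h R T (by simpa [nRot] using hR) hT
          (fun g hg => hbR g (by simp [hg])) hbT)
    · obtain ⟨C, hC, h⟩ := ih A B hA hB hbA hbB
      refine ⟨C, hC, fun R T hR hT hbR hbT => ?_⟩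
      cases T with
      | nil => simp [nRef] at hT
      | cons a T =>
        exact .cons (hbT a (by simp)) (h R T hR (by simpa [nRef] using hT) hbR
          (fun g hg => hbT g (by simp [hg])))
    · cases A with
      | nil => simp [nFrot] at hA
      | cons a A =>
        obtain ⟨C, hC, h⟩ := ih A B (by simpa [nFrot] using hA) hB
          (fun g hg => hbA g (by simp [hg])) hbB
        exact ⟨a :: C, hC.cons a, fun R T hR hT hbR hbT =>
          .cons (hbA a (by simp)) (h R T hR hT hbR hbT)⟩
    · cases B with
      | nil => simp [nFref] at hB
      | cons a B =>
        obtain ⟨C, hC, h⟩ := ih A B hA (by simpa [nFref] using hB) hbA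
          (fun g hg => hbB g (by simp [hg]))
        exact ⟨a :: C, (hC.cons a).trans List.perm_middle.symm, fun R T hR hT hbR hbT =>
          .cons (hbB a (by simp)) (h R T hR hT hbR hbT)⟩

/-- A program, values for its variables and constants, and the resulting alternating sum. The
integers are stored with offset `64`. -/
structure Cert where
  prog : List Instr
  rots : List ℕ
  refs : List ℕ
  cons : List ℕ
  value : ℕ

/-- Validity of a certificate for `r` rotations and `f` reflections; the value has offset `o`. -/
noncomputable def Cert.check (o r f : ℕ) (c : Cert) : Bool :=
  validProg c.prog true false &&
  Nat.ble (walkDeg c.prog 1 0) (nRot (c.prog.map Instr.slot) * (nRot (c.prog.map Instr.slot) - 1) /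
      2
    + nRef (c.prog.map Instr.slot) * (nRef (c.prog.map Instr.slot) - 1) / 2) &&
  Nat.beq (nRot (c.prog.map Instr.slot) + nFrot (c.prog.map Instr.slot)) r &&
  Nat.beq (nRef (c.prog.map Instr.slot) + nFref (c.prog.map Instr.slot)) f &&
  Nat.beq c.rots.length (nRot (c.prog.map Instr.slot)) &&
  Nat.beq c.refs.length (nRef (c.prog.map Instr.slot)) &&
  Nat.beq c.cons.length (nCon (c.prog.map Instr.slot)) &&
  Nat.ble 1 c.value &&
  Nat.beq (kEval c.prog [64] [] c.rots c.refs c.cons 1 2 o) c.value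

def Cert.abs (o : ℕ) (c : Cert) : ℕ := (c.value - o) + (o - c.value)

/-- Valid certificates whose values have no common prime factor larger than necessary. -/
noncomputable def checkCerts (o r f : ℕ) (cs : List Cert) : Bool :=
  cs.all (Cert.check o r f) &&
  Nat.beq ((Nat.factorial (max 4 (max r (f - 1))) ^ 100) %
    (cs.foldr (fun c g => Nat.gcd (c.abs o) g) 0)) 0

theorem dvd_foldr_gcd (o p : ℕ) (cs : List Cert) (h : ∀ c ∈ cs, p ∣ c.abs o) :
    p ∣ cs.foldr (fun c g => Nat.gcd (c.abs o) g) 0 := by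
  induction cs with
  | nil => simp
  | cons c cs ih =>
    exact Nat.dvd_gcd (h c (by simp)) (ih fun c hc => h c (by simp [hc]))

variable {m : ℕ}

theorem dVal_injective {g h : DihedralGroup m} (hr : dRef g = dRef h) (hv : dVal g = dVal h) :
    g = h := by
  cases g <;> cases h <;> simp_all [dVal, dRef]

theorem Cert.sequenceable [Fact m.Prime] {S : Finset (DihedralGroup m)} (h1 : 1 ∉ S) {o r f : ℕ}
    (hr : (S.filter (fun g => dRef g = false)).card = r)
    (hf : (S.filter (fun g => dRef g = true)).card = f)
    (c : Cert) (hc : c.check o r f = true) (hm : ¬ m ∣ c.abs o) : Sequenceable S := by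
  simp only [Cert.check, Bool.and_eq_true, Nat.beq_eq, Nat.ble_eq] at hc
  obtain ⟨⟨⟨⟨⟨⟨⟨⟨hval, hdeg⟩, hnr⟩, hnf⟩, hlr⟩, hlt⟩, hlc⟩, hpos⟩, hev⟩ := hc
  set w := c.prog.map Instr.slot with hw
  obtain ⟨k, hk⟩ := exists_altSum_walk_eq c.prog (by
    rw [Finset.sum_range_id, Finset.sum_range_id]; exact hdeg)
  rw [← hw] at hk
  -- the integer `k` is nonzero modulo `m`
  have hk0 : ((k : ℤ) : ZMod m) ≠ 0 := by
    intro h0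
    have hadd := adds_kEval c.prog [64] [] c.rots c.refs c.cons o hlr hlt hlc 1 2
    obtain ⟨-, hadd⟩ := hadd (by simp only [hev]; omega)
    simp only [hev] at hadd
    have hkz := hk ℤ (decFun _ c.rots) (decFun _ c.refs) (c.cons.map dec) (by simpa using hlc)
    have h64 : ([64] : List ℕ).map dec = [0] := by simp [dec]
    rw [h64, List.map_nil, ← hw, hkz] at hadd
    have hdvd : (m : ℤ) ∣ (c.value : ℤ) - o := by
      have : (c.value : ℤ) - o = k * ((Matrix.vandermonde (decFun (nRot w) c.rots)).det *
          (Matrix.vandermonde (decFun (nRef w) c.refs)).det) := by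
        rw [hadd]; push_cast; ring
      rw [this]
      exact Dvd.dvd.mul_right ((ZMod.intCast_zmod_eq_zero_iff_dvd k m).mp h0) _
    apply hm
    rw [← Int.natCast_dvd_natCast]
    unfold Cert.abs
    rcases le_total c.value o with h | h
    · rw [Nat.sub_eq_zero_of_le h, zero_add, Nat.cast_sub h]
      exact (dvd_sub_comm).mp (by simpa using hdvd)
    · rw [Nat.sub_eq_zero_of_le h, add_zero, Nat.cast_sub h]
      simpa using hdvd
  -- distribute the elements of `S`
  set L₁ := (S.filter (fun g => dRef g = false)).toList with hL₁
  set L₂ := (S.filter (fun g => dRef g = true)).toList with hL₂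
  have hlen₁ : L₁.length = r := by rw [hL₁, Finset.length_toList, hr]
  have hlen₂ : L₂.length = f := by rw [hL₂, Finset.length_toList, hf]
  have hb₁ : ∀ g ∈ L₁, dRef g = false := fun g hg => by
    rw [hL₁, Finset.mem_toList, Finset.mem_filter] at hg; exact hg.2
  have hb₂ : ∀ g ∈ L₂, dRef g = true := fun g hg => by
    rw [hL₂, Finset.mem_toList, Finset.mem_filter] at hg; exact hg.2
  have hnd₁ : L₁.Nodup := Finset.nodup_toList _
  have hnd₂ : L₂.Nodup := Finset.nodup_toList _
  obtain ⟨C, hC, hforall⟩ := exists_constants dRef w (L₁.drop (nRot w)) (L₂.drop (nRef w))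
    (by rw [List.length_drop]; omega) (by rw [List.length_drop]; omega)
    (fun g hg => hb₁ g (List.mem_of_mem_drop hg)) (fun g hg => hb₂ g (List.mem_of_mem_drop hg))
  have hClen : C.length = nCon w := by
    rw [hC.length_eq, List.length_append, List.length_drop, List.length_drop, nCon_eq]; omega
  have hR : (nRot w) ≤ L₁.length := by omega
  have hT : (nRef w) ≤ L₂.length := by omega
  let R : Fin (nRot w) → DihedralGroup m := fun i => L₁[(i : ℕ)]
  let T : Fin (nRef w) → DihedralGroup m := fun i => L₂[(i : ℕ)]
  have hRof : List.ofFn R = L₁.take (nRot w) := by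
    apply List.ext_getElem
    · simp [hR]
    · intro i h1 h2; simp [R]
  have hTof : List.ofFn T = L₂.take (nRef w) := by
    apply List.ext_getElem
    · simp [hT]
    · intro i h1 h2; simp [T]
  have hRinj : Function.Injective fun i => dVal (R i) := by
    intro i j hij
    have := dVal_injective (by rw [hb₁ _ (List.getElem_mem _), hb₁ _ (List.getElem_mem _)]) hij
    exact Fin.ext ((hnd₁.getElem_inj_iff).mp this)
  have hTinj : Function.Injective fun i => dVal (T i) := by
    intro i j hij
    have := dVal_injective (by rw [hb₂ _ (List.getElem_mem _), hb₂ _ (List.getElem_mem _)]) hij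
    exact Fin.ext ((hnd₂.getElem_inj_iff).mp this)
  have hne : altSum w (fun i => dVal (R i)) (fun i => dVal (T i)) (C.map dVal)
      (fun xs => walk c.prog xs [0] []) ≠ 0 := by
    rw [hk (ZMod m) _ _ _ (by simpa using hClen)]
    exact mul_ne_zero hk0 (mul_ne_zero (Matrix.det_vandermonde_ne_zero_iff.mpr hRinj)
      (Matrix.det_vandermonde_ne_zero_iff.mpr hTinj))
  obtain ⟨σ, -, hσ⟩ := Finset.exists_ne_zero_of_sum_ne_zero hne
  obtain ⟨τ, -, hτ⟩ := Finset.exists_ne_zero_of_sum_ne_zero hσ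
  have hwalk := right_ne_zero_of_smul hτ
  set l := fill w (List.ofFn fun i => R (σ i)) (List.ofFn fun i => T (τ i)) C with hl
  have hpR : (List.ofFn fun i => R (σ i)).Perm (L₁.take (nRot w)) := by
    rw [← hRof]; exact Equiv.Perm.ofFn_comp_perm σ R
  have hpT : (List.ofFn fun i => T (τ i)).Perm (L₂.take (nRef w)) := by
    rw [← hTof]; exact Equiv.Perm.ofFn_comp_perm τ T
  have hperm : l.Perm (L₁ ++ L₂) := by
    refine (fill_perm w _ _ _ (by simp) (by simp) hClen).trans ?_
    refine (hpR.append (hpT.append hC)).trans ?_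
    conv_rhs => rw [← List.take_append_drop (nRot w) L₁, ← List.take_append_drop (nRef w) L₂]
    rw [List.append_assoc]
    refine List.Perm.append_left _ ?_
    rw [← List.append_assoc, ← List.append_assoc]
    exact List.Perm.append_right _ List.perm_append_comm
  have hfor := hforall (List.ofFn fun i => R (σ i)) (List.ofFn fun i => T (τ i)) (by simp)
    (by simp) (fun g hg => hb₁ g (List.mem_of_mem_take (hpR.mem_iff.mp hg)))
    (fun g hg => hb₂ g (List.mem_of_mem_take (hpT.mem_iff.mp hg)))
  refine sequenceable_of_walk_ne_zero c.prog l hval ?_ ?_ ?_ h1 ?_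
  · exact (List.forall₂_map_left_iff).mp hfor
  · rw [hperm.nodup_iff, List.nodup_append]
    refine ⟨hnd₁, hnd₂, fun a ha b hb hab => ?_⟩
    have h1 := hb₁ a ha
    have h2 := hb₂ b hb
    rw [hab, h2] at h1
    exact Bool.noConfusion h1
  · intro g
    rw [hperm.mem_iff, List.mem_append, hL₁, hL₂, Finset.mem_toList, Finset.mem_toList,
      Finset.mem_filter, Finset.mem_filter]
    cases dRef g <;> simp
  · rw [hl, map_fill, List.map_ofFn, List.map_ofFn]
    exact hwalk

theorem sequenceable_of_checkCerts (hm : m.Prime) (hm3 : 3 < m) {S : Finset (DihedralGroup m)}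
    (h1 : 1 ∉ S) {o r f : ℕ} (hr : (S.filter (fun g => dRef g = false)).card = r)
    (hf : (S.filter (fun g => dRef g = true)).card = f) (cs : List Cert)
    (hcs : checkCerts o r f cs = true) : Sequenceable S := by
  have := Fact.mk hm
  have : NeZero m := ⟨hm.ne_zero⟩
  simp only [checkCerts, Bool.and_eq_true, Nat.beq_eq, List.all_eq_true] at hcs
  obtain ⟨hall, hgcd⟩ := hcs
  by_contra hS
  have hdvd : m ∣ cs.foldr (fun c g => Nat.gcd (c.abs o) g) 0 := dvd_foldr_gcd o m cs fun c hc => by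
    by_contra h
    exact hS (c.sequenceable h1 hr hf (hall c hc) h)
  have hle := (hm.dvd_factorial).mp
    (hm.dvd_of_dvd_pow (hdvd.trans (Nat.dvd_of_mod_eq_zero hgcd)))
  have h4 : m ≠ 4 := by rintro rfl; exact absurd hm (by decide)
  have hrm : r < m := by
    have : ((S.filter (fun g => dRef g = false)).image dVal).card ≤
        (Finset.univ.erase (0 : ZMod m)).card := by
      refine Finset.card_le_card fun x hx => ?_
      obtain ⟨g, hg, rfl⟩ := Finset.mem_image.mp hx
      rw [Finset.mem_filter] at hg
      refine Finset.mem_erase.mpr ⟨fun h0 => ?_, Finset.mem_univ _⟩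
      have : g = 1 := dVal_injective (hg.2.trans rfl) (h0.trans rfl)
      exact h1 (this ▸ hg.1)
    rw [Finset.card_image_of_injOn, hr, Finset.card_erase_of_mem (Finset.mem_univ _),
      Finset.card_univ, ZMod.card] at this
    · have := hm.pos; omega
    · intro a ha b hb hab
      simp only [Finset.coe_filter, Set.mem_ofPred_eq] at ha hb
      exact dVal_injective (ha.2.trans hb.2.symm) hab
  have hfm : f ≤ m := by
    have : ((S.filter (fun g => dRef g = true)).image dVal).card ≤
        (Finset.univ : Finset (ZMod m)).card := Finset.card_le_univ _
    rw [Finset.card_image_of_injOn, hf, Finset.card_univ, ZMod.card] at this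
    · exact this
    · intro a ha b hb hab
      simp only [Finset.coe_filter, Set.mem_ofPred_eq] at ha hb
      exact dVal_injective (ha.2.trans hb.2.symm) hab
  omega

end Certificates

section SuffixSums
variable {K : Type*} [CommRing K]

/-- The sums of the nonempty suffixes of a list, longest suffix first. -/
def sufSums : List K → List K
  | [] => []
  | x :: l => (x :: l).sum :: sufSums l

/-- The product of all differences of two non-neighbouring suffix sums. -/
def gapProd : List K → K
  | [] => 1
  | x :: l => ((sufSums l ++ [0]).tail.map fun u => (x :: l).sum - u).prod * gapProd l

/-- The sequencing polynomial of `x₀ :: z₀ :: t`, where the total sum is replaced by `y`,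
padded by a linear factor. -/
def seqPoly (b : Bool) (x₀ z₀ : K) (t : List K) (y : K) : K :=
  (if b then x₀ else t.sum) * ((sufSums t).map fun u => y - u).prod * gapProd (z₀ :: t)

/-- Expansion of a determinant of powers along a row, with columns encoded by bits. -/
def bitLap (s : K) : (List Bool → K) → List Bool → K
  | _, [] => 0
  | a, false :: p => s * bitLap s (fun q => a (false :: q)) p
  | a, true :: p => a (false :: p) - s * bitLap s (fun q => a (true :: q)) p

/-- The positions of the true bits, counted from `o`. -/
def ones : ℕ → List Bool → List ℕ
  | _, [] => []
  | o, false :: p => ones (o + 1) p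
  | o, true :: p => o :: ones (o + 1) p

/-- Iterated row expansion, with the squares of the suffix sums as additional factors. -/
noncomputable def bitDet : List K → List Bool → K
  | [], p => if ones 0 p = [] then 1 else 0
  | x :: l, p => (x :: l).sum ^ 2 * bitLap (x :: l).sum (bitDet l) p

def expLap (s : K) : (List ℕ → K) → List ℕ → K
  | _, [] => 0
  | a, u :: v => s ^ u * a v - expLap s (fun w => a (u :: w)) v

noncomputable def expDet : List K → List ℕ → K
  | [], v => if v = [] then 1 else 0
  | s :: l, v => expLap s (expDet l) v

def vdmProd : List K → K
  | [] => 1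
  | s :: l => (l.map fun u => u - s).prod * vdmProd l

theorem length_sufSums (l : List K) : (sufSums l).length = l.length := by
  induction l with
  | nil => rfl
  | cons x l ih => simp [sufSums, ih]

theorem bitLap_mul_left (s c : K) (p : List Bool) : ∀ a : List Bool → K,
    bitLap s (fun q => c * a q) p = c * bitLap s a p := by
  induction p with
  | nil => intro a; simp [bitLap]
  | cons b p ih =>
    intro a
    cases b
    · simp only [bitLap]; rw [ih fun q => a (false :: q)]; ring
    · simp only [bitLap]; rw [ih fun q => a (true :: q)]; ring

theorem pow_mul_bitLap (s : K) (p : List Bool) : ∀ (o : ℕ) (a : List ℕ → K),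
    s ^ o * bitLap s (fun q => a (ones o q)) p = expLap s a (ones o p) := by
  induction p with
  | nil => intro o a; simp [bitLap, ones, expLap]
  | cons b p ih =>
    intro o a
    cases b
    · simp only [bitLap, ones]; rw [← ih]; ring
    · simp only [bitLap, ones, expLap]; rw [← ih]; ring

theorem bitDet_eq (l : List K) : ∀ p : List Bool,
    bitDet l p = ((sufSums l).map fun u => u ^ 2).prod * expDet (sufSums l) (ones 0 p) := by
  induction l with
  | nil => intro p; simp [bitDet, sufSums, expDet]
  | cons x l ih =>
    intro p
    have h : bitDet l = fun p => ((sufSums l).map fun u => u ^ 2).prod *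
      (expDet (sufSums l) (ones 0 p)) := funext ih
    have h2 := pow_mul_bitLap (x :: l).sum p 0 (expDet (sufSums l))
    rw [pow_zero, one_mul] at h2
    rw [bitDet, h, bitLap_mul_left, h2]
    simp only [sufSums, expDet, List.map_cons, List.prod_cons]
    ring

theorem expLap_ofFn (s : K) (n : ℕ) : ∀ (a : List ℕ → K) (u : Fin (n + 1) → ℕ),
    expLap s a (List.ofFn u) =
      ∑ j : Fin (n + 1), (-1) ^ (j : ℕ) * s ^ u j * a (List.ofFn fun i => u (j.succAbove i)) := by
  induction n with
  | zero => intro a u; simp [expLap]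
  | succ n ih =>
    intro a u
    rw [List.ofFn_succ, expLap, ih, Fin.sum_univ_succ (n := n + 1), sub_eq_add_neg,
        ← Finset.sum_neg_distrib]
    congr 1
    · simp
    · refine Finset.sum_congr rfl fun j _ => ?_
      rw [List.ofFn_succ (f := fun i => u (j.succ.succAbove i))]
      simp only [Fin.succ_succAbove_zero, Fin.succ_succAbove_succ, Fin.val_succ]
      ring

theorem expDet_ofFn (n : ℕ) : ∀ (s : Fin n → K) (u : Fin n → ℕ),
    expDet (List.ofFn s) (List.ofFn u) = (Matrix.of fun i j => s i ^ u j).det := by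
  induction n with
  | zero => intro s u; simp [expDet]
  | succ n ih =>
    intro s u
    rw [List.ofFn_succ, expDet, expLap_ofFn, Matrix.det_succ_row_zero]
    refine Finset.sum_congr rfl fun j _ => ?_
    rw [ih]
    rfl

theorem det_vandermonde_ofFn (n : ℕ) : ∀ s : Fin n → K,
    (Matrix.vandermonde s).det = vdmProd (List.ofFn s) := by
  induction n with
  | zero => intro s; simp [vdmProd]
  | succ n ih =>
    intro s
    rw [List.ofFn_succ, vdmProd, ← ih, Matrix.det_vandermonde, Matrix.det_vandermonde,
      Fin.prod_univ_succ, Fin.prod_Ioi_zero, List.map_ofFn, List.prod_ofFn]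
    congr 1
    exact Finset.prod_congr rfl fun i _ => by rw [Fin.prod_Ioi_succ]

theorem ones_replicate (n : ℕ) : ∀ o, ones o (List.replicate n true) = List.range' o n := by
  induction n with
  | zero => intro o; rfl
  | succ n ih => intro o; rw [List.replicate_succ, ones, ih, List.range'_succ]

theorem expDet_range (l : List K) : expDet l (List.range' 0 l.length) = vdmProd l := by
  have h : List.range' 0 l.length = List.ofFn fun i : Fin l.length => (i : ℕ) := by
    rw [List.ofFn_eq_map, List.map_coe_finRange_eq_range, List.range_eq_range']
  conv_lhs => rw [h, ← List.ofFn_get l]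
  simp only [List.length_ofFn]
  rw [expDet_ofFn]
  conv_rhs => rw [← List.ofFn_get l]
  rw [← det_vandermonde_ofFn]
  rfl

theorem prod_map_sub_rev (s : K) (l : List K) :
    (l.map fun u => u - s).prod = (-1) ^ l.length * (l.map fun u => s - u).prod := by
  induction l with
  | nil => simp
  | cons x l ih => simp only [List.map_cons, List.prod_cons, ih, List.length_cons]; ring

theorem sufSums_prod_mul_vdmProd (l : List K) :
    (sufSums l).prod * vdmProd (sufSums l) =
      (-1) ^ (∑ i ∈ Finset.range l.length, i) * (l.prod * gapProd l) := by
  induction l with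
  | nil => simp [sufSums, vdmProd, gapProd]
  | cons x l ih =>
    have h : x * ((sufSums l ++ [0]).tail.map fun u => (x :: l).sum - u).prod =
        (x :: l).sum * ((sufSums l).map fun u => (x :: l).sum - u).prod := by
      cases l with
      | nil => simp [sufSums]
      | cons y l =>
        simp only [sufSums, List.cons_append, List.tail_cons, List.map_append, List.map_cons,
          List.map_nil, List.prod_append, List.prod_cons, List.prod_nil, List.sum_cons]
        ring
    rw [List.length_cons, Finset.sum_range_succ, pow_add, gapProd]
    rw [List.prod_cons]
    have h2 : ∀ a b c d e : K, a * b * (x * c * (d * e)) = (x * d) * (b * (a * (c * e))) := by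
      intros; ring
    rw [h2, h, ← ih]
    simp only [sufSums, vdmProd, List.prod_cons]
    rw [prod_map_sub_rev, length_sufSums]
    ring

theorem prod_mul_seqPoly_zero (b : Bool) (x₀ z₀ : K) (t : List K) :
    (x₀ :: z₀ :: t).prod * seqPoly b x₀ z₀ t 0 =
      (-1) ^ (t.length + ∑ i ∈ Finset.range (t.length + 1), i) *
        (x₀ * (if b then x₀ else t.sum) * ((z₀ :: t).sum *
          bitLap (z₀ :: t).sum (bitDet t) (List.replicate (t.length + 1) true))) := by
  have h : bitLap (z₀ :: t).sum (bitDet t) (List.replicate (t.length + 1) true) =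
      ((sufSums t).map fun u => u ^ 2).prod * vdmProd (sufSums (z₀ :: t)) := by
    have h1 : bitDet t = fun p => ((sufSums t).map fun u => u ^ 2).prod *
      (expDet (sufSums t) (ones 0 p)) := funext (bitDet_eq t)
    have h2 := pow_mul_bitLap (z₀ :: t).sum (List.replicate (t.length + 1) true) 0
      (expDet (sufSums t))
    rw [pow_zero, one_mul, ones_replicate] at h2
    rw [h1, bitLap_mul_left, h2, ← expDet_range, length_sufSums]
    rfl
  have h3 : ((sufSums t).map fun u => u ^ 2).prod = (sufSums t).prod * (sufSums t).prod := by
    simp only [sq, List.prod_map_mul, List.map_id']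
  have h4 := sufSums_prod_mul_vdmProd (z₀ :: t)
  have h5 := prod_map_sub_rev (0 : K) (sufSums t)
  simp only [sub_zero, List.map_id'] at h5
  rw [length_sufSums] at h5
  have h6 : (-1 : K) ^ t.length * (-1) ^ t.length = 1 := by
    rw [← mul_pow]; simp
  have h7 : ((sufSums t).map fun u => 0 - u).prod = (-1) ^ t.length * (sufSums t).prod := by
    rw [h5, ← mul_assoc, h6, one_mul]
  rw [h, h3, seqPoly, h7, pow_add]
  have h8 : (z₀ :: t).sum * ((sufSums t).prod * (sufSums t).prod * vdmProd (sufSums (z₀ :: t))) =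
      (sufSums t).prod * ((-1) ^ (∑ i ∈ Finset.range (t.length + 1), i) *
        ((z₀ :: t).prod * gapProd (z₀ :: t))) := by
    rw [← List.length_cons (a := z₀), ← h4]
    simp only [sufSums, List.prod_cons]
    ring
  rw [h8]
  have h9 : (-1 : K) ^ (∑ i ∈ Finset.range (t.length + 1), i) *
      (-1) ^ (∑ i ∈ Finset.range (t.length + 1), i) = 1 := by
    rw [← mul_pow]; simp
  rw [List.prod_cons (a := x₀)]
  linear_combination (-(x₀ * (z₀ :: t).prod * (if b then x₀ else t.sum) * ((-1) ^ t.length *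
    (sufSums t).prod) * gapProd (z₀ :: t))) * h9

end SuffixSums

section LinearFactors
open Equiv Matrix
variable {k : ℕ}

/-- A uniformly defined function of `x` and `y` is a product of `d` integral linear forms; the
product of the `ℓ¹`-norms of the parts in `x` is at most `B`. -/
def IsLinProd (d B : ℕ) (f : ∀ (K : Type) [CommRing K], (Fin k → K) → K → K) : Prop :=
  ∃ Ls : List ((Fin k → ℤ) × ℤ), Ls.length = d ∧
    (Ls.map fun L => ∑ i, (L.1 i).natAbs).prod ≤ B ∧
    ∀ (K : Type) [CommRing K] (x : Fin k → K) (y : K),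
      f K x y = (Ls.map fun L => ∑ i, (L.1 i : K) * x i + (L.2 : K) * y).prod

theorem isLinProd_one : IsLinProd (k := k) 0 1 fun _ _ _ _ => 1 :=
  ⟨[], rfl, by simp, by simp⟩

theorem IsLinProd.mul {d e B C : ℕ} {f g : ∀ (K : Type) [CommRing K], (Fin k → K) → K → K}
    (hf : IsLinProd d B f) (hg : IsLinProd e C g) :
    IsLinProd (d + e) (B * C) fun K _ x y => f K x y * g K x y := by
  obtain ⟨L, h1, h2, h3⟩ := hf
  obtain ⟨M, h4, h5, h6⟩ := hg
  refine ⟨L ++ M, by simp [h1, h4], ?_, fun K _ x y => ?_⟩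
  · rw [List.map_append, List.prod_append]; exact Nat.mul_le_mul h2 h5
  · simp only [List.map_append, List.prod_append]; rw [h3, h6]

theorem isLinProd_sum (a : ℤ) (c : ℤ) (ha : a.natAbs ≤ 1) (js : List (Fin k)) :
    IsLinProd 1 js.length fun K _ x y => (c : K) * y + (a : K) * (js.map x).sum := by
  refine ⟨[(fun i => a * js.count i, c)], rfl, ?_, fun K _ x y => ?_⟩
  · simp only [List.map_cons, List.map_nil, List.prod_cons, List.prod_nil, mul_one, Int.natAbs_mul,
      Int.natAbs_natCast, ← Finset.mul_sum]
    have : ∑ i, js.count i = js.length := by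
      rw [← List.sum_toFinset_count_eq_length]
      refine (Finset.sum_subset (Finset.subset_univ _) fun i _ hi => ?_).symm
      exact List.count_eq_zero_of_not_mem (by simpa using hi)
    rw [this]
    exact (Nat.mul_le_mul_right _ ha).trans (by simp)
  · simp only [List.map_cons, List.map_nil, List.prod_cons, List.prod_nil, mul_one]
    have : (js.map x).sum = ∑ i, (js.count i : K) * x i := by
      rw [Finset.sum_list_map_count]
      simp only [nsmul_eq_mul]
      refine Finset.sum_subset (Finset.subset_univ _) fun i _ hi => ?_
      rw [List.count_eq_zero_of_not_mem (by simpa using hi)]; simp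
    rw [this, Finset.mul_sum, add_comm]
    congr 1
    refine Finset.sum_congr rfl fun i _ => ?_
    push_cast; ring

theorem isLinProd_differences (js : List (Fin k)) : ∀ is : List (Fin k),
    IsLinProd (js.length + 1) (is.length.ascFactorial (js.length + 1)) fun _ _ x _ =>
      ((sufSums (js.map x) ++ [0]).map fun u => ((is ++ js).map x).sum - u).prod := by
  induction js with
  | nil =>
    intro is
    have := isLinProd_sum 1 0 (by simp) is
    simpa [sufSums, Nat.ascFactorial] using this
  | cons j js ih =>
    intro is
    have h1 := isLinProd_sum 1 0 (by simp) is
    have h2 := h1.mul (ih (is ++ [j]))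
    rw [List.length_cons, add_comm (js.length + 1) 1]
    have h3 : is.length.ascFactorial (1 + (js.length + 1)) =
        is.length * (is ++ [j]).length.ascFactorial (js.length + 1) := by
      rw [add_comm, Nat.ascFactorial_succ, List.length_append, List.length_singleton,
        ← Nat.succ_ascFactorial]
    rw [h3]
    convert h2 using 5 with K _ x y
    simp only [List.map_cons, sufSums, List.cons_append, List.prod_cons]
    congr 1
    · simp
    · simp

theorem isLinProd_gapProd (js : List (Fin k)) :
    IsLinProd (∑ i ∈ Finset.range js.length, i) (∏ i ∈ Finset.range js.length, (i + 1).factorial)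
      fun _ _ x _ => gapProd (js.map x) := by
  induction js with
  | nil => exact isLinProd_one
  | cons j js ih =>
    rw [List.length_cons, Finset.sum_range_succ, Finset.prod_range_succ]
    have h : IsLinProd js.length (js.length + 1).factorial fun K _ x _ =>
        ((sufSums (js.map x) ++ [0]).tail.map fun u => ((j :: js).map x).sum - u).prod := by
      cases js with
      | nil => simpa [sufSums] using isLinProd_one (k := k)
      | cons i js =>
        have h1 := isLinProd_differences js [j, i]
        have h2 : [j, i].length.ascFactorial (js.length + 1)
            = ((i :: js).length + 1).factorial := by
          have := Nat.factorial_mul_ascFactorial 1 (js.length + 1)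
          rw [Nat.factorial_one, one_mul] at this
          rw [show (i :: js).length + 1 = 1 + (js.length + 1) by simp [add_comm], ← this]
          rfl
        rw [h2] at h1
        exact h1
    have h3 := ih.mul h
    convert h3 using 5 with K _ x y
    rw [List.map_cons, gapProd, mul_comm]

theorem isLinProd_sub (js : List (Fin k)) :
    IsLinProd js.length js.length.factorial fun _ _ x y =>
      ((sufSums (js.map x)).map fun u => y - u).prod := by
  induction js with
  | nil => exact isLinProd_one
  | cons j js ih =>
    have h1 := (isLinProd_sum (-1) 1 (by simp) (j :: js)).mul ih
    rw [List.length_cons, Nat.factorial_succ, add_comm js.length 1]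
    rw [List.length_cons, add_comm js.length 1] at h1
    convert h1 using 5 with K _ x y
    rw [List.map_cons, sufSums]
    simp [sub_eq_add_neg]

theorem IsLinProd.mono {d B C : ℕ} {f : ∀ (K : Type) [CommRing K], (Fin k → K) → K → K}
    (hf : IsLinProd d B f) (h : B ≤ C) : IsLinProd d C f := by
  obtain ⟨L, h1, h2, h3⟩ := hf
  exact ⟨L, h1, h2.trans h, h3⟩

theorem isLinProd_seqPoly (b : Bool) (i j : Fin k) (js : List (Fin k)) (hk : k = js.length + 2) :
    IsLinProd (∑ i ∈ Finset.range k, i) (∏ i ∈ Finset.range k, (i + 1).factorial)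
      fun _ _ x y => seqPoly b (x i) (x j) (js.map x) y := by
  have h1 : IsLinProd (k := k) 1 (js.length + 1) fun K _ x _ =>
      if b then x i else (js.map x).sum := by
    cases b
    · have := (isLinProd_sum 1 0 (by simp) js).mono (Nat.le_succ _)
      simpa using this
    · have := (isLinProd_sum 1 0 (by simp) [i]).mono (C := js.length + 1) (by simp)
      simpa using this
  have hr : Finset.range k = Finset.range (js.length + 2) := congrArg _ hk
  have h2 := ((h1.mul (isLinProd_sub js)).mul (isLinProd_gapProd (j :: js))).mono
    (C := ∏ i ∈ Finset.range k, (i + 1).factorial) (by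
      rw [hr, Finset.prod_range_succ, mul_comm, ← Nat.factorial_succ, List.length_cons]
      exact Nat.mul_le_mul_left _ (Nat.factorial_le (Nat.le_succ _)))
  have h3 : 1 + js.length + ∑ i ∈ Finset.range (j :: js).length, i = ∑ i ∈ Finset.range k, i := by
    rw [hr, Finset.sum_range_succ _ (js.length + 1), List.length_cons]
    omega
  rw [h3] at h2
  exact h2

theorem natAbs_permSign_le {n : ℕ} (u : Fin n → ℕ) : (permSign u).natAbs ≤ 1 := by
  by_cases h : ∃ π : Perm (Fin n), u = fun i => (π i : ℕ)
  · obtain ⟨π, rfl⟩ := h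
    rw [permSign_val]
    exact (Int.units_natAbs _).le
  · have : permSign u = 0 := Finset.sum_eq_zero fun π _ => if_neg fun hπ => h ⟨π, hπ⟩
    simp [this]

/-- The alternating sum of a product of linear forms with at most as many factors as needed. -/
theorem exists_alternating_linear (Ls : List ((Fin k → ℤ) × ℤ)) : ∀ u : Fin k → ℕ,
    ∑ i, u i + Ls.length ≤ ∑ i ∈ Finset.range k, i →
    ∃ c : ℤ, c.natAbs ≤ (Ls.map fun L => ∑ i, (L.1 i).natAbs).prod ∧
      (∑ i, u i + Ls.length < ∑ i ∈ Finset.range k, i → c = 0) ∧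
      ∀ (K : Type) [CommRing K] (x : Fin k → K) (y : K),
        ∑ σ : Perm (Fin k), (Perm.sign σ : ℤ) • ((∏ i, x (σ i) ^ u i) *
          (Ls.map fun L => ∑ i, (L.1 i : K) * x (σ i) + (L.2 : K) * y).prod) =
            (c : K) * (vandermonde x).det := by
  induction Ls with
  | nil =>
    intro u hu
    refine ⟨permSign u, by simpa using natAbs_permSign_le u, fun h => permSign_eq_zero u h,
      fun K _ x y => ?_⟩
    simp only [List.map_nil, List.prod_nil, mul_one]
    rw [sum_sign_prod_pow, det_pow_eq x u (by simpa using hu)]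
  | cons L Ls ih =>
    intro u hu
    rw [List.length_cons] at hu
    have hup : ∀ j : Fin k, ∑ i, (u + Pi.single j 1 : Fin k → ℕ) i = ∑ i, u i + 1 := fun j => by
      simp [Finset.sum_add_distrib]
    choose c hc hc0 hcv using fun j : Fin k => ih (u + Pi.single j 1) (by rw [hup]; omega)
    obtain ⟨d, -, hd, hdv⟩ := ih u (by omega)
    rw [hd (by omega)] at hdv
    refine ⟨∑ j, L.1 j * c j, ?_, fun h => ?_, fun K _ x y => ?_⟩
    · rw [List.map_cons, List.prod_cons, Finset.sum_mul]
      refine (Int.natAbs_sum_le _ _).trans (Finset.sum_le_sum fun j _ => ?_)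
      rw [Int.natAbs_mul]
      exact Nat.mul_le_mul_left _ (hc j)
    · refine Finset.sum_eq_zero fun j _ => ?_
      rw [hc0 j (by rw [hup]; rw [List.length_cons] at h; omega), mul_zero]
    · have h1 : ∀ σ : Perm (Fin k), (Perm.sign σ : ℤ) • ((∏ i, x (σ i) ^ u i) *
          ((L :: Ls).map fun L => ∑ i, (L.1 i : K) * x (σ i) + (L.2 : K) * y).prod) =
          ∑ j, (L.1 j : K) * ((Perm.sign σ : ℤ) •
              ((∏ i, x (σ i) ^ (u + Pi.single j 1 : Fin k → ℕ) i) *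
            (Ls.map fun L => ∑ i, (L.1 i : K) * x (σ i) + (L.2 : K) * y).prod)) +
          (L.2 : K) * y * ((Perm.sign σ : ℤ) • ((∏ i, x (σ i) ^ u i) *
            (Ls.map fun L => ∑ i, (L.1 i : K) * x (σ i) + (L.2 : K) * y).prod)) := by
        intro σ
        have h2 : ∀ j, ∏ i, x (σ i) ^ (u + Pi.single j 1 : Fin k → ℕ) i =
            (∏ i, x (σ i) ^ u i) * x (σ j) := by
          intro j
          simp only [Pi.add_apply, pow_add, Finset.prod_mul_distrib]
          congr 1
          rw [Finset.prod_eq_single j] <;> simp +contextual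
        simp only [h2, List.map_cons, List.prod_cons, zsmul_eq_mul]
        simp only [mul_add, add_mul, Finset.sum_mul, Finset.mul_sum]
        congr 1
        · exact Finset.sum_congr rfl fun j _ => by ring
        · ring
      simp only [h1]
      rw [Finset.sum_add_distrib, ← Finset.mul_sum, hdv, Finset.sum_comm]
      simp only [← Finset.mul_sum, hcv]
      push_cast
      rw [Finset.sum_mul]
      simp only [zero_mul, mul_zero, add_zero, mul_assoc]

/-- The alternating sum of the sequencing polynomial is a universal multiple of the Vandermonde
determinant. -/
theorem exists_alternating_seqPoly (n : ℕ) (b : Bool) :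
    ∃ c : ℤ, c.natAbs ≤ ∏ i ∈ Finset.range (n + 2), (i + 1).factorial ∧
      ∀ (K : Type) [CommRing K] (x : Fin (n + 2) → K) (y : K),
        ∑ σ : Perm (Fin (n + 2)), (Perm.sign σ : ℤ) • seqPoly b (x (σ 0)) (x (σ 1))
          (List.ofFn fun i : Fin n => x (σ i.succ.succ)) y = (c : K) * (vandermonde x).det := by
  obtain ⟨Ls, h1, h2, h3⟩ := isLinProd_seqPoly b (0 : Fin (n + 2)) 1
    (List.ofFn fun i : Fin n => i.succ.succ) (by simp)
  obtain ⟨c, hc, -, hcv⟩ := exists_alternating_linear Ls 0 (by simp [h1])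
  refine ⟨c, hc.trans h2, fun K _ x y => ?_⟩
  rw [← hcv K x y]
  refine Finset.sum_congr rfl fun σ _ => ?_
  have := h3 K (fun i => x (σ i)) y
  simp only [List.map_ofFn] at this
  rw [← this]
  simp [Function.comp_def]

end LinearFactors

section Sequencing
variable {K : Type*} [CommRing K]

theorem sum_drop_mem_sufSums (l : List K) : ∀ j < l.length, (l.drop j).sum ∈ sufSums l := by
  induction l with
  | nil => intro j hj; simp at hj
  | cons x l ih =>
    intro j hj
    cases j with
    | zero => simp [sufSums]
    | succ j => exact List.mem_cons_of_mem _ (ih j (by simpa using hj))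

theorem sum_drop_ne_of_gapProd_ne_zero (l : List K) (h0 : ∀ x ∈ l, x ≠ 0) (h : gapProd l ≠ 0) :
    ∀ i j, i < j → j ≤ l.length → (l.drop i).sum ≠ (l.drop j).sum := by
  induction l with
  | nil => intro i j hij hj; simp at hj; omega
  | cons x l ih =>
    intro i j hij hj
    obtain ⟨j, rfl⟩ : ∃ j', j = j' + 1 := ⟨j - 1, by omega⟩
    rw [List.length_cons] at hj
    cases i with
    | succ i =>
      exact ih (fun y hy => h0 y (by simp [hy])) (right_ne_zero_of_mul h) i j (by omega) (by omega)
    | zero =>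
      intro he
      rw [List.drop_zero, List.drop_succ_cons] at he
      cases j with
      | zero => simp at he; exact h0 x (by simp) he
      | succ j =>
        cases l with
        | nil => simp at hj
        | cons y l =>
          refine left_ne_zero_of_mul h (List.prod_eq_zero ?_)
          rw [List.mem_map]
          refine ⟨(l.drop j).sum, ?_, by rw [he]; simp⟩
          simp only [sufSums, List.cons_append, List.tail_cons, List.mem_append]
          rcases Nat.lt_or_ge j l.length with hl | hl
          · exact Or.inl (sum_drop_mem_sufSums l j hl)
          · rw [List.drop_eq_nil_of_le hl]; simp

theorem sum_take_ne_of_seqPoly_ne_zero (b : Bool) (x₀ z₀ : K) (t : List K)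
    (h0 : ∀ x ∈ x₀ :: z₀ :: t, x ≠ 0) (h : seqPoly b x₀ z₀ t (x₀ :: z₀ :: t).sum ≠ 0) (i j : ℕ)
    (hij : i < j) (hj : j ≤ t.length + 2) (hn : ¬ (i = 0 ∧ j = t.length + 2)) :
    ((x₀ :: z₀ :: t).take i).sum ≠ ((x₀ :: z₀ :: t).take j).sum := by
  intro he
  have hd : ((x₀ :: z₀ :: t).drop i).sum = ((x₀ :: z₀ :: t).drop j).sum := by
    have h1 := List.sum_take_add_sum_drop (x₀ :: z₀ :: t) i
    have h2 := List.sum_take_add_sum_drop (x₀ :: z₀ :: t) j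
    rw [← h2, he] at h1
    exact add_left_cancel h1
  obtain ⟨j, rfl⟩ : ∃ j', j = j' + 1 := ⟨j - 1, by omega⟩
  cases i with
  | succ i =>
    exact sum_drop_ne_of_gapProd_ne_zero (z₀ :: t) (fun y hy => h0 y (List.mem_cons_of_mem _ hy))
      (right_ne_zero_of_mul h) i j (by omega) (by rw [List.length_cons]; omega) hd
  | zero =>
    rw [List.drop_zero, List.drop_succ_cons] at hd
    cases j with
    | zero => simp at hd; exact h0 x₀ (by simp) hd
    | succ j =>
      refine right_ne_zero_of_mul (left_ne_zero_of_mul h) (List.prod_eq_zero ?_)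
      rw [List.mem_map]
      exact ⟨(t.drop j).sum, sum_drop_mem_sufSums t j (by omega), by rw [hd]; simp⟩

end Sequencing

section Alternation
open Equiv Matrix
variable {K : Type*} [CommRing K]

/-- The signed sum of the values of `f` at all orderings of the entries of `x`. -/
noncomputable def alternate (n : ℕ) (f : List K → K) (x : Fin n → K) : K :=
  ∑ σ : Perm (Fin n), (Perm.sign σ : ℤ) • f (List.ofFn fun i => x (σ i))

/-- The signed sum over all ways of leaving out one of the variables. -/
def extAlt {n : ℕ} (g : (Fin n → K) → K) (x : Fin (n + 1) → K) : K :=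
  ∑ j : Fin (n + 1), (-1) ^ (j : ℕ) * g fun i => x (j.succAbove i)

def sumFn (n : ℕ) : (Fin n → K) → K := fun x => ∑ i, x i

theorem alternate_congr {n : ℕ} {f g : List K → K} (h : ∀ l, l.length = n → f l = g l) :
    alternate n f = alternate n g := by
  funext x
  exact Finset.sum_congr rfl fun σ _ => by rw [h _ (by simp)]

theorem alternate_succ (n : ℕ) (f : List K → K) (x : Fin (n + 1) → K) :
    alternate (n + 1) f x = ∑ j : Fin (n + 1), (-1) ^ (j : ℕ) *
      alternate n (fun l => f (x j :: l)) fun i => x (j.succAbove i) := by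
  rw [alternate, ← Equiv.sum_comp Perm.decomposeFin.symm, Fintype.sum_prod_type]
  refine Finset.sum_congr rfl fun j _ => ?_
  refine Fin.cases ?_ (fun j => ?_) j
  · simp only [Perm.decomposeFin.symm_sign, List.ofFn_succ, Perm.decomposeFin_symm_apply_zero,
      Perm.decomposeFin_symm_apply_succ]
    simp [alternate]
  · have : ((-1) ^ ((j.succ : Fin (n + 1)) : ℕ) : K) = -((Perm.sign j.cycleRange : ℤ) : K) := by
      simp [Fin.sign_cycleRange, pow_succ]
    rw [this, alternate, Finset.mul_sum]
    conv_rhs => rw [← Equiv.sum_comp (Equiv.mulLeft j.cycleRange)]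
    refine Finset.sum_congr rfl fun τ _ => ?_
    simp only [Perm.decomposeFin.symm_sign, List.ofFn_succ, Perm.decomposeFin_symm_apply_zero,
      Perm.decomposeFin_symm_apply_succ, Fin.succ_ne_zero, if_false, Equiv.coe_mulLeft,
          Perm.mul_apply,
      Fin.succAbove_cycleRange, Perm.sign_mul]
    have h2 : ((Perm.sign j.cycleRange : ℤ) : K) * ((Perm.sign j.cycleRange : ℤ) : K) = 1 := by
      rw [← Int.cast_mul, ← Units.val_mul, Int.units_mul_self]; simp
    simp only [zsmul_eq_mul]
    push_cast
    linear_combination ((Perm.sign τ : ℤ) : K) *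
      f (x j.succ :: List.ofFn fun i => x ((swap 0 j.succ) (τ i).succ)) * h2

theorem alternate_tail (n : ℕ) (f : List K → K) :
    alternate (n + 1) (fun l => f l.tail) = extAlt (alternate n f) := by
  funext x
  rw [alternate_succ]
  rfl

theorem alternate_sum_mul (n : ℕ) (f : List K → K) :
    alternate n (fun l => l.sum * f l) = sumFn n * alternate n f := by
  funext x
  simp only [alternate, Pi.mul_apply, sumFn, Finset.mul_sum]
  refine Finset.sum_congr rfl fun σ _ => ?_
  rw [List.sum_ofFn, Equiv.sum_comp σ x, mul_smul_comm]

theorem alternate_sub (n : ℕ) (f g : List K → K) :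
    alternate n (fun l => f l - g l) = alternate n f - alternate n g := by
  funext x
  simp [alternate, smul_sub]

theorem alternate_bitLap (n : ℕ) (p : List Bool) : ∀ a : List K → List Bool → K,
    alternate n (fun l => bitLap l.sum (a l) p) =
      bitLap (sumFn n) (fun q => alternate n fun l => a l q) p := by
  induction p with
  | nil => intro a; funext x; simp [alternate, bitLap]
  | cons b p ih =>
    intro a
    cases b
    · simp only [bitLap]
      rw [alternate_sum_mul, ih fun l q => a l (false :: q)]
    · simp only [bitLap]
      rw [alternate_sub, alternate_sum_mul, ih fun l q => a l (true :: q)]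

noncomputable def altDet (n : ℕ) (p : List Bool) : (Fin n → K) → K :=
  alternate n fun l => bitDet l p

theorem altDet_zero (p : List Bool) (x : Fin 0 → K) :
    altDet 0 p x = if ones 0 p = [] then 1 else 0 := by
  simp [altDet, alternate, bitDet]

theorem altDet_succ (n : ℕ) (p : List Bool) :
    altDet (K := K) (n + 1) p = sumFn (n + 1) *
      (sumFn (n + 1) * bitLap (sumFn (n + 1)) (fun q => extAlt (altDet n q)) p) := by
  rw [altDet, alternate_congr (g := fun l => l.sum * (l.sum * bitLap l.sum (bitDet l.tail) p))]
  · rw [alternate_sum_mul, alternate_sum_mul, alternate_bitLap]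
    congr 3
    funext q
    exact alternate_tail n fun l => bitDet l q
  · intro l hl
    cases l with
    | nil => simp at hl
    | cons x l => simp only [bitDet, List.tail_cons]; ring

/-- The alternant whose first factors have been divided out. -/
noncomputable def lastAlt (n : ℕ) (b : Bool) : (Fin (n + 1) → K) → K :=
  sumFn (n + 1) * bitLap (sumFn (n + 1))
    (fun q => extAlt (if b then altDet n q else sumFn n * altDet n q)) (List.replicate (n + 1) true)

theorem lastAlt_eq (n : ℕ) (b : Bool) : lastAlt (K := K) n b = alternate (n + 1) fun l =>
    l.sum * bitLap l.sum (fun q => (if b then 1 else l.tail.sum) * bitDet l.tail q)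
      (List.replicate (n + 1) true) := by
  rw [lastAlt, alternate_sum_mul, alternate_bitLap n.succ _
    fun l q => (if b then 1 else l.tail.sum) * bitDet l.tail q]
  congr 3
  funext q
  rw [alternate_tail n fun l => (if b then 1 else l.sum) * bitDet l q]
  cases b
  · simp only [Bool.false_eq_true, if_false, alternate_sum_mul]; rfl
  · simp only [if_true, one_mul]; rfl

theorem alternate_eq_sum_lastAlt (n : ℕ) (b : Bool) (x : Fin (n + 2) → K) :
    (∏ i, x i) * ∑ σ : Perm (Fin (n + 2)), (Perm.sign σ : ℤ) • seqPoly b (x (σ 0)) (x (σ 1))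
      (List.ofFn fun i : Fin n => x (σ i.succ.succ)) 0 =
    (-1) ^ (n + ∑ i ∈ Finset.range (n + 1), i) *
      ∑ j : Fin (n + 2), (-1) ^ (j : ℕ) *
        (x j ^ (if b then 2 else 1) * lastAlt n b fun i => x (j.succAbove i)) := by
  have h := alternate_succ (n + 1) (fun l => l.head?.getD 0 ^ (if b then 2 else 1) *
    (l.tail.sum * bitLap l.tail.sum
      (fun q => (if b then 1 else l.tail.tail.sum) * bitDet l.tail.tail q)
        (List.replicate (n + 1) true))) x
  have h2 : ∀ j : Fin (n + 2), (alternate (n + 1) fun l =>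
      (x j :: l).head?.getD 0 ^ (if b then 2 else 1) * ((x j :: l).tail.sum *
        bitLap (x j :: l).tail.sum
          (fun q => (if b then 1 else (x j :: l).tail.tail.sum) * bitDet (x j :: l).tail.tail q)
          (List.replicate (n + 1) true))) =
      fun y => x j ^ (if b then 2 else 1) * lastAlt n b y := by
    intro j
    rw [lastAlt_eq]
    funext y
    simp only [alternate, Finset.mul_sum, mul_smul_comm]
    rfl
  simp only [h2] at h
  rw [← h, alternate, Finset.mul_sum, Finset.mul_sum]
  refine Finset.sum_congr rfl fun σ _ => ?_
  rw [mul_smul_comm, mul_smul_comm]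
  congr 1
  have h3 := prod_mul_seqPoly_zero b (x (σ 0)) (x (σ 1))
    (List.ofFn fun i : Fin n => x (σ i.succ.succ))
  have h4 : (x (σ 0) :: x (σ 1) :: List.ofFn fun i : Fin n => x (σ i.succ.succ)) =
      List.ofFn fun i => x (σ i) := by
    rw [List.ofFn_succ, List.ofFn_succ]; rfl
  rw [h4, List.prod_ofFn, Equiv.prod_comp σ x, List.length_ofFn] at h3
  rw [h3, ← h4, bitLap_mul_left]
  simp only [List.head?_cons, Option.getD_some, List.tail_cons]
  cases b
  · simp only [Bool.false_eq_true, if_false]; ring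
  · simp only [if_true]; ring

end Alternation

section Alternants
open Equiv Matrix
variable {K : Type*} [CommRing K]

/-- The alternant with exponent set `s`. -/
noncomputable def powDet (n : ℕ) (s : Finset ℕ) : (Fin n → K) → K := fun x =>
  if h : s.card = n then (Matrix.of fun i j => x i ^ s.orderEmbOfFin h j).det else 0

theorem powDet_eq {n : ℕ} {s : Finset ℕ} (u : Fin n → ℕ) (hu : StrictMono u)
    (hs : s = Finset.univ.image u) (x : Fin n → K) :
    powDet n s x = (Matrix.of fun i j => x i ^ u j).det := by
  have h : s.card = n := by
    rw [hs, Finset.card_image_of_injective _ hu.injective]; simp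
  rw [powDet, dif_pos h, Finset.orderEmbOfFin_unique h (f := u) (fun i => by simp [hs]) hu]

theorem powDet_eq_zero {n : ℕ} {s : Finset ℕ} {e : ℕ} (he : e ∈ s) (x : Fin n → K)
    (hx : ∀ i, x i ^ e = 0) : powDet n s x = 0 := by
  rw [powDet]
  split_ifs with h
  · have : e ∈ Set.range (s.orderEmbOfFin h) := by simpa using he
    obtain ⟨j, hj⟩ := this
    exact det_eq_zero_of_column_eq_zero j fun i => by simp [hj, hx]
  · rfl

theorem sum_mul_det_pow {n : ℕ} (u : Fin n → ℕ) (x : Fin n → K) :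
    (∑ i, x i) * (Matrix.of fun i j => x i ^ u j).det =
      ∑ j, (Matrix.of fun i l => x i ^ (u + Pi.single j 1 : Fin n → ℕ) l).det := by
  simp only [← sum_sign_prod_pow]
  rw [Finset.sum_comm, Finset.mul_sum]
  refine Finset.sum_congr rfl fun σ _ => ?_
  rw [← Equiv.sum_comp σ x, ← Finset.smul_sum, mul_smul_comm, Finset.sum_mul]
  congr 1
  refine Finset.sum_congr rfl fun j _ => ?_
  simp only [Pi.add_apply, pow_add, Finset.prod_mul_distrib]
  rw [mul_comm]
  congr 1
  rw [Finset.prod_eq_single j] <;> simp +contextual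

theorem sumFn_mul_powDet {n : ℕ} {s : Finset ℕ} (h : s.card = n) (x : Fin n → K) :
    sumFn n x * powDet n s x =
      ∑ e ∈ s, if e + 1 ∈ s then 0 else powDet n (insert (e + 1) (s.erase e)) x := by
  have hs : s = Finset.univ.image (s.orderEmbOfFin h) := by simp
  set u := s.orderEmbOfFin h with hu
  have hsum : ∑ e ∈ s, (if e + 1 ∈ s then 0 else powDet n (insert (e + 1) (s.erase e)) x) =
      ∑ j, if u j + 1 ∈ s then 0 else powDet n (insert (u j + 1) (s.erase (u j))) x := by
    conv_lhs => rw [hs, Finset.sum_image fun a _ b _ hab => u.injective hab]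
    rw [← hs]
  rw [hsum, powDet_eq u u.strictMono hs, sumFn, sum_mul_det_pow]
  refine Finset.sum_congr rfl fun j _ => ?_
  split_ifs with h1
  · have : u j + 1 ∈ Set.range u := by simpa [hu] using h1
    obtain ⟨i, hi⟩ := this
    have hij : i ≠ j := by rintro rfl; omega
    refine det_zero_of_column_eq hij fun a => ?_
    simp [hij, hi]
  · have hne : ∀ i, u i ≠ u j + 1 := fun i hi => h1 (hi ▸ by simp [hu])
    symm
    apply powDet_eq
    · intro a b hab
      have h2 := u.strictMono hab
      have := hne b
      by_cases ha : a = j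
      · subst ha
        have hb : b ≠ a := hab.ne'
        simp [hb]; omega
      · by_cases hb : b = j
        · subst hb; simp [ha]; omega
        · simp [ha, hb]; omega
    · ext e
      simp only [Finset.mem_insert, Finset.mem_erase, Finset.mem_image, Finset.mem_univ, true_and]
      constructor
      · rintro (rfl | ⟨h2, h3⟩)
        · exact ⟨j, by simp⟩
        · have : e ∈ Set.range u := by simpa [hu] using h3
          obtain ⟨i, rfl⟩ := this
          have hij : i ≠ j := by rintro rfl; exact h2 rfl
          exact ⟨i, by simp [hij]⟩
      · rintro ⟨i, rfl⟩
        by_cases hij : i = j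
        · subst hij; simp
        · right
          simp only [Pi.add_apply, Pi.single_apply, hij, if_false, add_zero]
          exact ⟨fun h => hij (u.injective h), by simp [hu]⟩

theorem sum_pow_mul_powDet {n : ℕ} {s : Finset ℕ} (h : s.card = n) (a : ℕ) (x : Fin (n + 1) → K) :
    ∑ j : Fin (n + 1), (-1) ^ (j : ℕ) * (x j ^ a * powDet n s fun i => x (j.succAbove i)) =
      (Matrix.of fun i j =>
        x i ^ (Fin.cons a (s.orderEmbOfFin h) : Fin (n + 1) → ℕ) j).det := by
  rw [det_succ_column_zero]
  refine Finset.sum_congr rfl fun j _ => ?_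
  rw [powDet, dif_pos h, ← mul_assoc]
  congr 2

theorem extAlt_powDet {n : ℕ} {s : Finset ℕ} (h : s.card = n) :
    extAlt (powDet (K := K) n s) = if 0 ∈ s then 0 else powDet (n + 1) (insert 0 s) := by
  funext x
  have h1 := sum_pow_mul_powDet h 0 x
  simp only [pow_zero, one_mul] at h1
  rw [extAlt, h1]
  split_ifs with h0
  · have : 0 ∈ Set.range (s.orderEmbOfFin h) := by simpa using h0
    obtain ⟨j, hj⟩ := this
    exact det_zero_of_column_eq (Fin.succ_ne_zero j).symm fun i => by simp [hj]
  · symm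
    apply powDet_eq
    · intro i j hij
      obtain ⟨j, rfl⟩ := Fin.exists_succ_eq.mpr (Fin.ne_zero_of_lt hij)
      have hm : s.orderEmbOfFin h j ∈ s := by simp
      refine Fin.cases (fun _ => ?_) (fun i hij => ?_) i hij
      · simp only [Fin.cons_zero, Fin.cons_succ]
        exact Nat.pos_of_ne_zero fun h2 => h0 (h2 ▸ hm)
      · simpa using hij
    · ext e
      have : e ∈ s ↔ ∃ j, s.orderEmbOfFin h j = e := by
        rw [← Set.mem_range]; simp
      simp only [Finset.mem_insert, this, Finset.mem_image, Finset.mem_univ, true_and,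
        Fin.exists_fin_succ, Fin.cons_zero, Fin.cons_succ, eq_comm]

end Alternants

section Coefficients
open Equiv Matrix MvPolynomial
variable {A : Type*} [CommRing A]

/-- The sign of the permutation `u - 1`, and zero if there is no such permutation. -/
noncomputable def shiftSign {k : ℕ} (u : Fin k → ℕ) : ℤ :=
  ∑ σ : Perm (Fin k), if (u = fun j => (σ j : ℕ) + 1) then (Perm.sign σ : ℤ) else 0

theorem shiftSign_val {k : ℕ} (σ : Perm (Fin k)) :
    shiftSign (fun j => (σ j : ℕ) + 1) = Perm.sign σ := by
  unfold shiftSign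
  rw [Finset.sum_eq_single σ]
  · simp
  · intro τ _ hτ
    rw [if_neg]
    intro h
    apply hτ
    ext i
    have := congrFun h i
    simp at this
    exact this.symm ▸ rfl
  · simp

theorem coeff_det_pow {k : ℕ} (u : Fin k → ℕ) :
    coeff (Finsupp.equivFunOnFinite.symm fun i : Fin k => (i : ℕ) + 1)
      (Matrix.of fun i j => (X i : MvPolynomial (Fin k) A) ^ u j).det = shiftSign u := by
  rw [← sum_sign_prod_pow, coeff_sum, shiftSign]
  push_cast
  refine Finset.sum_congr rfl fun σ _ => ?_
  have h : ∏ i, (X (σ i) : MvPolynomial (Fin k) A) ^ u i =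
      monomial (Finsupp.equivFunOnFinite.symm fun i => u (σ.symm i)) 1 := by
    rw [monomial_eq, map_one, one_mul, Finsupp.prod_fintype _ _ fun i => pow_zero _,
      ← Equiv.prod_comp σ fun i => X i ^ (Finsupp.equivFunOnFinite.symm fun i => u (σ.symm i)) i]
    simp
  rw [h, coeff_smul, coeff_monomial]
  have h2 : (Finsupp.equivFunOnFinite.symm (fun i => u (σ.symm i)) =
      Finsupp.equivFunOnFinite.symm fun i : Fin k => (i : ℕ) + 1) ↔
      u = fun j => (σ j : ℕ) + 1 := by
    rw [Finsupp.equivFunOnFinite.symm.injective.eq_iff]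
    constructor
    · intro h; funext j; have := congrFun h (σ j); simpa using this
    · intro h; funext j; have := congrFun h (σ.symm j); simpa using this
  simp only [h2]
  split_ifs <;> simp

theorem coeff_eq_zero_of_mem_span {k : ℕ} {f : MvPolynomial (Fin k) A}
    (hf : f ∈ Ideal.span (Set.range fun i : Fin k => (X i : MvPolynomial (Fin k) A) ^ (k + 1))) :
    coeff (Finsupp.equivFunOnFinite.symm fun i : Fin k => (i : ℕ) + 1) f = 0 := by
  have h1 : (Set.range fun i : Fin k => (X i : MvPolynomial (Fin k) A) ^ (k + 1)) =
      (fun s => monomial s (1 : A)) '' Set.range fun i : Fin k => Finsupp.single i (k + 1) := by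
    rw [← Set.range_comp]
    congr 1
    funext i
    simp [X_pow_eq_monomial]
  rw [h1, mem_ideal_span_monomial_image] at hf
  by_contra h
  obtain ⟨_, ⟨i, rfl⟩, hle⟩ := hf _ (mem_support_iff.mpr h)
  have := hle i
  simp at this
  omega

theorem shiftSign_cons {n a : ℕ} {s : Finset ℕ} (h : s.card = n) (ha : 1 ≤ a) (han : a ≤ n + 1) :
    (shiftSign (Fin.cons a (s.orderEmbOfFin h) : Fin (n + 1) → ℕ)).natAbs =
      if s = ((Finset.range (n + 2)).erase 0).erase a then 1 else 0 := by
  set u : Fin (n + 1) → ℕ := Fin.cons a (s.orderEmbOfFin h) with hu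
  have hs : Finset.univ.image u = insert a s := by
    ext e
    have : e ∈ s ↔ ∃ j, s.orderEmbOfFin h j = e := by rw [← Set.mem_range]; simp
    simp only [hu, Finset.mem_insert, this, Finset.mem_image, Finset.mem_univ, true_and,
      Fin.exists_fin_succ, Fin.cons_zero, Fin.cons_succ, eq_comm]
  have hcE : (((Finset.range (n + 2)).erase 0).erase a).card = n := by
    rw [Finset.card_erase_of_mem, Finset.card_erase_of_mem] <;> simp
    omega
  split_ifs with h1
  · have haE : a ∉ s := by simp [h1]
    have hlt : ∀ i, 1 ≤ u i ∧ u i ≤ n + 1 := by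
      intro i
      have : u i ∈ insert a s := hs ▸ Finset.mem_image_of_mem _ (Finset.mem_univ i)
      rw [h1] at this
      simp at this
      omega
    have hinj : Function.Injective u := by
      rw [hu, Fin.cons_injective_iff]
      refine ⟨?_, (s.orderEmbOfFin h).injective⟩
      simpa using haE
    have hinj' : Function.Injective fun i => (⟨u i - 1, by
        have := hlt i; omega⟩ : Fin (n + 1)) := by
      intro i j hij
      apply hinj
      simp only [Fin.mk.injEq] at hij
      have := hlt i; have := hlt j
      omega
    have h2 : u = fun j => ((Equiv.ofBijective _ (Finite.injective_iff_bijective.mp hinj') j :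
        Fin (n + 1)) : ℕ) + 1 := by
      funext j
      have := hlt j
      simp only [Equiv.ofBijective_apply]
      omega
    rw [h2, shiftSign_val, Int.units_natAbs]
  · rw [Int.natAbs_eq_zero]
    refine Finset.sum_eq_zero fun σ _ => if_neg fun h2 => h1 ?_
    have hlt : ∀ e ∈ insert a s, 1 ≤ e ∧ e < n + 2 := by
      intro e he
      rw [← hs, Finset.mem_image] at he
      obtain ⟨j, -, rfl⟩ := he
      rw [h2]
      exact ⟨by simp, by have := (σ j).isLt; simp only; omega⟩
    have haE : a ∉ s := by
      intro h3
      have h4 : (insert a s).card = n + 1 := by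
        rw [← hs, Finset.card_image_of_injective, Finset.card_univ, Fintype.card_fin]
        rw [h2]
        intro i j hij
        simpa [Fin.val_inj] using hij
      rw [Finset.insert_eq_of_mem h3, h] at h4
      omega
    refine Finset.eq_of_subset_of_card_le (fun e he => ?_) (by rw [hcE, h])
    have := hlt e (Finset.mem_insert_of_mem he)
    simp only [Finset.mem_erase, Finset.mem_range]
    exact ⟨fun h => haE (h ▸ he), by omega, this.2⟩

/-- Over the ring of truncated polynomials, the coefficient of a minimal alternant can be read
off from an expansion. -/
theorem exists_sign_of_expansion {A : Type} [CommRing A] {n a : ℕ} (ha : 1 ≤ a) (han : a ≤ n + 1)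
    (c : ℤ) (q : ℕ) (α : Finset ℕ → ℕ) (g : ∀ (K : Type) [CommRing K], (Fin n → K) → K)
    (hg : ∀ (K : Type) [CommRing K] [Algebra A K] (y : Fin n → K), (∀ i, y i ^ (n + 2) = 0) →
      g K y = ∑ s ∈ Finset.powersetCard n (Finset.range (n + 2)), (α s : K) * powDet n s y)
    (hc : ∀ (K : Type) [CommRing K] (x : Fin (n + 1) → K),
      (∏ i, x i) * ((c : K) * (vandermonde x).det) = (-1) ^ q * ∑ j : Fin (n + 1), (-1) ^ (j : ℕ) *
        (x j ^ a * g K fun i => x (j.succAbove i))) :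
    ∃ ε : ℤ, ε.natAbs = 1 ∧ (c : A) = ε * (α (((Finset.range (n + 2)).erase 0).erase a) : A) := by
  let I : Ideal (MvPolynomial (Fin (n + 1)) A) :=
    Ideal.span (Set.range fun i : Fin (n + 1) => X i ^ (n + 1 + 1))
  let φ : MvPolynomial (Fin (n + 1)) A →+* MvPolynomial (Fin (n + 1)) A ⧸ I := Ideal.Quotient.mk I
  have hx : ∀ i, φ (X i) ^ (n + 2) = 0 := by
    intro i
    rw [← map_pow]
    exact Ideal.Quotient.eq_zero_iff_mem.mpr (Ideal.subset_span ⟨i, rfl⟩)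
  have h1 := hc _ fun i => φ (X i)
  have h2 : (∏ i, φ (X i)) * ((c : MvPolynomial (Fin (n + 1)) A ⧸ I) *
      (vandermonde fun i => φ (X i)).det) =
      φ ((c : MvPolynomial (Fin (n + 1)) A) *
        (Matrix.of fun i j : Fin (n + 1) => X i ^ ((j : ℕ) + 1)).det) := by
    rw [mul_left_comm, map_mul, map_intCast, RingHom.map_det]
    congr 1
    rw [← det_mul_column]
    congr 1
    ext i j
    simp [vandermonde_apply, pow_succ']
  have h3 : (-1) ^ q * ∑ j : Fin (n + 1), (-1) ^ (j : ℕ) *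
        (φ (X j) ^ a * g _ fun i => φ (X (j.succAbove i))) =
      φ ((-1) ^ q * ∑ s ∈ (Finset.powersetCard n (Finset.range (n + 2))).attach,
        (α s : MvPolynomial (Fin (n + 1)) A) * (Matrix.of fun i j => X i ^ (Fin.cons a
          ((s : Finset ℕ).orderEmbOfFin (Finset.mem_powersetCard.mp s.2).2) :
            Fin (n + 1) → ℕ) j).det) := by
    rw [map_mul, map_pow, map_neg, map_one, map_sum]
    congr 1
    have h4 : ∀ j : Fin (n + 1), (g _ fun i => φ (X (j.succAbove i))) =
        ∑ s ∈ (Finset.powersetCard n (Finset.range (n + 2))).attach,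
          (α s : MvPolynomial (Fin (n + 1)) A ⧸ I) * powDet n s fun i => φ (X (j.succAbove i)) := by
      intro j
      rw [hg _ _ fun i => hx _, ← Finset.sum_attach]
    simp only [h4, Finset.mul_sum]
    rw [Finset.sum_comm]
    refine Finset.sum_congr rfl fun s _ => ?_
    rw [map_mul, map_natCast, RingHom.map_det]
    have h5 := sum_pow_mul_powDet (Finset.mem_powersetCard.mp s.2).2 a fun i => φ (X i)
    have h6 : φ.mapMatrix (Matrix.of fun i j => X i ^ (Fin.cons a
          ((s : Finset ℕ).orderEmbOfFin (Finset.mem_powersetCard.mp s.2).2) :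
            Fin (n + 1) → ℕ) j) = Matrix.of fun i j => φ (X i) ^ (Fin.cons a
          ((s : Finset ℕ).orderEmbOfFin (Finset.mem_powersetCard.mp s.2).2) :
            Fin (n + 1) → ℕ) j := by
      ext i j; simp
    rw [h6, ← h5, Finset.mul_sum]
    exact Finset.sum_congr rfl fun j _ => by ring
  rw [h2, h3] at h1
  have h7 := coeff_eq_zero_of_mem_span (Ideal.Quotient.eq.mp h1)
  have hC : ∀ (z : ℤ) (p : MvPolynomial (Fin (n + 1)) A) d,
      coeff d ((z : MvPolynomial (Fin (n + 1)) A) * p) =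
      z * coeff d p := by
    intro z p d
    rw [← map_intCast (C : A →+* MvPolynomial (Fin (n + 1)) A), coeff_C_mul]
  have hE : ((Finset.range (n + 2)).erase 0).erase a ∈
      Finset.powersetCard n (Finset.range (n + 2)) := by
    rw [Finset.mem_powersetCard]
    refine ⟨(Finset.erase_subset _ _).trans (Finset.erase_subset _ _), ?_⟩
    rw [Finset.card_erase_of_mem, Finset.card_erase_of_mem] <;> simp
    omega
  have hq : ((-1 : MvPolynomial (Fin (n + 1)) A) ^ q) =
      (((-1) ^ q : ℤ) : MvPolynomial (Fin (n + 1)) A) := by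
    simp
  have h8 : shiftSign (fun j : Fin (n + 1) => (j : ℕ) + 1) = 1 := by
    have := shiftSign_val (1 : Perm (Fin (n + 1)))
    simpa using this
  rw [coeff_sub, hC, coeff_det_pow, h8, hq, hC, coeff_sum,
    Finset.sum_eq_single ⟨_, hE⟩, sub_eq_zero] at h7
  · refine ⟨(-1) ^ q * shiftSign (Fin.cons a (Finset.orderEmbOfFin _
      (Finset.mem_powersetCard.mp hE).2) : Fin (n + 1) → ℕ), ?_, ?_⟩
    · rw [Int.natAbs_mul, shiftSign_cons _ ha han, if_pos rfl, Int.natAbs_pow]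
      simp
    · have h9 := hC (α (((Finset.range (n + 2)).erase 0).erase a) : ℤ)
      simp only [Int.cast_natCast] at h9
      rw [h9, coeff_det_pow] at h7
      push_cast at h7 ⊢
      rw [mul_one] at h7
      rw [h7]
      ring
  · intro s _ hs
    have h9 := hC (α s : ℤ)
    simp only [Int.cast_natCast] at h9
    have h10 := shiftSign_cons (Finset.mem_powersetCard.mp s.2).2 ha han
    rw [if_neg fun h => hs (Subtype.ext h), Int.natAbs_eq_zero] at h10
    rw [h9, coeff_det_pow, h10]
    simp
  · intro h; exact absurd (Finset.mem_attach _ _) h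

end Coefficients

section PackedNumbers

theorem add_mul_land_add_mul {M a a' : ℕ} (b b' : ℕ) (ha : a < 2 ^ M) (ha' : a' < 2 ^ M) :
    (a + b * 2 ^ M) &&& (a' + b' * 2 ^ M) = (a &&& a') + (b &&& b') * 2 ^ M := by
  have h : a &&& a' < 2 ^ M := lt_of_le_of_lt Nat.and_le_left ha
  refine Nat.eq_of_testBit_eq fun i => ?_
  rw [Nat.testBit_and, add_comm a, add_comm a', add_comm (a &&& a'), mul_comm b, mul_comm b',
    mul_comm (b &&& b'), Nat.testBit_two_pow_mul_add _ ha, Nat.testBit_two_pow_mul_add _ ha',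
    Nat.testBit_two_pow_mul_add _ h]
  split_ifs <;> simp [Nat.testBit_and]

theorem sum_lanes_lt {W : ℕ} (f : ℕ → ℕ) (hf : ∀ t, f t < W) (N : ℕ) :
    ∑ t ∈ Finset.range N, f t * W ^ t < W ^ N := by
  induction N with
  | zero => simp
  | succ N ih =>
    rw [Finset.sum_range_succ, pow_succ]
    have := Nat.mul_le_mul_right (W ^ N) (hf N)
    rw [Nat.succ_mul] at this
    rw [mul_comm (W ^ N)]
    omega

theorem land_sum_lanes {L : ℕ} (f g : ℕ → ℕ) (hf : ∀ t, f t < 2 ^ L) (hg : ∀ t, g t < 2 ^ L)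
    (N : ℕ) : (∑ t ∈ Finset.range N, f t * (2 ^ L) ^ t) &&&
      (∑ t ∈ Finset.range N, g t * (2 ^ L) ^ t) =
        ∑ t ∈ Finset.range N, (f t &&& g t) * (2 ^ L) ^ t := by
  induction N with
  | zero => simp
  | succ N ih =>
    have h1 := sum_lanes_lt f hf N
    have h2 := sum_lanes_lt g hg N
    rw [Finset.sum_range_succ, Finset.sum_range_succ, Finset.sum_range_succ, ← ih]
    rw [← pow_mul] at *
    exact add_mul_land_add_mul _ _ h1 h2

theorem land_mask {L w : ℕ} (hw : w ≤ L) (f : ℕ → ℕ) (hf : ∀ t, f t < 2 ^ L) {N : ℕ}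
    {T : Finset ℕ} (hT : T ⊆ Finset.range N) :
    (∑ t ∈ Finset.range N, f t * (2 ^ L) ^ t) &&& (∑ t ∈ T, (2 ^ w - 1) * (2 ^ L) ^ t) =
      ∑ t ∈ T, (f t % 2 ^ w) * (2 ^ L) ^ t := by
  have h1 : ∀ h : ℕ → ℕ, ∑ t ∈ T, h t * (2 ^ L) ^ t =
      ∑ t ∈ Finset.range N, (if t ∈ T then h t else 0) * (2 ^ L) ^ t := by
    intro h
    rw [← Finset.sum_subset hT]
    · exact Finset.sum_congr rfl fun t ht => by rw [if_pos ht]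
    · intro t _ ht; rw [if_neg ht, zero_mul]
  have h2 : 2 ^ w ≤ 2 ^ L := Nat.pow_le_pow_right (by norm_num) hw
  have h3 : 0 < 2 ^ w := by positivity
  rw [h1, h1, land_sum_lanes f _ hf]
  · refine Finset.sum_congr rfl fun t _ => ?_
    split_ifs
    · rw [Nat.and_two_pow_sub_one_eq_mod]
    · simp
  · intro t
    split_ifs <;> omega

theorem sum_lanes_div_mod {W : ℕ} (f : ℕ → ℕ) (hf : ∀ t, f t < W) {N j : ℕ} (hj : j < N) :
    (∑ t ∈ Finset.range N, f t * W ^ t) / W ^ j % W = f j := by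
  have hW : 0 < W := lt_of_le_of_lt (Nat.zero_le _) (hf 0)
  obtain ⟨M, rfl⟩ : ∃ M, N = j + 1 + M := ⟨N - (j + 1), by omega⟩
  have h1 := sum_lanes_lt f hf j
  have h2 : ∑ t ∈ Finset.range (j + 1 + M), f t * W ^ t = ∑ t ∈ Finset.range j, f t * W ^ t +
      W ^ j * (f j + W * ∑ t ∈ Finset.range M, f (j + 1 + t) * W ^ t) := by
    rw [Finset.sum_range_add, Finset.sum_range_succ, Finset.mul_sum, mul_add, Finset.mul_sum,
      add_assoc]
    congr 2
    · ring
    · exact Finset.sum_congr rfl fun t _ => by ring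
  rw [h2, Nat.add_mul_div_left _ _ (by positivity), Nat.div_eq_of_lt h1, zero_add,
    Nat.add_mul_mod_self_left, Nat.mod_eq_of_lt (hf j)]

/-- The number with the given binary support. -/
def laneIdx (s : Finset ℕ) : ℕ := ∑ e ∈ s, 2 ^ e

theorem laneIdx_injective : Function.Injective laneIdx := Finset.geomSum_injective le_rfl

theorem laneIdx_insert {s : Finset ℕ} {e : ℕ} (h : e ∉ s) :
    laneIdx (insert e s) = laneIdx s + 2 ^ e := by
  rw [laneIdx, Finset.sum_insert h, add_comm]; rfl

theorem laneIdx_erase {s : Finset ℕ} {e : ℕ} (h : e ∈ s) :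
    laneIdx s + 2 ^ e = laneIdx (s.erase e) + 2 ^ (e + 1) := by
  have := Finset.sum_erase_add s (fun e => 2 ^ e) h
  rw [laneIdx, ← this, laneIdx, pow_succ]; ring

theorem laneIdx_lt {s : Finset ℕ} {b : ℕ} (h : s ⊆ Finset.range b) : laneIdx s < 2 ^ b := by
  refine Nat.geomSum_lt le_rfl fun e he => ?_
  simpa using h he

theorem card_le_of_laneIdx (n : ℕ) : ∀ (s t : Finset ℕ) (e : ℕ), s.card = n →
    laneIdx s + 2 ^ e = laneIdx t → t.card ≤ n + 1 := by
  induction n with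
  | zero =>
    intro s t e hs h
    rw [Finset.card_eq_zero] at hs
    subst hs
    rw [← laneIdx_insert (Finset.notMem_empty e)] at h
    rw [← laneIdx_injective h]; simp
  | succ n ih =>
    intro s t e hs h
    by_cases he : e ∈ s
    · rw [laneIdx_erase he] at h
      have := ih _ t _ (by rw [Finset.card_erase_of_mem he, hs]; rfl) h
      omega
    · rw [← laneIdx_insert he] at h
      rw [← laneIdx_injective h, Finset.card_insert_of_notMem he, hs]

theorem card_le_of_laneIdx_of_mem {s t : Finset ℕ} {e : ℕ} (he : e ∈ s)
    (h : laneIdx s + 2 ^ e = laneIdx t) : t.card ≤ s.card := by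
  rw [laneIdx_erase he] at h
  have := card_le_of_laneIdx _ _ _ _ rfl h
  rw [Finset.card_erase_of_mem he] at this
  have := Finset.card_pos.mpr ⟨e, he⟩
  omega

theorem laneIdx_add_eq_iff_of_card {s t : Finset ℕ} {e : ℕ} (hc : t.card = s.card) :
    laneIdx s + 2 ^ e = laneIdx t ↔ (e ∈ s ∧ e + 1 ∉ s) ∧ t = insert (e + 1) (s.erase e) := by
  constructor
  · intro h
    have he : e ∈ s := by
      by_contra he
      rw [← laneIdx_insert he] at h
      rw [← laneIdx_injective h, Finset.card_insert_of_notMem he] at hc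
      omega
    have h2 := h
    rw [laneIdx_erase he] at h2
    have he1 : e + 1 ∉ s := by
      intro he1
      have := card_le_of_laneIdx_of_mem (Finset.mem_erase.mpr ⟨by simp, he1⟩) h2
      rw [Finset.card_erase_of_mem he] at this
      have := Finset.card_pos.mpr ⟨e, he⟩
      omega
    refine ⟨⟨he, he1⟩, ?_⟩
    rw [← laneIdx_insert (fun h => he1 (Finset.mem_of_mem_erase h))] at h2
    exact (laneIdx_injective h2).symm
  · rintro ⟨⟨he, he1⟩, rfl⟩
    rw [laneIdx_erase he, laneIdx_insert fun h => he1 (Finset.mem_of_mem_erase h)]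

theorem laneIdx_add_eq_iff_of_card_succ {s t : Finset ℕ} {e : ℕ} (hc : t.card = s.card + 1) :
    laneIdx s + 2 ^ e = laneIdx t ↔ e ∉ s ∧ t = insert e s := by
  constructor
  · intro h
    have he : e ∉ s := fun he => by
      have := card_le_of_laneIdx_of_mem he h
      omega
    refine ⟨he, ?_⟩
    rw [← laneIdx_insert he] at h
    exact (laneIdx_injective h).symm
  · rintro ⟨he, rfl⟩
    rw [laneIdx_insert he]

/-- The sets of `n` exponents below `b`. -/
def lanes (b n : ℕ) : Finset (Finset ℕ) := Finset.powersetCard n (Finset.range b)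

theorem mem_lanes {b n : ℕ} {s : Finset ℕ} : s ∈ lanes b n ↔ s ⊆ Finset.range b ∧ s.card = n :=
  Finset.mem_powersetCard

noncomputable def constLanes (W v e : ℕ) : ℕ → ℕ :=
  Nat.rec (motive := fun _ => ℕ → ℕ) (fun n => Nat.rec (motive := fun _ => ℕ) v (fun _ _ => 0) n)
    (fun e g n => Nat.rec (motive := fun _ => ℕ) (g 0)
      (fun n _ => Nat.add (g (Nat.succ n)) (Nat.mul (g n) (Nat.pow W (Nat.pow 2 e)))) n) e

theorem constLanes_eq (W v b : ℕ) : ∀ n,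
    constLanes W v b n = ∑ s ∈ lanes b n, v * W ^ laneIdx s := by
  induction b with
  | zero =>
    intro n
    cases n with
    | zero => simp [lanes, laneIdx, constLanes]
    | succ n =>
      have : lanes 0 (n + 1) = ∅ := Finset.powersetCard_eq_empty.mpr (by simp)
      rw [this]; rfl
  | succ b ih =>
    intro n
    cases n with
    | zero =>
      change constLanes W v b 0 = _
      rw [ih]; simp [lanes]
    | succ n =>
      change constLanes W v b (n + 1) + constLanes W v b n * W ^ 2 ^ b = _
      rw [ih, ih, lanes, lanes, lanes, Finset.range_add_one,
        Finset.powersetCard_succ_insert Finset.notMem_range_self, Finset.sum_union, Finset.sum_mul,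
        Finset.sum_image]
      · congr 1
        refine Finset.sum_congr rfl fun s hs => ?_
        have hb : b ∉ s := fun h => by simpa using (Finset.mem_powersetCard.mp hs).1 h
        rw [laneIdx_insert hb, pow_add]; ring
      · intro s hs t ht hst
        have h1 : b ∉ s := fun h => by simpa using (Finset.mem_powersetCard.mp hs).1 h
        have h2 : b ∉ t := fun h => by simpa using (Finset.mem_powersetCard.mp ht).1 h
        rw [← Finset.erase_insert h1, ← Finset.erase_insert h2, hst]
      · rw [Finset.disjoint_left]
        intro s hs hs'
        obtain ⟨t, -, rfl⟩ := Finset.mem_image.mp hs'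
        simpa using (Finset.mem_powersetCard.mp hs).1 (Finset.mem_insert_self b t)

/-- Multiplication by a sum of lane shifts, restricted to the lanes of the right size. -/
theorem land_mul_shifts {L w b n n' v : ℕ} (hw : w ≤ L) (a : Finset ℕ → ℕ) (ha : ∀ s, a s < v)
    (E : Finset ℕ) (hE : E ⊆ Finset.range b) (hv : E.card * v < 2 ^ L) :
    ((∑ s ∈ lanes b n, a s * (2 ^ L) ^ laneIdx s) * ∑ e ∈ E, (2 ^ L) ^ 2 ^ e) &&&
      constLanes (2 ^ L) (2 ^ w - 1) b n' =
    ∑ t ∈ lanes b n', ((∑ e ∈ E, ∑ s ∈ lanes b n,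
      if laneIdx s + 2 ^ e = laneIdx t then a s else 0) % 2 ^ w) * (2 ^ L) ^ laneIdx t := by
  set f : ℕ → ℕ := fun t => ∑ e ∈ E, ∑ s ∈ lanes b n, if laneIdx s + 2 ^ e = t then a s else 0
    with hf
  have hv0 : 0 < v := lt_of_le_of_lt (Nat.zero_le _) (ha ∅)
  have h1 : ∀ t, f t < 2 ^ L := by
    intro t
    refine lt_of_le_of_lt ?_ hv
    rw [← smul_eq_mul]
    refine Finset.sum_le_card_nsmul _ _ _ fun e _ => ?_
    by_cases h : ∃ s ∈ lanes b n, laneIdx s + 2 ^ e = t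
    · obtain ⟨s, hs, rfl⟩ := h
      rw [Finset.sum_eq_single_of_mem s hs]
      · rw [if_pos rfl]; exact (ha s).le
      · intro s' _ hs'
        rw [if_neg fun h => hs' (laneIdx_injective (Nat.add_right_cancel h))]
    · push Not at h
      rw [Finset.sum_eq_zero fun s hs => if_neg (h s hs)]
      exact hv0.le
  have h2 : (∑ s ∈ lanes b n, a s * (2 ^ L) ^ laneIdx s) * ∑ e ∈ E, (2 ^ L) ^ 2 ^ e =
      ∑ t ∈ Finset.range (2 ^ (b + 1)), f t * (2 ^ L) ^ t := by
    simp only [hf, Finset.sum_mul, Finset.mul_sum]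
    refine Eq.trans ?_ Finset.sum_comm
    refine Finset.sum_congr rfl fun e he => ?_
    refine Eq.trans ?_ Finset.sum_comm
    refine Finset.sum_congr rfl fun s hs => ?_
    have h3 := laneIdx_lt (mem_lanes.mp hs).1
    have h4 : 2 ^ e < 2 ^ b := Nat.pow_lt_pow_right (by norm_num) (by simpa using hE he)
    rw [Finset.sum_eq_single_of_mem (laneIdx s + 2 ^ e)]
    · rw [if_pos rfl, pow_add, mul_assoc]
    · rw [Finset.mem_range, pow_succ]; omega
    · intro t _ ht
      rw [if_neg ht.symm, zero_mul]
  have h3 : ∀ g : ℕ → ℕ, ∑ t ∈ lanes b n', g (laneIdx t) * (2 ^ L) ^ laneIdx t =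
      ∑ t ∈ (lanes b n').image laneIdx, g t * (2 ^ L) ^ t := by
    intro g
    rw [Finset.sum_image fun s _ t _ h => laneIdx_injective h]
  rw [h2, constLanes_eq, h3 fun _ => 2 ^ w - 1, h3 fun t => f t % 2 ^ w, land_mask hw f h1]
  intro t ht
  obtain ⟨s, hs, rfl⟩ := Finset.mem_image.mp ht
  have := laneIdx_lt (mem_lanes.mp hs).1
  rw [Finset.mem_range, pow_succ]; omega

theorem sum_lanes_read {L b n : ℕ} (a : Finset ℕ → ℕ) (ha : ∀ s, a s < 2 ^ L) {s : Finset ℕ}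
    (hs : s ∈ lanes b n) :
    (∑ t ∈ lanes b n, a t * (2 ^ L) ^ laneIdx t) / (2 ^ L) ^ laneIdx s % 2 ^ L = a s := by
  set f : ℕ → ℕ := fun i => ∑ t ∈ lanes b n, if laneIdx t = i then a t else 0 with hf
  have h0 : ∀ t ∈ lanes b n, f (laneIdx t) = a t := by
    intro t ht
    rw [hf]
    simp only
    rw [Finset.sum_eq_single_of_mem t ht, if_pos rfl]
    intro u _ hu
    rw [if_neg fun h => hu (laneIdx_injective h)]
  have h1 : ∀ i, f i < 2 ^ L := by
    intro i
    by_cases h : ∃ s ∈ lanes b n, laneIdx s = i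
    · obtain ⟨s, hs, rfl⟩ := h
      rw [h0 s hs]; exact ha s
    · push Not at h
      rw [hf]
      simp only
      rw [Finset.sum_eq_zero fun s hs => if_neg (h s hs)]
      positivity
  have h2 : ∑ t ∈ lanes b n, a t * (2 ^ L) ^ laneIdx t =
      ∑ i ∈ Finset.range (2 ^ b), f i * (2 ^ L) ^ i := by
    simp only [hf, Finset.sum_mul]
    rw [Finset.sum_comm]
    refine Finset.sum_congr rfl fun t ht => ?_
    rw [Finset.sum_eq_single_of_mem (laneIdx t)]
    · rw [if_pos rfl]
    · rw [Finset.mem_range]; exact laneIdx_lt (mem_lanes.mp ht).1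
    · intro i _ hi; rw [if_neg hi.symm, zero_mul]
  rw [h2, sum_lanes_div_mod f h1 (laneIdx_lt (mem_lanes.mp hs).1), h0 s hs]

end PackedNumbers

section PackedAlternants
variable {L w k n n' v : ℕ}

/-- A point with entries of bounded nilpotency over a ring in which `2 ^ w` vanishes. -/
structure Truncated (w k : ℕ) {n : ℕ} (K : Type) [CommRing K] (x : Fin n → K) : Prop where
  two_pow : (2 ^ w : K) = 0
  pow : ∀ i, x i ^ (k + 1) = 0

/-- The packed number `p`, with lanes below `v`, lists the coefficients of `g` in terms of
alternants. -/
def IsPacked (L w k v : ℕ) {n : ℕ} (p : ℕ)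
    (g : ∀ (K : Type) [CommRing K], (Fin n → K) → K) : Prop :=
  ∃ a : Finset ℕ → ℕ, (∀ s, a s < v) ∧
    p = ∑ s ∈ lanes (k + 1) n, a s * (2 ^ L) ^ laneIdx s ∧
    ∀ (K : Type) [CommRing K] (x : Fin n → K), Truncated w k K x →
      g K x = ∑ s ∈ lanes (k + 1) n, (a s : K) * powDet n s x

theorem IsPacked.mono {p : ℕ} {g : ∀ (K : Type) [CommRing K], (Fin n → K) → K} {v v' : ℕ}
    (h : IsPacked L w k v p g) (hv : v ≤ v') : IsPacked L w k v' p g := by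
  obtain ⟨a, h1, h2⟩ := h
  exact ⟨a, fun s => (h1 s).trans_le hv, h2⟩

theorem IsPacked.congr {p : ℕ} {g h : ∀ (K : Type) [CommRing K], (Fin n → K) → K}
    (hg : IsPacked L w k v p g)
    (hh : ∀ (K : Type) [CommRing K] (x : Fin n → K), Truncated w k K x → g K x = h K x) :
    IsPacked L w k v p h := by
  obtain ⟨a, h1, h2, h3⟩ := hg
  exact ⟨a, h1, h2, fun K _ x hx => by rw [← hh K x hx, h3 K x hx]⟩

theorem isPacked_zero (hv : 0 < v) {g : ∀ (K : Type) [CommRing K], (Fin n → K) → K}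
    (hg : ∀ (K : Type) [CommRing K] (x : Fin n → K), Truncated w k K x → g K x = 0) :
    IsPacked L w k v 0 g :=
  ⟨fun _ => 0, fun _ => hv, by simp, fun K _ x hx => by simp [hg K x hx]⟩

theorem isPacked_one (hw : 0 < w) : IsPacked L w k (2 ^ w) 1
    (fun K _ (_ : Fin 0 → K) => (1 : K)) := by
  refine ⟨fun _ => 1, fun _ => Nat.one_lt_two_pow hw.ne', by simp [lanes, laneIdx], ?_⟩
  intro K _ x _
  simp [lanes, powDet]

theorem IsPacked.const_sub {q : ℕ} {h : ∀ (K : Type) [CommRing K], (Fin n → K) → K}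
    (hh : IsPacked L w k (2 ^ w) q h) :
    IsPacked L w k (2 ^ (w + 1)) (Nat.sub (constLanes (2 ^ L) (2 ^ w) (k + 1) n) q)
      fun K _ x => -h K x := by
  obtain ⟨a, h1, rfl, h3⟩ := hh
  refine ⟨fun s => 2 ^ w - a s, fun s => ?_, ?_, fun K _ x hx => ?_⟩
  · have : 0 < 2 ^ w := by positivity
    simp only [pow_succ]; omega
  · rw [constLanes_eq]
    refine Nat.sub_eq_of_eq_add ?_
    rw [← Finset.sum_add_distrib]
    refine Finset.sum_congr rfl fun s _ => ?_
    rw [← add_mul, Nat.sub_add_cancel (h1 s).le]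
  · beta_reduce
    rw [h3 K x hx, ← Finset.sum_neg_distrib]
    refine Finset.sum_congr rfl fun s _ => ?_
    rw [Nat.cast_sub (h1 s).le]
    push_cast
    rw [hx.two_pow]; ring

theorem IsPacked.add_const_sub {p q : ℕ} {g h : ∀ (K : Type) [CommRing K], (Fin n → K) → K}
    (hg : IsPacked L w k (2 ^ w) p g) (hh : IsPacked L w k (2 ^ w) q h) :
    IsPacked L w k (2 ^ (w + 1)) (Nat.add p (Nat.sub (constLanes (2 ^ L) (2 ^ w) (k + 1) n) q))
      fun K _ x => g K x - h K x := by
  obtain ⟨a, h1, rfl, h3⟩ := hg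
  obtain ⟨b, h4, rfl, h6⟩ := hh
  refine ⟨fun s => a s + (2 ^ w - b s), fun s => ?_, ?_, fun K _ x hx => ?_⟩
  · have := h1 s
    simp only [pow_succ]; omega
  · rw [constLanes_eq]
    simp only [add_mul, Finset.sum_add_distrib]
    refine congrArg (Nat.add _) (Nat.sub_eq_of_eq_add ?_)
    rw [← Finset.sum_add_distrib]
    refine Finset.sum_congr rfl fun s _ => ?_
    rw [← add_mul, Nat.sub_add_cancel (h4 s).le]
  · beta_reduce
    rw [h3 K x hx, h6 K x hx, ← Finset.sum_sub_distrib]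
    refine Finset.sum_congr rfl fun s _ => ?_
    push_cast
    rw [Nat.cast_sub (h4 s).le]
    push_cast
    rw [hx.two_pow]; ring

theorem cast_mod_two_pow {K : Type} [CommRing K] (h : (2 ^ w : K) = 0) (N : ℕ) :
    ((N % 2 ^ w : ℕ) : K) = N := by
  conv_rhs => rw [← Nat.mod_add_div N (2 ^ w)]
  push_cast
  rw [h]; ring

theorem IsPacked.shift (hw : w ≤ L) {E : Finset ℕ} (hE : E ⊆ Finset.range (k + 1))
    (hv : E.card * v < 2 ^ L) (P : ℕ → Finset ℕ → Prop)
    [∀ e s, Decidable (P e s)] (ins : ℕ → Finset ℕ → Finset ℕ)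
    (hP : ∀ e ∈ E, ∀ s ∈ lanes (k + 1) n, ∀ t ∈ lanes (k + 1) n',
      laneIdx s + 2 ^ e = laneIdx t ↔ P e s ∧ t = ins e s)
    (hins : ∀ e ∈ E, ∀ s ∈ lanes (k + 1) n, P e s → ins e s ∈ lanes (k + 1) n')
    {p : ℕ} {g : ∀ (K : Type) [CommRing K], (Fin n → K) → K} (hg : IsPacked L w k v p g)
    {h : ∀ (K : Type) [CommRing K], (Fin n' → K) → K}
    (hh : ∀ (a : Finset ℕ → ℕ) (K : Type) [CommRing K] (x : Fin n' → K), Truncated w k K x →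
      (∀ y : Fin n → K, Truncated w k K y →
        g K y = ∑ s ∈ lanes (k + 1) n, (a s : K) * powDet n s y) →
      h K x = ∑ s ∈ lanes (k + 1) n, (a s : K) *
        ∑ e ∈ E, if P e s then powDet n' (ins e s) x else 0) :
    IsPacked L w k (2 ^ w) (Nat.land (Nat.mul p (∑ e ∈ E, (2 ^ L) ^ 2 ^ e))
      (constLanes (2 ^ L) (2 ^ w - 1) (k + 1) n')) h := by
  obtain ⟨a, h1, rfl, h3⟩ := hg
  refine ⟨_, fun s => Nat.mod_lt _ (by positivity), land_mul_shifts hw a h1 E hE hv, ?_⟩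
  intro K _ x hx
  rw [hh a K x hx fun y hy => h3 K y hy]
  simp only [cast_mod_two_pow hx.two_pow]
  push_cast
  simp only [Finset.sum_mul, Finset.mul_sum]
  rw [Finset.sum_comm]
  refine Eq.trans ?_ Finset.sum_comm
  refine Finset.sum_congr rfl fun e he => ?_
  refine Eq.trans ?_ Finset.sum_comm
  refine Finset.sum_congr rfl fun s hs => ?_
  by_cases hPe : P e s
  · rw [if_pos hPe, Finset.sum_eq_single_of_mem _ (hins e he s hs hPe)]
    · rw [if_pos ((hP e he s hs _ (hins e he s hs hPe)).mpr ⟨hPe, rfl⟩)]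
    · intro t ht htn
      rw [if_neg fun h => htn ((hP e he s hs t ht).mp h).2, zero_mul]
  · rw [if_neg hPe, mul_zero, Finset.sum_eq_zero]
    intro t ht
    rw [if_neg fun h => hPe ((hP e he s hs t ht).mp h).1, zero_mul]

theorem IsPacked.sumFn_mul (hw : w ≤ L) (hv : k * v < 2 ^ L) {p : ℕ}
    {g : ∀ (K : Type) [CommRing K], (Fin n → K) → K} (hg : IsPacked L w k v p g) :
    IsPacked L w k (2 ^ w) (Nat.land (Nat.mul p (∑ e ∈ Finset.range k, (2 ^ L) ^ 2 ^ e))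
      (constLanes (2 ^ L) (2 ^ w - 1) (k + 1) n)) fun K _ x => sumFn n x * g K x := by
  refine IsPacked.shift hw (Finset.range_subset_range.mpr k.le_succ) (by simpa using hv)
    (fun e s => e ∈ s ∧ e + 1 ∉ s) (fun e s => insert (e + 1) (s.erase e)) ?_ ?_ hg ?_
  · intro e _ s hs t ht
    exact laneIdx_add_eq_iff_of_card ((mem_lanes.mp ht).2.trans (mem_lanes.mp hs).2.symm)
  · intro e he s hs hP
    rw [mem_lanes] at hs ⊢
    refine ⟨?_, ?_⟩
    · rw [Finset.insert_subset_iff]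
      exact ⟨by simpa using he, (Finset.erase_subset _ _).trans hs.1⟩
    · rw [Finset.card_insert_of_notMem fun h => hP.2 (Finset.mem_of_mem_erase h),
        Finset.card_erase_add_one hP.1, hs.2]
  · intro a K _ x hx h
    rw [h x hx, Finset.mul_sum]
    refine Finset.sum_congr rfl fun s hs => ?_
    rw [mem_lanes] at hs
    rw [mul_left_comm, sumFn_mul_powDet hs.2]
    congr 1
    have h1 : ∑ e ∈ Finset.range k, (if e ∈ s ∧ e + 1 ∉ s then
        powDet n (insert (e + 1) (s.erase e)) x else 0) =
        ∑ e ∈ Finset.range (k + 1), if e ∈ s ∧ e + 1 ∉ s then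
          powDet n (insert (e + 1) (s.erase e)) x else 0 := by
      rw [Finset.sum_range_succ]
      split_ifs with h2
      · rw [powDet_eq_zero (Finset.mem_insert_self _ _) x hx.pow, add_zero]
      · rw [add_zero]
    rw [h1, ← Finset.sum_subset hs.1]
    · refine Finset.sum_congr rfl fun e he => ?_
      by_cases h2 : e + 1 ∈ s <;> simp [he, h2]
    · intro e _ he
      rw [if_neg fun h => he h.1]

theorem IsPacked.extAlt (hw : w ≤ L) (hv : v < 2 ^ L) {p : ℕ}
    {g : ∀ (K : Type) [CommRing K], (Fin n → K) → K} (hg : IsPacked L w k v p g) :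
    IsPacked L w k (2 ^ w) (Nat.land (Nat.mul p (2 ^ L))
      (constLanes (2 ^ L) (2 ^ w - 1) (k + 1) (n + 1))) fun K _ x => extAlt (g K) x := by
  have := IsPacked.shift (n' := n + 1) hw (E := {0}) (by simp) (by simpa using hv)
    (fun e s => e ∉ s) (fun e s => insert e s) ?_ ?_ hg
    (h := fun K _ x => _root_.extAlt (g K) x) ?_
  · simpa using this
  · intro e _ s hs t ht
    exact laneIdx_add_eq_iff_of_card_succ ((mem_lanes.mp ht).2.trans (by rw [(mem_lanes.mp hs).2]))
  · intro e he s hs hP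
    rw [mem_lanes] at hs ⊢
    rw [Finset.mem_singleton] at he
    subst he
    refine ⟨?_, by rw [Finset.card_insert_of_notMem hP, hs.2]⟩
    rw [Finset.insert_subset_iff]
    exact ⟨by simp, hs.1⟩
  · intro a K _ x hx h
    have h1 : ∀ j : Fin (n + 1), (g K fun i => x (j.succAbove i)) =
        ∑ s ∈ lanes (k + 1) n, (a s : K) * powDet n s fun i => x (j.succAbove i) :=
      fun j => h _ ⟨hx.two_pow, fun i => hx.pow _⟩
    simp only [_root_.extAlt, h1, Finset.mul_sum, Finset.sum_singleton]
    rw [Finset.sum_comm]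
    refine Finset.sum_congr rfl fun s hs => ?_
    have h2 := congrFun (extAlt_powDet (K := K) (mem_lanes.mp hs).2) x
    simp only [_root_.extAlt] at h2
    have h3 : (if 0 ∉ s then powDet (n + 1) (insert 0 s) x else 0) =
        (if 0 ∈ s then (0 : (Fin (n + 1) → K) → K) else powDet (n + 1) (insert 0 s)) x := by
      by_cases h0 : 0 ∈ s <;> simp [h0]
    rw [h3, ← h2, Finset.mul_sum]
    exact Finset.sum_congr rfl fun j _ => by ring

end PackedAlternants

section PackedTrees

/-- Binary trees with packed numbers at the leaves. -/
inductive LaneTree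
  | nil
  | leaf (p : ℕ)
  | node (l r : LaneTree)

namespace LaneTree

noncomputable def mk (l r : LaneTree) : LaneTree := LaneTree.rec (motive := fun _ => LaneTree)
  (LaneTree.rec (motive := fun _ => LaneTree) nil (fun p => node nil (leaf p))
    (fun a b _ _ => node nil (node a b)) r)
  (fun p => node (leaf p) r) (fun a b _ _ => node (node a b) r) l

noncomputable def sub (B : ℕ) (x : LaneTree) : LaneTree → LaneTree :=
  LaneTree.rec (motive := fun _ => LaneTree → LaneTree)
    (fun y => LaneTree.rec (motive := fun _ => LaneTree) nil (fun q => leaf (Nat.sub B q))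
      (fun _ _ a b => node a b) y)
    (fun p y => LaneTree.rec (motive := fun _ => LaneTree) (leaf p)
      (fun q => leaf (Nat.add p (Nat.sub B q))) (fun _ _ _ _ => nil) y)
    (fun l r al ar y => LaneTree.rec (motive := fun _ => LaneTree) (node l r) (fun _ => nil)
      (fun l' r' _ _ => node (al l') (ar r')) y) x

noncomputable def shift (Z M : ℕ) (x : LaneTree) : LaneTree :=
  LaneTree.rec (motive := fun _ => LaneTree) nil
    (fun p => leaf (Nat.land (Nat.mul p Z) M)) (fun _ _ a b => node a b) x

noncomputable def lap (Z M B d : ℕ) : LaneTree → LaneTree :=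
  Nat.rec (motive := fun _ => LaneTree → LaneTree) (fun _ => nil)
    (fun _ g x => LaneTree.rec (motive := fun _ => LaneTree) nil (fun _ => nil)
      (fun l r _ _ => mk (shift Z M (g l)) (sub B l (shift Z M (g r)))) x) d

noncomputable def value (x : LaneTree) : ℕ :=
  LaneTree.rec (motive := fun _ => ℕ) 0 (fun p => p) (fun _ _ _ b => b) x

noncomputable def single (d : ℕ) : LaneTree :=
  Nat.rec (motive := fun _ => LaneTree) (leaf 1) (fun _ t => node t nil) d

end LaneTree

noncomputable def shiftSum (W k : ℕ) : ℕ :=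
  Nat.rec (motive := fun _ => ℕ) 0 (fun e z => Nat.add z (Nat.pow W (Nat.pow 2 e))) k

theorem shiftSum_eq (W k : ℕ) : shiftSum W k = ∑ e ∈ Finset.range k, W ^ 2 ^ e := by
  induction k with
  | zero => rfl
  | succ k ih => rw [Finset.sum_range_succ, ← ih]; rfl

theorem bitLap_eq_zero {K : Type*} [CommRing K] (s : K) (p : List Bool) : ∀ a : List Bool → K,
    (∀ q, q.length = p.length → a q = 0) → bitLap s a p = 0 := by
  induction p with
  | nil => intro a _; rfl
  | cons b p ih =>
    intro a ha
    cases b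
    · rw [bitLap, ih _ fun q hq => ha _ (by simp [hq]), mul_zero]
    · rw [bitLap, ih _ fun q hq => ha _ (by simp [hq]), ha _ (by simp), mul_zero, sub_zero]

theorem bitLap_apply {ι K : Type*} [CommRing K] (s : ι → K) (x : ι) (p : List Bool) :
    ∀ a : List Bool → ι → K, bitLap s a p x = bitLap (s x) (fun q => a q x) p := by
  induction p with
  | nil => intro a; rfl
  | cons b p ih =>
    intro a
    cases b
    · simp only [bitLap, Pi.mul_apply, ih]
    · simp only [bitLap, Pi.sub_apply, Pi.mul_apply, ih]

namespace LaneTree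
variable {L w k n n' v d : ℕ}

/-- The tree lists the functions indexed by the bit strings of length `d`. -/
def Rep (L w k v n : ℕ) : LaneTree → ℕ →
    (List Bool → ∀ (K : Type) [CommRing K], (Fin n → K) → K) → Prop
  | nil, d, a => ∀ q, q.length = d → ∀ (K : Type) [CommRing K] (x : Fin n → K),
      Truncated w k K x → a q K x = 0
  | leaf p, d, a => d = 0 ∧ IsPacked L w k v p (a [])
  | node l r, d, a => ∃ d', d = d' + 1 ∧ Rep L w k v n l d' (fun q => a (false :: q)) ∧
      Rep L w k v n r d' (fun q => a (true :: q))

theorem Rep.mono {v' : ℕ} (hv : v ≤ v') {t : LaneTree} :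
    ∀ {d} {a : List Bool → ∀ (K : Type) [CommRing K], (Fin n → K) → K},
      Rep L w k v n t d a → Rep L w k v' n t d a := by
  induction t with
  | nil => intro d a h; exact h
  | leaf p => intro d a h; exact ⟨h.1, h.2.mono hv⟩
  | node l r ihl ihr =>
    rintro d a ⟨d', h1, h2, h3⟩
    exact ⟨d', h1, ihl h2, ihr h3⟩

theorem Rep.congr {t : LaneTree} :
    ∀ {d} {a b : List Bool → ∀ (K : Type) [CommRing K], (Fin n → K) → K},
      Rep L w k v n t d a → (∀ q, q.length = d → ∀ (K : Type) [CommRing K] (x : Fin n → K),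
        Truncated w k K x → a q K x = b q K x) → Rep L w k v n t d b := by
  induction t with
  | nil => intro d a b h hab q hq K _ x hx; rw [← hab q hq K x hx, h q hq K x hx]
  | leaf p =>
    rintro d a b ⟨rfl, h2⟩ hab
    exact ⟨rfl, h2.congr (hab [] rfl)⟩
  | node l r ihl ihr =>
    rintro d a b ⟨d', rfl, h2, h3⟩ hab
    exact ⟨d', rfl, ihl h2 fun q hq => hab _ (by simp [hq]),
      ihr h3 fun q hq => hab _ (by simp [hq])⟩

theorem Rep.shift {v' Z M : ℕ} (T : (∀ (K : Type) [CommRing K], (Fin n → K) → K) →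
      ∀ (K : Type) [CommRing K], (Fin n' → K) → K)
    (h0 : ∀ g : ∀ (K : Type) [CommRing K], (Fin n → K) → K,
      (∀ (K : Type) [CommRing K] x, Truncated w k K x → g K x = 0) →
        ∀ (K : Type) [CommRing K] x, Truncated w k K x → T g K x = 0)
    (hT : ∀ (p : ℕ) (g : ∀ (K : Type) [CommRing K], (Fin n → K) → K), IsPacked L w k v p g →
      IsPacked L w k v' (Nat.land (Nat.mul p Z) M) (T g)) {t : LaneTree} :
    ∀ {d} {a : List Bool → ∀ (K : Type) [CommRing K], (Fin n → K) → K},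
      Rep L w k v n t d a → Rep L w k v' n' (shift Z M t) d fun q => T (a q) := by
  induction t with
  | nil => intro d a h q hq; exact h0 _ (h q hq)
  | leaf p => intro d a h; exact ⟨h.1, hT _ _ h.2⟩
  | node l r ihl ihr =>
    rintro d a ⟨d', h1, h2, h3⟩
    exact ⟨d', h1, ihl h2, ihr h3⟩

theorem Rep.sumFn_mul (hw : w ≤ L) (hv : k * v < 2 ^ L) {t : LaneTree}
    {a : List Bool → ∀ (K : Type) [CommRing K], (Fin n → K) → K} (h : Rep L w k v n t d a) :
    Rep L w k (2 ^ w) n (LaneTree.shift (shiftSum (2 ^ L) k)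
        (constLanes (2 ^ L) (2 ^ w - 1) (k + 1) n) t)
      d fun q K _ x => sumFn n x * a q K x := by
  refine Rep.shift (fun g K _ x => sumFn n x * g K x) ?_ ?_ h
  · intro g hg K _ x hx
    rw [hg K x hx, mul_zero]
  · intro p g hg
    rw [shiftSum_eq]
    exact hg.sumFn_mul hw hv

theorem Rep.extAlt (hw : w ≤ L) (hv : v < 2 ^ L) {t : LaneTree}
    {a : List Bool → ∀ (K : Type) [CommRing K], (Fin n → K) → K} (h : Rep L w k v n t d a) :
    Rep L w k (2 ^ w) (n + 1)
      (LaneTree.shift (2 ^ L) (constLanes (2 ^ L) (2 ^ w - 1) (k + 1) (n + 1)) t)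
      d fun q K _ x => extAlt (a q K) x := by
  refine Rep.shift (fun g K _ x => _root_.extAlt (g K) x) ?_ ?_ h
  · intro g hg K _ x hx
    refine Finset.sum_eq_zero fun j _ => ?_
    rw [hg K _ ⟨hx.two_pow, fun i => hx.pow _⟩, mul_zero]
  · intro p g hg
    exact hg.extAlt hw hv

theorem Rep.neg {y : LaneTree} :
    ∀ {d} {b : List Bool → ∀ (K : Type) [CommRing K], (Fin n → K) → K},
      Rep L w k (2 ^ w) n y d b → Rep L w k (2 ^ (w + 1)) n
        (LaneTree.sub (constLanes (2 ^ L) (2 ^ w) (k + 1) n) nil y) d fun q K _ x => -b q K x := by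
  induction y with
  | nil =>
    intro d b h q hq K _ x hx
    beta_reduce
    rw [h q hq K x hx, neg_zero]
  | leaf p => intro d b h; exact ⟨h.1, h.2.const_sub⟩
  | node l r ihl ihr =>
    rintro d b ⟨d', h1, h2, h3⟩
    exact ⟨d', h1, ihl h2, ihr h3⟩

theorem Rep.sub {x : LaneTree} :
    ∀ {y : LaneTree} {d} {a b : List Bool → ∀ (K : Type) [CommRing K], (Fin n → K) → K},
      Rep L w k (2 ^ w) n x d a → Rep L w k (2 ^ w) n y d b → Rep L w k (2 ^ (w + 1)) n
        (LaneTree.sub (constLanes (2 ^ L) (2 ^ w) (k + 1) n) x y) d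
          fun q K _ x => a q K x - b q K x := by
  have hv : 2 ^ w ≤ 2 ^ (w + 1) := Nat.pow_le_pow_right (by norm_num) w.le_succ
  induction x with
  | nil =>
    intro y d a b ha hb
    refine hb.neg.congr fun q hq K _ x hx => ?_
    rw [ha q hq K x hx, zero_sub]
  | leaf p =>
    rintro y d a b ha hb
    cases y with
    | nil =>
      refine (Rep.mono hv ha).congr fun q hq K _ x hx => ?_
      rw [hb q hq K x hx, sub_zero]
    | leaf q => exact ⟨ha.1, ha.2.add_const_sub hb.2⟩
    | node l r =>
      obtain ⟨d', h, -⟩ := hb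
      exact absurd (ha.1.symm.trans h) (by simp)
  | node l r ihl ihr =>
    intro y d a b ha hb
    cases y with
    | nil =>
      refine (Rep.mono hv ha).congr fun q hq K _ x hx => ?_
      rw [hb q hq K x hx, sub_zero]
    | leaf q =>
      obtain ⟨d', h, -⟩ := ha
      exact absurd (hb.1.symm.trans h) (by simp)
    | node l' r' =>
      obtain ⟨d', rfl, h2, h3⟩ := ha
      obtain ⟨d'', h1, h4, h5⟩ := hb
      obtain rfl : d' = d'' := by omega
      exact ⟨d', rfl, ihl h2 h4, ihr h3 h5⟩

theorem Rep.mk {l r : LaneTree} {a : List Bool → ∀ (K : Type) [CommRing K], (Fin n → K) → K}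
    (hl : Rep L w k v n l d fun q => a (false :: q))
    (hr : Rep L w k v n r d fun q => a (true :: q)) :
    Rep L w k v n (LaneTree.mk l r) (d + 1) a := by
  cases l with
  | nil =>
    cases r with
    | nil =>
      intro q hq
      cases q with
      | nil => simp at hq
      | cons b q =>
        cases b
        · exact hl q (by simpa using hq)
        · exact hr q (by simpa using hq)
    | leaf p => exact ⟨d, rfl, hl, hr⟩
    | node r r' => exact ⟨d, rfl, hl, hr⟩
  | leaf p => exact ⟨d, rfl, hl, hr⟩
  | node l l' => exact ⟨d, rfl, hl, hr⟩

theorem Rep.lap (hw : w ≤ L) (hv : k * 2 ^ (w + 1) < 2 ^ L) (D : ℕ) :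
    ∀ {t : LaneTree} {d} {a : List Bool → ∀ (K : Type) [CommRing K], (Fin n → K) → K}, d ≤ D →
      Rep L w k (2 ^ w) n t d a → Rep L w k (2 ^ (w + 1)) n
        (LaneTree.lap (shiftSum (2 ^ L) k) (constLanes (2 ^ L) (2 ^ w - 1) (k + 1) n)
          (constLanes (2 ^ L) (2 ^ w) (k + 1) n) D t) d
        fun q K _ x => bitLap (sumFn n x) (fun q => a q K x) q := by
  induction D with
  | zero =>
    intro t d a hd h q hq K _ x hx
    rw [List.length_eq_zero_iff.mp (hq.trans (Nat.le_zero.mp hd))]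
    rfl
  | succ D ih =>
    intro t d a hd h
    cases t with
    | nil =>
      intro q hq K _ x hx
      exact bitLap_eq_zero _ _ _ fun q' hq' => h q' (hq'.trans hq) K x hx
    | leaf p =>
      intro q hq K _ x hx
      rw [List.length_eq_zero_iff.mp (hq.trans h.1)]
      rfl
    | node l r =>
      obtain ⟨d', rfl, h2, h3⟩ := h
      have hd' : d' ≤ D := by omega
      have hv2 : 2 ^ w ≤ 2 ^ (w + 1) := Nat.pow_le_pow_right (by norm_num) w.le_succ
      exact Rep.mk (((ih hd' h2).sumFn_mul hw hv).mono hv2)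
        (h2.sub ((ih hd' h3).sumFn_mul hw hv))

theorem rep_single (hw : 0 < w) (d : ℕ) : ∀ o, Rep L w k (2 ^ w) 0 (single d) d
    fun q _ _ _ => if ones o q = [] then 1 else 0 := by
  induction d with
  | zero =>
    intro o
    refine ⟨rfl, ?_⟩
    simpa [ones] using isPacked_one hw
  | succ d ih =>
    intro o
    refine ⟨d, rfl, ?_, ?_⟩
    · exact (ih (o + 1)).congr fun q _ K _ x _ => if_congr (by rw [ones]) rfl rfl
    · intro q _ K _ x _
      simp [ones]

theorem Rep.value (hv : 0 < v) {t : LaneTree} :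
    ∀ {d} {a : List Bool → ∀ (K : Type) [CommRing K], (Fin n → K) → K},
      Rep L w k v n t d a → IsPacked L w k v (value t) (a (List.replicate d true)) := by
  induction t with
  | nil => intro d a h; exact isPacked_zero hv (h _ (by simp))
  | leaf p => rintro d a ⟨rfl, h2⟩; exact h2
  | node l r ihl ihr =>
    rintro d a ⟨d', rfl, h2, h3⟩
    rw [List.replicate_succ]
    exact ihr h3

/-- One row expansion, without the final factor. -/
noncomputable def expand (L w k d n : ℕ) (x : LaneTree) : LaneTree :=
  LaneTree.shift (shiftSum (Nat.pow 2 L) k)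
    (constLanes (Nat.pow 2 L) (Nat.sub (Nat.pow 2 w) 1) (Nat.succ k) n)
    (LaneTree.lap (shiftSum (Nat.pow 2 L) k)
      (constLanes (Nat.pow 2 L) (Nat.sub (Nat.pow 2 w) 1) (Nat.succ k) n)
      (constLanes (Nat.pow 2 L) (Nat.pow 2 w) (Nat.succ k) n) d
      (LaneTree.shift (Nat.pow 2 L)
        (constLanes (Nat.pow 2 L) (Nat.sub (Nat.pow 2 w) 1) (Nat.succ k) n) x))

noncomputable def mulSum (L w k n : ℕ) (x : LaneTree) : LaneTree :=
  LaneTree.shift (shiftSum (Nat.pow 2 L) k)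
    (constLanes (Nat.pow 2 L) (Nat.sub (Nat.pow 2 w) 1) (Nat.succ k) n) x

noncomputable def run (L w k d n : ℕ) : LaneTree :=
  Nat.rec (motive := fun _ => LaneTree) (single d)
    (fun n t => mulSum L w k (Nat.succ n) (expand L w k d (Nat.succ n) t)) n

theorem Rep.mulSum (hw : w ≤ L) (hv : k * v < 2 ^ L) {t : LaneTree}
    {a : List Bool → ∀ (K : Type) [CommRing K], (Fin n → K) → K} (h : Rep L w k v n t d a) :
    Rep L w k (2 ^ w) n (LaneTree.mulSum L w k n t) d fun q K _ x => sumFn n x * a q K x :=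
  h.sumFn_mul hw hv

theorem Rep.expand (hw : w < L) (hv : k * 2 ^ (w + 1) < 2 ^ L) {t : LaneTree}
    {a : List Bool → ∀ (K : Type) [CommRing K], (Fin n → K) → K}
    (h : Rep L w k (2 ^ w) n t d a) :
    Rep L w k (2 ^ w) (n + 1) (LaneTree.expand L w k d (n + 1) t) d fun q K _ x =>
      (sumFn (n + 1) * bitLap (sumFn (n + 1)) (fun q => _root_.extAlt (a q K)) q :
        (Fin (n + 1) → K) → K) x := by
  refine (((h.extAlt hw.le (Nat.pow_lt_pow_right (by norm_num) hw)).lap hw.le hv d le_rfl).sumFn_mul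
    hw.le hv).congr fun q _ K _ x _ => ?_
  rw [Pi.mul_apply, bitLap_apply]

theorem rep_run (hw0 : 0 < w) (hw : w < L) (hv : k * 2 ^ (w + 1) < 2 ^ L) (d n : ℕ) :
    Rep L w k (2 ^ w) n (run L w k d n) d fun q _ _ x => altDet n q x := by
  induction n with
  | zero =>
    refine (rep_single hw0 d 0).congr fun q _ K _ x _ => ?_
    rw [altDet_zero]
  | succ n ih =>
    have hv2 : k * 2 ^ w < 2 ^ L :=
      (Nat.mul_le_mul_left k (Nat.pow_le_pow_right (by norm_num) w.le_succ)).trans_lt hv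
    refine ((ih.expand hw hv).mulSum hw.le hv2).congr fun q _ _ _ x _ => ?_
    rw [altDet_succ]; rfl

/-- The packed coefficients of the last alternant. -/
noncomputable def final (L w n : ℕ) (b : Bool) : ℕ :=
  value (expand L w (Nat.succ (Nat.succ n)) (Nat.succ n) (Nat.succ n)
    (Bool.rec (mulSum L w (Nat.succ (Nat.succ n)) n
      (run L w (Nat.succ (Nat.succ n)) (Nat.succ n) n))
      (run L w (Nat.succ (Nat.succ n)) (Nat.succ n) n) b))

theorem isPacked_final (hw0 : 0 < w) (hw : w < L) (hv : (n + 2) * 2 ^ (w + 1) < 2 ^ L) (b : Bool) :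
    IsPacked (n := n + 1) L w (n + 2) (2 ^ w) (final L w n b) fun _ _ x => lastAlt n b x := by
  have hv2 : (n + 2) * 2 ^ w < 2 ^ L :=
    (Nat.mul_le_mul_left _ (Nat.pow_le_pow_right (by norm_num) w.le_succ)).trans_lt hv
  have h := rep_run hw0 hw hv (n + 1) n
  cases b
  · exact (((h.mulSum hw.le hv2).expand hw hv).value (by positivity)).congr
      fun _ _ _ _ => by simp only [lastAlt]; rfl
  · exact ((h.expand hw hv).value (by positivity)).congr
      fun _ _ _ _ => by simp only [lastAlt]; rfl

end LaneTree
end PackedTrees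

section AlternantValues

/-- The lane `E` of the packed coefficients of the last alternant. -/
noncomputable def alternantLane (L w n : ℕ) (b : Bool) (E : ℕ) : ℕ :=
  Nat.mod (Nat.div (LaneTree.final L w n b) (Nat.pow (Nat.pow 2 L) E)) (Nat.pow 2 L)

/-- Check that the distinguished coefficients are the given values up to sign. -/
noncomputable def checkLane (L w n : ℕ) (b : Bool) (E V : ℕ) : Bool :=
  or (Nat.beq (alternantLane L w n b E) V)
    (Nat.beq (alternantLane L w n b E) (Nat.sub (Nat.pow 2 w) V))

theorem natAbs_eq_of_checkLane {L w n : ℕ} {b : Bool} {E V : ℕ} (hw0 : 0 < w) (hw : w < L)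
    (hv : (n + 2) * 2 ^ (w + 1) < 2 ^ L)
    (hE : E = laneIdx (((Finset.range (n + 3)).erase 0).erase (if b then 2 else 1)))
    (hV : (∏ i ∈ Finset.range (n + 2), (i + 1).factorial) + V < 2 ^ w)
    (h : checkLane L w n b E V = true) {c : ℤ}
    (hc : c.natAbs ≤ ∏ i ∈ Finset.range (n + 2), (i + 1).factorial)
    (hcs : ∀ (K : Type) [CommRing K] (x : Fin (n + 2) → K) (y : K),
      ∑ σ : Equiv.Perm (Fin (n + 2)), (Equiv.Perm.sign σ : ℤ) • seqPoly b (x (σ 0)) (x (σ 1))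
        (List.ofFn fun i : Fin n => x (σ i.succ.succ)) y = (c : K) * (Matrix.vandermonde x).det) :
    c.natAbs = V := by
  obtain ⟨a, h1, h2, h3⟩ := LaneTree.isPacked_final (n := n) hw0 hw hv b
  have ha : (1 : ℕ) ≤ (if b then 2 else 1) := by split_ifs <;> norm_num
  have han : (if b then 2 else 1) ≤ n + 1 + 1 := by split_ifs <;> omega
  obtain ⟨ε, hε, h4⟩ := exists_sign_of_expansion (A := ZMod (2 ^ w)) ha han c
    (n + ∑ i ∈ Finset.range (n + 1), i) a (fun K _ x => lastAlt n b x)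
    (fun K _ _ y hy => h3 K y ⟨by
      have := congrArg (algebraMap (ZMod (2 ^ w)) K) (ZMod.natCast_self (2 ^ w))
      rw [map_natCast, map_zero] at this
      exact_mod_cast this, hy⟩)
    (fun K _ x => by rw [← hcs K x 0, alternate_eq_sum_lastAlt])
  have hmem : ((Finset.range (n + 3)).erase 0).erase (if b then 2 else 1) ∈
      lanes (n + 3) (n + 1) := by
    rw [mem_lanes]
    refine ⟨(Finset.erase_subset _ _).trans (Finset.erase_subset _ _), ?_⟩
    rw [Finset.card_erase_of_mem, Finset.card_erase_of_mem] <;> cases b <;> simp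
  have h5 : alternantLane L w n b E =
      a (((Finset.range (n + 3)).erase 0).erase (if b then 2 else 1)) := by
    rw [hE, ← sum_lanes_read (L := L) a
      (fun s => (h1 s).trans (Nat.pow_lt_pow_right (by norm_num) hw)) hmem, ← h2]
    rfl
  have h6 : ∃ δ : ℤ, δ.natAbs = 1 ∧
      (alternantLane L w n b E : ZMod (2 ^ w)) = δ * (V : ZMod (2 ^ w)) := by
    rw [checkLane, Bool.or_eq_true, Nat.beq_eq, Nat.beq_eq] at h
    rcases h with h | h
    · exact ⟨1, rfl, by rw [h]; simp⟩
    · refine ⟨-1, rfl, ?_⟩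
      have h7 : Nat.sub (Nat.pow 2 w) V + V = 2 ^ w := Nat.sub_add_cancel (by
        change V ≤ 2 ^ w; omega)
      have h8 := congrArg (Nat.cast (R := ZMod (2 ^ w))) h7
      rw [ZMod.natCast_self] at h8
      rw [h]
      push_cast at h8 ⊢
      rw [eq_neg_of_add_eq_zero_left h8]; ring
  obtain ⟨δ, hδ, h6⟩ := h6
  rw [← h5, h6] at h4
  have h7 : ((c - ε * δ * V : ℤ) : ZMod (2 ^ w)) = 0 := by
    push_cast
    rw [h4]; ring
  rw [ZMod.intCast_zmod_eq_zero_iff_dvd] at h7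
  have h8 : (ε * δ * V).natAbs = V := by simp [Int.natAbs_mul, hε, hδ]
  have h9 : (c - ε * δ * V).natAbs < 2 ^ w := by
    have := Int.natAbs_sub_le c (ε * δ * V)
    omega
  have h10 := Int.eq_zero_of_abs_lt_dvd h7 (by
    rw [Int.abs_eq_natAbs]; exact_mod_cast h9)
  rw [← h8]
  congr 1
  omega

end AlternantValues

section Rotations
variable {m : ℕ}

theorem prod_eq_r_sum_dVal (l : List (DihedralGroup m)) (hl : ∀ g ∈ l, dRef g = false) :
    l.prod = DihedralGroup.r (l.map dVal).sum := by
  induction l with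
  | nil => rfl
  | cons g l ih =>
    rw [List.prod_cons, ih fun h hh => hl h (List.mem_cons_of_mem _ hh), List.map_cons,
      List.sum_cons]
    have := hl g List.mem_cons_self
    cases g with
    | r i => rw [DihedralGroup.r_mul_r]; rfl
    | sr i => simp [dRef] at this

theorem sequenceable_of_rotations (hm : m.Prime) {n : ℕ} {S : Finset (DihedralGroup m)}
    (hS : ∀ g ∈ S, dRef g = false) (h1 : 1 ∉ S) (hcard : S.card = n + 2) (b : Bool) {c : ℤ}
    (hcs : ∀ (K : Type) [CommRing K] (x : Fin (n + 2) → K) (y : K),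
      ∑ σ : Equiv.Perm (Fin (n + 2)), (Equiv.Perm.sign σ : ℤ) • seqPoly b (x (σ 0)) (x (σ 1))
        (List.ofFn fun i : Fin n => x (σ i.succ.succ)) y = (c : K) * (Matrix.vandermonde x).det)
    (hc : ¬ m ∣ c.natAbs) : Sequenceable S := by
  have := Fact.mk hm
  let e := (S.equivFinOfCardEq hcard).symm
  let x : Fin (n + 2) → ZMod m := fun i => dVal (e i).1
  have hinj : Function.Injective x := fun i j hij =>
    e.injective (Subtype.ext (dVal_injective ((hS _ (e i).2).trans (hS _ (e j).2).symm) hij))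
  have hx0 : ∀ i, x i ≠ 0 := fun i hi => h1 (by
    have : (e i).1 = 1 := dVal_injective ((hS _ (e i).2).trans rfl) (hi.trans rfl)
    exact this ▸ (e i).2)
  have hne : (c : ZMod m) * (Matrix.vandermonde x).det ≠ 0 := by
    refine mul_ne_zero ?_ (Matrix.det_vandermonde_ne_zero_iff.mpr hinj)
    rw [Ne, ZMod.intCast_zmod_eq_zero_iff_dvd]
    exact fun h => hc (Int.natCast_dvd.mp h)
  rw [← hcs _ x (∑ i, x i)] at hne
  obtain ⟨σ, -, hσ⟩ := Finset.exists_ne_zero_of_sum_ne_zero hne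
  have hσ' := right_ne_zero_of_smul hσ
  have hl : (x (σ 0) :: x (σ 1) :: List.ofFn fun i : Fin n => x (σ i.succ.succ)) =
      List.ofFn fun i => x (σ i) := by
    rw [List.ofFn_succ, List.ofFn_succ]; rfl
  rw [← Equiv.sum_comp σ x, ← List.sum_ofFn, ← hl] at hσ'
  have hdist := sum_take_ne_of_seqPoly_ne_zero b _ _ _ (by
    rw [hl]
    intro z hz
    obtain ⟨i, rfl⟩ := (List.mem_ofFn' _ _).mp hz
    exact hx0 _) hσ'
  rw [hl] at hdist
  refine ⟨List.ofFn fun i => (e (σ i)).1, ?_, ?_, ?_⟩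
  · exact List.nodup_ofFn.mpr fun i j hij => σ.injective (e.injective (Subtype.ext hij))
  · ext g
    refine Iff.trans (@List.mem_toFinset _ (_) _ _) ?_
    rw [List.mem_ofFn']
    constructor
    · rintro ⟨i, rfl⟩; exact (e (σ i)).2
    · intro hg
      exact ⟨σ.symm (e.symm ⟨g, hg⟩), by simp⟩
  · intro i j hij hj hn h
    simp only [List.length_ofFn] at hj hn hdist
    have hrot : ∀ k, ∀ g ∈ (List.ofFn fun i => (e (σ i)).1).take k, dRef g = false := by
      intro k g hg
      obtain ⟨i, rfl⟩ := (List.mem_ofFn' _ _).mp (List.mem_of_mem_take hg)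
      exact hS _ (e (σ i)).2
    rw [PartialSum, PartialSum, prod_eq_r_sum_dVal _ (hrot i), prod_eq_r_sum_dVal _ (hrot j),
      DihedralGroup.r.injEq, List.map_take, List.map_take, List.map_ofFn] at h
    exact hdist i j hij hj hn h

/-- Two coprime-to-`m` candidates for the alternating sum give an ordering. -/
theorem sequenceable_of_checkLane (hm : m.Prime) (hm3 : 3 < m) {L w n V V' E E' : ℕ}
    (hw0 : 0 < w) (hw : w < L) (hv : (n + 2) * 2 ^ (w + 1) < 2 ^ L)
    (hE : E = laneIdx (((Finset.range (n + 3)).erase 0).erase 2))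
    (hE' : E' = laneIdx (((Finset.range (n + 3)).erase 0).erase 1))
    (hV : (∏ i ∈ Finset.range (n + 2), (i + 1).factorial) + V < 2 ^ w)
    (hV' : (∏ i ∈ Finset.range (n + 2), (i + 1).factorial) + V' < 2 ^ w)
    (hg : V.gcd V' ∣ 6 ^ 100)
    (h : and (checkLane L w n true E V) (checkLane L w n false E' V') = true)
    {S : Finset (DihedralGroup m)} (hS : ∀ g ∈ S, dRef g = false) (h1 : 1 ∉ S)
    (hcard : S.card = n + 2) : Sequenceable S := by
  rw [Bool.and_eq_true] at h
  obtain ⟨c, hc, hcs⟩ := exists_alternating_seqPoly n true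
  obtain ⟨c', hc', hcs'⟩ := exists_alternating_seqPoly n false
  have e1 := natAbs_eq_of_checkLane hw0 hw hv hE hV h.1 hc hcs
  have e2 := natAbs_eq_of_checkLane hw0 hw hv hE' hV' h.2 hc' hcs'
  by_cases hd : m ∣ c.natAbs
  · refine sequenceable_of_rotations hm hS h1 hcard false hcs' fun hd' => ?_
    have h6 : m ∣ 6 := hm.dvd_of_dvd_pow ((Nat.dvd_gcd (e1 ▸ hd) (e2 ▸ hd')).trans hg)
    have h7 : m ∣ 2 * 3 := h6
    rcases hm.dvd_mul.mp h7 with h | h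
    · exact absurd (Nat.le_of_dvd (by norm_num) h) (by omega)
    · exact absurd (Nat.le_of_dvd (by norm_num) h) (by omega)
  · exact sequenceable_of_rotations hm hS h1 hcard true hcs hd

end Rotations

theorem exists_certs_1 (r f : ℕ) (hf : 0 < f) (h : r + f = 1) :
    ∃ cs, checkCerts (2 ^ 128) r f cs = true := by
  obtain rfl : r = 1 - f := by omega
  replace h : f ≤ 1 := by omega
  interval_cases f
  · refine ⟨[
    ⟨[⟨.ref, 0, false, false⟩],
      [], [63], [], 340282366920938463463374607431768211457⟩], ?_⟩
    decide +kernel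

theorem exists_certs_2 (r f : ℕ) (hf : 0 < f) (h : r + f = 2) :
    ∃ cs, checkCerts (2 ^ 128) r f cs = true := by
  obtain rfl : r = 2 - f := by omega
  replace h : f ≤ 2 := by omega
  interval_cases f
  · refine ⟨[
    ⟨[⟨.frot, 0, false, false⟩, ⟨.fref, 0, false, false⟩],
      [], [], [66, 64], 340282366920938463463374607431768211457⟩], ?_⟩
    decide +kernel
  · refine ⟨[
    ⟨[⟨.fref, 0, false, false⟩, ⟨.fref, 0, true, true⟩],
      [], [], [65, 61], 340282366920938463463374607431768211457⟩], ?_⟩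
    decide +kernel

theorem exists_certs_3 (r f : ℕ) (hf : 0 < f) (h : r + f = 3) :
    ∃ cs, checkCerts (2 ^ 128) r f cs = true := by
  obtain rfl : r = 3 - f := by omega
  replace h : f ≤ 3 := by omega
  interval_cases f
  · refine ⟨[
    ⟨[⟨.frot, 0, false, false⟩, ⟨.fref, 0, false, false⟩, ⟨.rot, 0, false, false⟩],
      [64], [], [67, 67], 340282366920938463463374607431768211457⟩], ?_⟩
    decide +kernel
  · refine ⟨[
    ⟨[⟨.fref, 0, false, false⟩, ⟨.frot, 0, false, false⟩, ⟨.ref, 0, false, true⟩],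
      [], [63], [64, 61], 340282366920938463463374607431768211457⟩], ?_⟩
    decide +kernel
  · refine ⟨[
    ⟨[⟨.fref, 0, false, false⟩, ⟨.ref, 0, true, false⟩, ⟨.fref, 0, true, false⟩],
      [], [65], [62, 63], 340282366920938463463374607431768211457⟩], ?_⟩
    decide +kernel

theorem exists_certs_4 (r f : ℕ) (hf : 0 < f) (h : r + f = 4) :
    ∃ cs, checkCerts (2 ^ 128) r f cs = true := by
  obtain rfl : r = 4 - f := by omega
  replace h : f ≤ 4 := by omega
  interval_cases f
  · refine ⟨[
    ⟨[⟨.frot, 0, false, false⟩, ⟨.rot, 0, false, false⟩, ⟨.fref, 0, false, false⟩,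
      ⟨.rot, 0, false, false⟩],
      [64, 65], [], [64, 64], 340282366920938463463374607431768211455⟩], ?_⟩
    decide +kernel
  · refine ⟨[
    ⟨[⟨.fref, 0, false, false⟩, ⟨.rot, 0, false, false⟩, ⟨.fref, 0, false, false⟩,
      ⟨.rot, 0, false, true⟩],
      [63, 64], [], [61, 61], 340282366920938463463374607431768211457⟩], ?_⟩
    decide +kernel
  · refine ⟨[
    ⟨[⟨.frot, 0, false, false⟩, ⟨.fref, 0, false, false⟩, ⟨.ref, 0, true, false⟩,
      ⟨.ref, 0, true, false⟩],
      [], [65, 66], [62, 63], 340282366920938463463374607431768211455⟩], ?_⟩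
    decide +kernel
  · refine ⟨[
    ⟨[⟨.ref, 0, false, false⟩, ⟨.fref, 0, true, false⟩, ⟨.fref, 0, true, false⟩,
      ⟨.fref, 0, true, true⟩],
      [], [65], [61, 63, 65], 340282366920938463463374607431768211457⟩], ?_⟩
    decide +kernel

theorem exists_certs_5 (r f : ℕ) (hf : 0 < f) (h : r + f = 5) :
    ∃ cs, checkCerts (2 ^ 128) r f cs = true := by
  obtain rfl : r = 5 - f := by omega
  replace h : f ≤ 5 := by omega
  interval_cases f
  · refine ⟨[
    ⟨[⟨.frot, 0, false, false⟩, ⟨.rot, 0, false, false⟩, ⟨.fref, 0, false, false⟩,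
      ⟨.rot, 1, false, false⟩, ⟨.rot, 0, false, false⟩],
      [63, 64, 65], [], [64, 67], 340282366920938463463374607431768211458⟩], ?_⟩
    decide +kernel
  · refine ⟨[
    ⟨[⟨.ref, 0, false, false⟩, ⟨.frot, 0, false, false⟩, ⟨.rot, 0, false, false⟩,
      ⟨.ref, 0, false, false⟩, ⟨.rot, 0, false, true⟩],
      [63, 64], [65, 66], [65], 340282366920938463463374607431768211454⟩], ?_⟩
    decide +kernel
  · refine ⟨[
    ⟨[⟨.rot, 0, false, false⟩, ⟨.fref, 0, false, false⟩, ⟨.ref, 0, true, false⟩,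
      ⟨.ref, 0, true, false⟩, ⟨.rot, 0, false, false⟩],
      [62, 63], [64, 65], [63], 340282366920938463463374607431768211453⟩], ?_⟩
    decide +kernel
  · refine ⟨[
    ⟨[⟨.fref, 0, false, false⟩, ⟨.rot, 0, false, false⟩, ⟨.ref, 1, false, false⟩,
      ⟨.ref, 0, true, false⟩, ⟨.ref, 0, true, true⟩],
      [65], [64, 65, 66], [65], 340282366920938463463374607431768211454⟩], ?_⟩
    decide +kernel
  · refine ⟨[
    ⟨[⟨.fref, 0, false, false⟩, ⟨.fref, 0, true, false⟩, ⟨.ref, 1, true, false⟩,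
      ⟨.ref, 0, true, false⟩, ⟨.ref, 0, true, false⟩],
      [], [62, 63, 64], [62, 61], 340282366920938463463374607431768211448⟩], ?_⟩
    decide +kernel

theorem exists_certs_6 (r f : ℕ) (hf : 0 < f) (h : r + f = 6) :
    ∃ cs, checkCerts (2 ^ 128) r f cs = true := by
  obtain rfl : r = 6 - f := by omega
  replace h : f ≤ 6 := by omega
  interval_cases f
  · refine ⟨[
    ⟨[⟨.rot, 1, false, false⟩, ⟨.frot, 0, false, false⟩, ⟨.rot, 0, false, false⟩,
      ⟨.fref, 0, false, false⟩, ⟨.rot, 1, false, false⟩, ⟨.rot, 0, false, false⟩],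
      [62, 63, 64, 65], [], [65, 66], 340282366920938463463374607431768211444⟩], ?_⟩
    decide +kernel
  · refine ⟨[
    ⟨[⟨.ref, 0, false, false⟩, ⟨.frot, 0, false, false⟩, ⟨.rot, 0, false, false⟩,
      ⟨.ref, 0, false, false⟩, ⟨.rot, 0, false, false⟩, ⟨.rot, 0, false, true⟩],
      [61, 62, 63], [62, 63], [66], 340282366920938463463374607431768211460⟩], ?_⟩
    decide +kernel
  · refine ⟨[
    ⟨[⟨.frot, 0, false, false⟩, ⟨.rot, 0, false, false⟩, ⟨.ref, 0, false, false⟩,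
      ⟨.ref, 0, true, false⟩, ⟨.ref, 0, true, false⟩, ⟨.rot, 0, false, false⟩],
      [62, 63], [64, 65, 66], [66], 340282366920938463463374607431768211450⟩], ?_⟩
    decide +kernel
  · refine ⟨[
    ⟨[⟨.frot, 0, false, false⟩, ⟨.ref, 1, false, false⟩, ⟨.frot, 0, false, false⟩,
      ⟨.ref, 1, false, false⟩, ⟨.ref, 0, true, false⟩, ⟨.ref, 0, true, true⟩],
      [], [64, 65, 66, 67], [66, 65], 340282366920938463463374607431768211600⟩], ?_⟩
    decide +kernel
  · refine ⟨[
    ⟨[⟨.frot, 0, false, false⟩, ⟨.fref, 0, false, false⟩, ⟨.ref, 1, true, false⟩,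
      ⟨.ref, 0, true, false⟩, ⟨.ref, 1, true, false⟩, ⟨.ref, 0, true, false⟩],
      [], [63, 64, 65, 66], [63, 64], 340282366920938463463374607431768211384⟩], ?_⟩
    decide +kernel
  · refine ⟨[
    ⟨[⟨.fref, 0, false, false⟩, ⟨.fref, 0, true, false⟩, ⟨.fref, 0, true, false⟩,
      ⟨.ref, 0, true, false⟩, ⟨.ref, 0, true, false⟩, ⟨.ref, 0, true, true⟩],
      [], [66, 67, 68], [65, 64, 65], 340282366920938463463374607431768211448⟩], ?_⟩
    decide +kernel

theorem exists_certs_7 (r f : ℕ) (hf : 0 < f) (h : r + f = 7) :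
    ∃ cs, checkCerts (2 ^ 128) r f cs = true := by
  obtain rfl : r = 7 - f := by omega
  replace h : f ≤ 7 := by omega
  interval_cases f
  · refine ⟨[
    ⟨[⟨.frot, 0, false, false⟩, ⟨.rot, 0, false, false⟩, ⟨.rot, 0, false, false⟩,
      ⟨.ref, 0, false, false⟩, ⟨.frot, 0, false, false⟩, ⟨.rot, 0, false, false⟩,
      ⟨.rot, 0, false, false⟩],
      [62, 63, 64, 65], [63], [65, 65], 340282366920938463463374607431768211480⟩], ?_⟩
    decide +kernel
  · refine ⟨[
    ⟨[⟨.ref, 0, false, false⟩, ⟨.frot, 0, false, false⟩, ⟨.rot, 0, false, false⟩,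
      ⟨.rot, 0, false, false⟩, ⟨.fref, 0, false, false⟩, ⟨.rot, 0, false, false⟩,
      ⟨.rot, 0, false, true⟩],
      [63, 64, 65, 66], [65], [63, 63], 340282366920938463463374607431768211480⟩], ?_⟩
    decide +kernel
  · refine ⟨[
    ⟨[⟨.rot, 0, false, false⟩, ⟨.frot, 0, false, false⟩, ⟨.ref, 0, false, false⟩,
      ⟨.ref, 0, true, false⟩, ⟨.ref, 0, true, false⟩, ⟨.rot, 0, false, false⟩,
      ⟨.rot, 0, false, false⟩],
      [65, 66, 67], [65, 66, 67], [63], 340282366920938463463374607431768211468⟩], ?_⟩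
    decide +kernel
  · refine ⟨[
    ⟨[⟨.rot, 0, false, false⟩, ⟨.ref, 1, false, false⟩, ⟨.frot, 0, false, false⟩,
      ⟨.rot, 0, false, false⟩, ⟨.ref, 0, false, false⟩, ⟨.ref, 0, true, false⟩,
      ⟨.ref, 0, true, true⟩],
      [61, 62], [64, 65, 66, 67], [66], 340282366920938463463374607431768211264⟩], ?_⟩
    decide +kernel
  · refine ⟨[
    ⟨[⟨.frot, 0, false, false⟩, ⟨.fref, 0, false, false⟩, ⟨.ref, 0, true, false⟩,
      ⟨.ref, 0, true, false⟩, ⟨.ref, 0, true, false⟩, ⟨.ref, 0, true, false⟩,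
      ⟨.frot, 0, false, false⟩],
      [], [63, 64, 65, 66], [62, 62, 66], 340282366920938463463374607431768211504⟩], ?_⟩
    decide +kernel
  · refine ⟨[
    ⟨[⟨.fref, 0, false, false⟩, ⟨.ref, 0, true, false⟩, ⟨.fref, 0, true, false⟩,
      ⟨.frot, 0, false, false⟩, ⟨.ref, 0, false, false⟩, ⟨.ref, 0, true, false⟩,
      ⟨.ref, 0, true, true⟩],
      [], [62, 63, 64, 65], [61, 63, 65], 340282366920938463463374607431768211384⟩], ?_⟩
    decide +kernel
  · refine ⟨[
    ⟨[⟨.fref, 0, false, false⟩, ⟨.fref, 0, true, false⟩, ⟨.ref, 0, true, false⟩,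
      ⟨.fref, 0, true, false⟩, ⟨.ref, 0, true, false⟩, ⟨.ref, 0, true, false⟩,
      ⟨.ref, 0, true, false⟩],
      [], [63, 64, 65, 66], [65, 62, 67], 340282366920938463463374607431768211480⟩], ?_⟩
    decide +kernel

theorem exists_certs_8 (r f : ℕ) (hf : 0 < f) (h : r + f = 8) :
    ∃ cs, checkCerts (2 ^ 128) r f cs = true := by
  obtain rfl : r = 8 - f := by omega
  replace h : f ≤ 8 := by omega
  interval_cases f
  · refine ⟨[
    ⟨[⟨.frot, 0, false, false⟩, ⟨.rot, 0, false, false⟩, ⟨.frot, 0, false, false⟩,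
      ⟨.rot, 0, false, false⟩, ⟨.fref, 0, false, false⟩, ⟨.rot, 1, false, false⟩,
      ⟨.rot, 0, false, false⟩, ⟨.rot, 0, false, false⟩],
      [62, 63, 64, 65, 66], [], [65, 63, 66], 340282366920938463463374607431768212032⟩], ?_⟩
    decide +kernel
  · refine ⟨[
    ⟨[⟨.fref, 0, false, false⟩, ⟨.frot, 0, false, false⟩, ⟨.rot, 1, false, false⟩,
      ⟨.rot, 0, false, false⟩, ⟨.rot, 0, false, false⟩, ⟨.fref, 0, false, false⟩,
      ⟨.rot, 0, false, false⟩, ⟨.rot, 0, false, true⟩],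
      [62, 63, 64, 65, 66], [], [62, 65, 66], 340282366920938463463374607431768212320⟩], ?_⟩
    decide +kernel
  · refine ⟨[
    ⟨[⟨.rot, 0, false, false⟩, ⟨.frot, 0, false, false⟩, ⟨.rot, 0, false, false⟩,
      ⟨.ref, 0, false, false⟩, ⟨.ref, 0, true, false⟩, ⟨.ref, 0, true, false⟩,
      ⟨.rot, 0, false, false⟩, ⟨.rot, 0, false, false⟩],
      [62, 63, 64, 65], [64, 65, 66], [65], 340282366920938463463374607431768211600⟩], ?_⟩
    decide +kernel
  · refine ⟨[
    ⟨[⟨.frot, 0, false, false⟩, ⟨.rot, 0, false, false⟩, ⟨.ref, 0, false, false⟩,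
      ⟨.rot, 0, false, false⟩, ⟨.rot, 0, false, false⟩, ⟨.ref, 0, false, false⟩,
      ⟨.ref, 0, true, false⟩, ⟨.ref, 0, true, true⟩],
      [63, 64, 65], [65, 66, 67, 68], [65], 340282366920938463463374607431768212608⟩], ?_⟩
    decide +kernel
  · refine ⟨[
    ⟨[⟨.rot, 0, false, false⟩, ⟨.rot, 0, false, false⟩, ⟨.fref, 0, false, false⟩,
      ⟨.ref, 0, true, false⟩, ⟨.ref, 0, true, false⟩, ⟨.ref, 0, true, false⟩,
      ⟨.ref, 0, true, false⟩, ⟨.rot, 0, false, false⟩],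
      [63, 64, 65], [65, 66, 67, 68], [66], 340282366920938463463374607431768211072⟩], ?_⟩
    decide +kernel
  · refine ⟨[
    ⟨[⟨.frot, 0, false, false⟩, ⟨.ref, 0, false, false⟩, ⟨.frot, 0, false, false⟩,
      ⟨.fref, 0, false, false⟩, ⟨.ref, 0, true, false⟩, ⟨.ref, 0, true, false⟩,
      ⟨.ref, 1, true, false⟩, ⟨.ref, 0, true, true⟩],
      [], [62, 63, 64, 65, 66], [65, 63, 63], 340282366920938463463374607431768201088⟩], ?_⟩
    decide +kernel
  · refine ⟨[
    ⟨[⟨.frot, 0, false, false⟩, ⟨.ref, 0, false, false⟩, ⟨.fref, 0, true, false⟩,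
      ⟨.ref, 1, true, false⟩, ⟨.fref, 0, true, false⟩, ⟨.ref, 0, true, false⟩,
      ⟨.ref, 0, true, false⟩, ⟨.ref, 0, true, false⟩],
      [], [62, 63, 64, 65, 66], [61, 67, 61], 340282366920938463463374607431768214336⟩], ?_⟩
    decide +kernel
  · refine ⟨[
    ⟨[⟨.fref, 0, false, false⟩, ⟨.ref, 1, true, false⟩, ⟨.fref, 0, true, false⟩,
      ⟨.ref, 1, true, false⟩, ⟨.fref, 0, true, false⟩, ⟨.ref, 0, true, false⟩,
      ⟨.ref, 0, true, false⟩, ⟨.ref, 0, true, true⟩],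
      [], [62, 63, 64, 65, 66], [67, 61, 66], 340282366920938463463374607431768208000⟩], ?_⟩
    decide +kernel

theorem exists_certs_9 (r f : ℕ) (hf : 0 < f) (h : r + f = 9) :
    ∃ cs, checkCerts (2 ^ 128) r f cs = true := by
  obtain rfl : r = 9 - f := by omega
  replace h : f ≤ 9 := by omega
  interval_cases f
  · refine ⟨[
    ⟨[⟨.frot, 0, false, false⟩, ⟨.rot, 1, false, false⟩, ⟨.frot, 0, false, false⟩,
      ⟨.rot, 1, false, false⟩, ⟨.fref, 0, false, false⟩, ⟨.rot, 1, false, false⟩,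
      ⟨.rot, 0, false, false⟩, ⟨.rot, 0, false, false⟩, ⟨.rot, 0, false, false⟩],
      [62, 63, 64, 65, 66, 67], [], [62, 65, 66], 340282366920938463463374607431768280576⟩], ?_⟩
    decide +kernel
  · refine ⟨[
    ⟨[⟨.fref, 0, false, false⟩, ⟨.rot, 1, false, false⟩, ⟨.frot, 0, false, false⟩,
      ⟨.rot, 1, false, false⟩, ⟨.rot, 1, false, false⟩, ⟨.fref, 0, false, false⟩,
      ⟨.rot, 0, false, false⟩, ⟨.rot, 0, false, false⟩, ⟨.rot, 0, false, true⟩],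
      [62, 63, 64, 65, 66, 67], [], [65, 62, 61], 340282366920938463463374607431768729856⟩], ?_⟩
    decide +kernel
  · refine ⟨[
    ⟨[⟨.rot, 0, false, false⟩, ⟨.rot, 0, false, false⟩, ⟨.frot, 0, false, false⟩,
      ⟨.ref, 0, false, false⟩, ⟨.ref, 1, true, false⟩, ⟨.ref, 0, true, false⟩,
      ⟨.rot, 0, false, false⟩, ⟨.rot, 0, false, false⟩, ⟨.rot, 0, false, false⟩],
      [62, 63, 64, 65, 66], [64, 65, 66], [63], 340282366920938463463374607431768228736⟩], ?_⟩
    decide +kernel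
  · refine ⟨[
    ⟨[⟨.ref, 0, false, false⟩, ⟨.rot, 0, false, false⟩, ⟨.frot, 0, false, false⟩,
      ⟨.rot, 0, false, false⟩, ⟨.ref, 0, false, false⟩, ⟨.ref, 0, true, false⟩,
      ⟨.ref, 0, true, false⟩, ⟨.rot, 0, false, false⟩, ⟨.rot, 0, false, true⟩],
      [63, 64, 65, 66], [64, 65, 66, 67], [63], 340282366920938463463374607431768197632⟩], ?_⟩
    decide +kernel
  · refine ⟨[
    ⟨[⟨.rot, 0, false, false⟩, ⟨.rot, 0, false, false⟩, ⟨.fref, 0, false, false⟩,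
      ⟨.ref, 0, true, false⟩, ⟨.ref, 0, true, false⟩, ⟨.ref, 0, true, false⟩,
      ⟨.ref, 0, true, false⟩, ⟨.rot, 0, false, false⟩, ⟨.rot, 0, false, false⟩],
      [62, 63, 64, 65], [61, 62, 63, 64], [62], 340282366920938463463374607431768167104⟩,
    ⟨[⟨.frot, 0, false, false⟩, ⟨.rot, 0, false, false⟩, ⟨.ref, 0, false, false⟩,
      ⟨.rot, 0, false, false⟩, ⟨.rot, 0, false, false⟩, ⟨.ref, 0, false, false⟩,
      ⟨.ref, 0, true, false⟩, ⟨.ref, 0, true, false⟩, ⟨.ref, 0, true, false⟩],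
      [63, 64, 65], [59, 60, 61, 62, 63], [65], 340282366920938463463374607431769133056⟩], ?_⟩
    decide +kernel
  · refine ⟨[
    ⟨[⟨.rot, 0, false, false⟩, ⟨.ref, 0, false, false⟩, ⟨.fref, 0, true, false⟩,
      ⟨.ref, 0, true, false⟩, ⟨.rot, 0, false, false⟩, ⟨.rot, 1, false, false⟩,
      ⟨.ref, 0, false, false⟩, ⟨.ref, 0, true, false⟩, ⟨.ref, 0, true, true⟩],
      [63, 64, 65], [60, 61, 62, 63, 64], [62], 340282366920938463463374607431768159616⟩], ?_⟩
    decide +kernel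
  · refine ⟨[
    ⟨[⟨.frot, 0, false, false⟩, ⟨.ref, 0, false, false⟩, ⟨.fref, 0, true, false⟩,
      ⟨.rot, 0, false, false⟩, ⟨.ref, 0, false, false⟩, ⟨.ref, 1, true, false⟩,
      ⟨.ref, 0, true, false⟩, ⟨.ref, 0, true, false⟩, ⟨.ref, 0, true, false⟩],
      [63], [64, 65, 66, 67, 68, 69], [67, 65], 340282366920938463463374607431699091456⟩], ?_⟩
    decide +kernel
  · refine ⟨[
    ⟨[⟨.fref, 0, false, false⟩, ⟨.ref, 1, true, false⟩, ⟨.fref, 0, true, false⟩,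
      ⟨.rot, 0, false, false⟩, ⟨.ref, 1, false, false⟩, ⟨.ref, 0, true, false⟩,
      ⟨.ref, 1, true, false⟩, ⟨.ref, 0, true, false⟩, ⟨.ref, 0, true, true⟩],
      [63], [62, 63, 64, 65, 66, 67], [64, 66], 340282366920938463463374607431842861056⟩], ?_⟩
    decide +kernel
  · refine ⟨[
    ⟨[⟨.ref, 1, false, false⟩, ⟨.fref, 0, true, false⟩, ⟨.ref, 1, true, false⟩,
      ⟨.fref, 0, true, false⟩, ⟨.ref, 1, true, false⟩, ⟨.fref, 0, true, false⟩,
      ⟨.ref, 0, true, false⟩, ⟨.ref, 0, true, false⟩, ⟨.ref, 0, true, false⟩],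
      [], [64, 65, 66, 67, 68, 69], [66, 67, 67], 340282366920938463463374607431769455616⟩], ?_⟩
    decide +kernel

theorem exists_certs_10 (r f : ℕ) (hf : 0 < f) (h : r + f = 10) :
    ∃ cs, checkCerts (2 ^ 128) r f cs = true := by
  obtain rfl : r = 10 - f := by omega
  replace h : f ≤ 10 := by omega
  interval_cases f
  · refine ⟨[
    ⟨[⟨.frot, 0, false, false⟩, ⟨.rot, 1, false, false⟩, ⟨.frot, 0, false, false⟩,
      ⟨.rot, 1, false, false⟩, ⟨.rot, 1, false, false⟩, ⟨.ref, 0, false, false⟩,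
      ⟨.rot, 1, false, false⟩, ⟨.rot, 1, false, false⟩, ⟨.rot, 0, false, false⟩,
      ⟨.rot, 0, false, false⟩],
      [62, 63, 64, 65, 66, 67, 68], [64], [62, 63], 340282366920938463463374607431370080256⟩], ?_⟩
    decide +kernel
  · refine ⟨[
    ⟨[⟨.ref, 0, false, false⟩, ⟨.frot, 0, false, false⟩, ⟨.rot, 0, false, false⟩,
      ⟨.frot, 0, false, false⟩, ⟨.rot, 0, false, false⟩, ⟨.rot, 0, false, false⟩,
      ⟨.ref, 0, false, false⟩, ⟨.rot, 0, false, false⟩, ⟨.rot, 0, false, false⟩,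
      ⟨.rot, 0, false, true⟩],
      [61, 62, 63, 64, 65, 66], [65, 66], [63, 65], 340282366920938463463374607431770976256⟩], ?_⟩
    decide +kernel
  · refine ⟨[
    ⟨[⟨.rot, 0, false, false⟩, ⟨.rot, 0, false, false⟩, ⟨.frot, 0, false, false⟩,
      ⟨.fref, 0, false, false⟩, ⟨.ref, 0, true, false⟩, ⟨.ref, 0, true, false⟩,
      ⟨.rot, 0, false, false⟩, ⟨.rot, 0, false, false⟩, ⟨.rot, 0, false, false⟩,
      ⟨.rot, 0, false, false⟩],
      [61, 62, 63, 64, 65, 66], [63, 64], [67, 67], 340282366920938463463374607431766276096⟩], ?_⟩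
    decide +kernel
  · refine ⟨[
    ⟨[⟨.frot, 0, false, false⟩, ⟨.rot, 0, false, false⟩, ⟨.ref, 0, false, false⟩,
      ⟨.rot, 0, false, false⟩, ⟨.rot, 0, false, false⟩, ⟨.rot, 0, false, false⟩,
      ⟨.rot, 0, false, false⟩, ⟨.ref, 0, false, false⟩, ⟨.ref, 0, true, false⟩,
      ⟨.ref, 0, true, true⟩],
      [62, 63, 64, 65, 66], [60, 61, 62, 63], [62], 340282366920938463463374607431771529216⟩], ?_⟩
    decide +kernel
  · refine ⟨[
    ⟨[⟨.rot, 0, false, false⟩, ⟨.rot, 0, false, false⟩, ⟨.frot, 0, false, false⟩,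
      ⟨.ref, 0, false, false⟩, ⟨.ref, 0, true, false⟩, ⟨.ref, 0, true, false⟩,
      ⟨.ref, 0, true, false⟩, ⟨.ref, 0, true, false⟩, ⟨.rot, 0, false, false⟩,
      ⟨.rot, 0, false, false⟩],
      [63, 64, 65, 66], [62, 63, 64, 65, 66], [63], 340282366920938463463374607431728260096⟩,
    ⟨[⟨.rot, 0, false, false⟩, ⟨.frot, 0, false, false⟩, ⟨.rot, 0, false, false⟩,
      ⟨.ref, 0, false, false⟩, ⟨.ref, 0, true, false⟩, ⟨.ref, 0, true, false⟩,
      ⟨.ref, 0, true, false⟩, ⟨.ref, 0, true, false⟩, ⟨.rot, 0, false, false⟩,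
      ⟨.rot, 0, false, false⟩],
      [60, 61, 62, 63], [65, 66, 67, 68, 69], [67], 340282366920938463463374607431766103296⟩], ?_⟩
    decide +kernel
  · refine ⟨[
    ⟨[⟨.rot, 1, false, false⟩, ⟨.rot, 0, false, false⟩, ⟨.ref, 0, false, false⟩,
      ⟨.ref, 0, true, false⟩, ⟨.ref, 0, true, false⟩, ⟨.frot, 0, false, false⟩,
      ⟨.rot, 0, false, false⟩, ⟨.ref, 0, false, false⟩, ⟨.ref, 1, true, false⟩,
      ⟨.ref, 0, true, true⟩],
      [63, 64, 65], [59, 60, 61, 62, 63, 64], [65], 340282366920938463463374607432763539456⟩], ?_⟩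
    decide +kernel
  · refine ⟨[
    ⟨[⟨.frot, 0, false, false⟩, ⟨.rot, 0, false, false⟩, ⟨.fref, 0, false, false⟩,
      ⟨.ref, 0, true, false⟩, ⟨.ref, 0, true, false⟩, ⟨.ref, 0, true, false⟩,
      ⟨.ref, 0, true, false⟩, ⟨.ref, 0, true, false⟩, ⟨.ref, 0, true, false⟩,
      ⟨.rot, 0, false, false⟩],
      [62, 63], [63, 64, 65, 66, 67, 68], [65, 64], 340282366920938463463374607431952623616⟩,
    ⟨[⟨.frot, 0, false, false⟩, ⟨.rot, 0, false, false⟩, ⟨.ref, 0, false, false⟩,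
      ⟨.fref, 0, true, false⟩, ⟨.ref, 0, true, false⟩, ⟨.ref, 0, true, false⟩,
      ⟨.ref, 0, true, false⟩, ⟨.ref, 0, true, false⟩, ⟨.ref, 0, true, false⟩,
      ⟨.rot, 0, false, false⟩],
      [62, 63], [59, 60, 61, 62, 63, 64], [65, 63], 340282366920938463463374607430721838336⟩], ?_⟩
    decide +kernel
  · refine ⟨[
    ⟨[⟨.rot, 0, false, false⟩, ⟨.ref, 0, false, false⟩, ⟨.rot, 0, false, false⟩,
      ⟨.fref, 0, false, false⟩, ⟨.fref, 0, true, false⟩, ⟨.ref, 0, true, false⟩,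
      ⟨.ref, 0, true, false⟩, ⟨.ref, 0, true, false⟩, ⟨.ref, 0, true, false⟩,
      ⟨.ref, 0, true, true⟩],
      [63, 64], [60, 61, 62, 63, 64, 65], [65, 66], 340282366920938463463374607432869154816⟩,
    ⟨[⟨.rot, 0, false, false⟩, ⟨.ref, 0, false, false⟩, ⟨.fref, 0, true, false⟩,
      ⟨.fref, 0, true, false⟩, ⟨.rot, 0, false, false⟩, ⟨.ref, 0, false, false⟩,
      ⟨.ref, 0, true, false⟩, ⟨.ref, 0, true, false⟩, ⟨.ref, 0, true, false⟩,
      ⟨.ref, 0, true, true⟩],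
      [62, 63], [59, 60, 61, 62, 63, 64], [65, 66], 340282366920938463463374607434526030336⟩], ?_⟩
    decide +kernel
  · refine ⟨[
    ⟨[⟨.ref, 1, false, false⟩, ⟨.fref, 0, true, false⟩, ⟨.fref, 0, true, false⟩,
      ⟨.ref, 0, true, false⟩, ⟨.frot, 0, false, false⟩, ⟨.ref, 1, false, false⟩,
      ⟨.ref, 1, true, false⟩, ⟨.ref, 0, true, false⟩, ⟨.ref, 1, true, false⟩,
      ⟨.ref, 0, true, false⟩],
      [], [64, 65, 66, 67, 68, 69, 70], [62, 63, 63], 340282366920938463463374625629797933056⟩,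
    ⟨[⟨.ref, 0, false, false⟩, ⟨.fref, 0, true, false⟩, ⟨.frot, 0, false, false⟩,
      ⟨.ref, 0, false, false⟩, ⟨.fref, 0, true, false⟩, ⟨.ref, 1, true, false⟩,
      ⟨.ref, 1, true, false⟩, ⟨.ref, 1, true, false⟩, ⟨.ref, 1, true, false⟩,
      ⟨.ref, 0, true, false⟩],
      [], [61, 62, 63, 64, 65, 66, 67], [66, 62, 64], 340282366920938463463374608138699923456⟩], ?_⟩
    decide +kernel
  · refine ⟨[
    ⟨[⟨.ref, 0, false, false⟩, ⟨.ref, 0, true, false⟩, ⟨.fref, 0, true, false⟩,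
      ⟨.fref, 0, true, false⟩, ⟨.fref, 0, true, false⟩, ⟨.ref, 0, true, false⟩,
      ⟨.fref, 0, true, false⟩, ⟨.ref, 0, true, false⟩, ⟨.ref, 0, true, false⟩,
      ⟨.ref, 0, true, true⟩],
      [], [64, 65, 66, 67, 68, 69], [62, 61, 67, 63], 340282366920938463463374607431737729536⟩], ?_⟩
    decide +kernel

theorem exists_certs_11 (r f : ℕ) (hf : 0 < f) (h : r + f = 11) :
    ∃ cs, checkCerts (2 ^ 128) r f cs = true := by
  obtain rfl : r = 11 - f := by omega
  replace h : f ≤ 11 := by omega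
  interval_cases f
  · refine ⟨[
    ⟨[⟨.rot, 0, false, false⟩, ⟨.frot, 0, false, false⟩, ⟨.rot, 0, false, false⟩,
      ⟨.frot, 0, false, false⟩, ⟨.rot, 0, false, false⟩, ⟨.rot, 0, false, false⟩,
      ⟨.ref, 0, false, false⟩, ⟨.frot, 0, false, false⟩, ⟨.rot, 0, false, false⟩,
      ⟨.rot, 0, false, false⟩, ⟨.rot, 0, false, false⟩],
      [61, 62, 63, 64, 65, 66, 67], [64], [63, 65, 65],
      340282366920938463463374607428782227456⟩], ?_⟩
    decide +kernel
  · refine ⟨[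
    ⟨[⟨.fref, 0, false, false⟩, ⟨.rot, 0, false, false⟩, ⟨.frot, 0, false, false⟩,
      ⟨.rot, 0, false, false⟩, ⟨.frot, 0, false, false⟩, ⟨.rot, 0, false, false⟩,
      ⟨.rot, 0, false, false⟩, ⟨.fref, 0, false, false⟩, ⟨.rot, 0, false, false⟩,
      ⟨.rot, 0, false, false⟩, ⟨.rot, 0, false, true⟩],
      [61, 62, 63, 64, 65, 66, 67], [], [61, 63, 65, 67],
      340282366920938463463374607422810259456⟩], ?_⟩
    decide +kernel
  · refine ⟨[
    ⟨[⟨.rot, 1, false, false⟩, ⟨.rot, 0, false, false⟩, ⟨.frot, 0, false, false⟩,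
      ⟨.rot, 0, false, false⟩, ⟨.fref, 0, false, false⟩, ⟨.fref, 0, true, false⟩,
      ⟨.fref, 0, true, false⟩, ⟨.rot, 0, false, false⟩, ⟨.rot, 0, false, false⟩,
      ⟨.rot, 0, false, false⟩, ⟨.rot, 0, false, false⟩],
      [61, 62, 63, 64, 65, 66, 67], [], [65, 63, 62, 63],
      340282366920938463463374607430175686656⟩], ?_⟩
    decide +kernel
  · refine ⟨[
    ⟨[⟨.fref, 0, false, false⟩, ⟨.fref, 0, true, false⟩, ⟨.fref, 0, true, false⟩,
      ⟨.rot, 0, false, false⟩, ⟨.rot, 0, false, false⟩, ⟨.rot, 0, false, false⟩,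
      ⟨.rot, 0, false, false⟩, ⟨.rot, 0, false, false⟩, ⟨.fref, 0, false, false⟩,
      ⟨.rot, 0, false, false⟩, ⟨.rot, 0, false, true⟩],
      [61, 62, 63, 64, 65, 66, 67], [], [61, 62, 63, 67],
      340282366920938463463374607306356883456⟩], ?_⟩
    decide +kernel
  · refine ⟨[
    ⟨[⟨.rot, 0, false, false⟩, ⟨.rot, 0, false, false⟩, ⟨.rot, 0, false, false⟩,
      ⟨.fref, 0, false, false⟩, ⟨.ref, 0, true, false⟩, ⟨.ref, 0, true, false⟩,
      ⟨.ref, 1, true, false⟩, ⟨.ref, 0, true, false⟩, ⟨.rot, 0, false, false⟩,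
      ⟨.rot, 0, false, false⟩, ⟨.rot, 0, false, false⟩],
      [62, 63, 64, 65, 66, 67], [64, 65, 66, 67], [66],
      340282366920938463463374607430573817856⟩], ?_⟩
    decide +kernel
  · refine ⟨[
    ⟨[⟨.ref, 0, false, false⟩, ⟨.rot, 0, false, false⟩, ⟨.rot, 0, false, false⟩,
      ⟨.frot, 0, false, false⟩, ⟨.rot, 0, false, false⟩, ⟨.ref, 0, false, false⟩,
      ⟨.ref, 0, true, false⟩, ⟨.ref, 0, true, false⟩, ⟨.ref, 0, true, false⟩,
      ⟨.ref, 0, true, false⟩, ⟨.rot, 0, false, true⟩],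
      [62, 63, 64, 65], [58, 59, 60, 61, 62, 63], [65], 340282366920938463463374607365048887296⟩,
    ⟨[⟨.rot, 0, false, false⟩, ⟨.ref, 0, false, false⟩, ⟨.rot, 0, false, false⟩,
      ⟨.rot, 0, false, false⟩, ⟨.frot, 0, false, false⟩, ⟨.rot, 0, false, false⟩,
      ⟨.ref, 0, false, false⟩, ⟨.ref, 0, true, false⟩, ⟨.ref, 0, true, false⟩,
      ⟨.ref, 0, true, false⟩, ⟨.ref, 0, true, true⟩],
      [62, 63, 64, 65], [62, 63, 64, 65, 66, 67], [65],
      340282366920938463463374607434945796096⟩], ?_⟩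
    decide +kernel
  · refine ⟨[
    ⟨[⟨.frot, 0, false, false⟩, ⟨.rot, 0, false, false⟩, ⟨.ref, 0, false, false⟩,
      ⟨.ref, 0, true, false⟩, ⟨.ref, 1, true, false⟩, ⟨.rot, 0, false, false⟩,
      ⟨.ref, 0, false, false⟩, ⟨.ref, 0, true, false⟩, ⟨.ref, 0, true, false⟩,
      ⟨.ref, 0, true, false⟩, ⟨.frot, 0, false, false⟩],
      [62, 63], [64, 65, 66, 67, 68, 69, 70], [65, 67], 340282366920938463463373900483235168256⟩,
    ⟨[⟨.rot, 0, false, false⟩, ⟨.rot, 0, false, false⟩, ⟨.ref, 0, false, false⟩,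
      ⟨.rot, 0, false, false⟩, ⟨.rot, 0, false, false⟩, ⟨.fref, 0, false, false⟩,
      ⟨.ref, 0, true, false⟩, ⟨.ref, 0, true, false⟩, ⟨.ref, 0, true, false⟩,
      ⟨.ref, 0, true, false⟩, ⟨.ref, 0, true, false⟩],
      [62, 63, 64, 65], [63, 64, 65, 66, 67, 68], [64],
      340282366920938463463374611679214329856⟩], ?_⟩
    decide +kernel
  · refine ⟨[
    ⟨[⟨.rot, 0, false, false⟩, ⟨.ref, 0, false, false⟩, ⟨.frot, 0, false, false⟩,
      ⟨.fref, 0, false, false⟩, ⟨.ref, 0, true, false⟩, ⟨.frot, 0, false, false⟩,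
      ⟨.ref, 0, false, false⟩, ⟨.ref, 0, true, false⟩, ⟨.ref, 0, true, false⟩,
      ⟨.ref, 0, true, false⟩, ⟨.ref, 0, true, true⟩],
      [63], [60, 61, 62, 63, 64, 65, 66], [67, 67, 65], 340282366920938463463374701552024313856⟩,
    ⟨[⟨.frot, 0, false, false⟩, ⟨.ref, 0, false, false⟩, ⟨.frot, 0, false, false⟩,
      ⟨.ref, 0, false, false⟩, ⟨.fref, 0, true, false⟩, ⟨.frot, 0, false, false⟩,
      ⟨.ref, 0, false, false⟩, ⟨.ref, 0, true, false⟩, ⟨.ref, 0, true, false⟩,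
      ⟨.ref, 0, true, false⟩, ⟨.ref, 0, true, true⟩],
      [], [59, 60, 61, 62, 63, 64, 65], [66, 62, 67, 61],
      340282366920938463463374687895726022656⟩], ?_⟩
    decide +kernel
  · refine ⟨[
    ⟨[⟨.frot, 0, false, false⟩, ⟨.ref, 0, false, false⟩, ⟨.frot, 0, false, false⟩,
      ⟨.ref, 0, false, false⟩, ⟨.fref, 0, true, false⟩, ⟨.fref, 0, true, false⟩,
      ⟨.ref, 0, true, false⟩, ⟨.ref, 0, true, false⟩, ⟨.ref, 0, true, false⟩,
      ⟨.ref, 0, true, false⟩, ⟨.ref, 0, true, false⟩],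
      [], [65, 66, 67, 68, 69, 70, 71], [63, 67, 62, 64], 340282366920938463463373890930201440256⟩,
    ⟨[⟨.frot, 0, false, false⟩, ⟨.ref, 0, false, false⟩, ⟨.fref, 0, true, false⟩,
      ⟨.ref, 0, true, false⟩, ⟨.frot, 0, false, false⟩, ⟨.fref, 0, false, false⟩,
      ⟨.ref, 0, true, false⟩, ⟨.ref, 0, true, false⟩, ⟨.ref, 0, true, false⟩,
      ⟨.ref, 0, true, false⟩, ⟨.ref, 0, true, false⟩],
      [], [57, 58, 59, 60, 61, 62, 63], [61, 64, 67, 61],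
      340282366920938463463374563958453907456⟩], ?_⟩
    decide +kernel
  · refine ⟨[
    ⟨[⟨.ref, 0, false, false⟩, ⟨.ref, 0, true, false⟩, ⟨.fref, 0, true, false⟩,
      ⟨.ref, 0, true, false⟩, ⟨.fref, 0, true, false⟩, ⟨.frot, 0, false, false⟩,
      ⟨.ref, 1, false, false⟩, ⟨.fref, 0, true, false⟩, ⟨.ref, 0, true, false⟩,
      ⟨.ref, 0, true, false⟩, ⟨.ref, 0, true, true⟩],
      [], [61, 62, 63, 64, 65, 66, 67], [63, 65, 65, 64],
      340282366920938463463374607180945555456⟩], ?_⟩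
    decide +kernel
  · refine ⟨[
    ⟨[⟨.ref, 0, false, false⟩, ⟨.fref, 0, true, false⟩, ⟨.ref, 0, true, false⟩,
      ⟨.fref, 0, true, false⟩, ⟨.fref, 0, true, false⟩, ⟨.fref, 0, true, false⟩,
      ⟨.ref, 1, true, false⟩, ⟨.ref, 0, true, false⟩, ⟨.ref, 0, true, false⟩,
      ⟨.ref, 0, true, false⟩, ⟨.ref, 0, true, false⟩],
      [], [59, 60, 61, 62, 63, 64, 65], [66, 61, 66, 64], 340282366920938463463374548158418169856⟩,
    ⟨[⟨.ref, 0, false, false⟩, ⟨.fref, 0, true, false⟩, ⟨.ref, 1, true, false⟩,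
      ⟨.fref, 0, true, false⟩, ⟨.fref, 0, true, false⟩, ⟨.fref, 0, true, false⟩,
      ⟨.ref, 0, true, false⟩, ⟨.ref, 0, true, false⟩, ⟨.ref, 0, true, false⟩,
      ⟨.ref, 0, true, false⟩, ⟨.ref, 0, true, false⟩],
      [], [62, 63, 64, 65, 66, 67, 68], [61, 67, 61, 62],
      340282366920938463463374611487704928256⟩], ?_⟩
    decide +kernel

set_option maxHeartbeats 4000000 in
theorem exists_certs_12 (r f : ℕ) (hf : 0 < f) (h : r + f = 12) :
    ∃ cs, checkCerts (2 ^ 128) r f cs = true := by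
  obtain rfl : r = 12 - f := by omega
  replace h : f ≤ 12 := by omega
  interval_cases f
  · refine ⟨[
    ⟨[⟨.rot, 0, false, false⟩, ⟨.frot, 0, false, false⟩, ⟨.rot, 0, false, false⟩,
      ⟨.frot, 0, false, false⟩, ⟨.rot, 0, false, false⟩, ⟨.frot, 0, false, false⟩,
      ⟨.rot, 0, false, false⟩, ⟨.ref, 0, false, false⟩, ⟨.rot, 1, false, false⟩,
      ⟨.rot, 0, false, false⟩, ⟨.rot, 0, false, false⟩, ⟨.rot, 0, false, false⟩],
      [60, 61, 62, 63, 64, 65, 66, 67], [64], [67, 61, 67],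
      340282366920938463463374623484418195456⟩], ?_⟩
    decide +kernel
  · refine ⟨[
    ⟨[⟨.ref, 0, false, false⟩, ⟨.rot, 1, false, false⟩, ⟨.rot, 1, false, false⟩,
      ⟨.frot, 0, false, false⟩, ⟨.rot, 0, false, false⟩, ⟨.frot, 0, false, false⟩,
      ⟨.rot, 1, false, false⟩, ⟨.fref, 0, false, false⟩, ⟨.rot, 0, false, false⟩,
      ⟨.rot, 0, false, false⟩, ⟨.rot, 0, false, false⟩, ⟨.rot, 0, false, true⟩],
      [60, 61, 62, 63, 64, 65, 66, 67], [61], [66, 63, 66],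
      340282366920938463463374649569974419456⟩], ?_⟩
    decide +kernel
  · refine ⟨[
    ⟨[⟨.rot, 0, false, false⟩, ⟨.frot, 0, false, false⟩, ⟨.rot, 2, false, false⟩,
      ⟨.fref, 0, false, false⟩, ⟨.ref, 0, true, false⟩, ⟨.rot, 0, false, false⟩,
      ⟨.rot, 0, false, false⟩, ⟨.fref, 0, false, false⟩, ⟨.rot, 0, false, false⟩,
      ⟨.rot, 0, false, false⟩, ⟨.rot, 0, false, false⟩, ⟨.rot, 0, false, false⟩],
      [61, 62, 63, 64, 65, 66, 67, 68], [64], [65, 66, 65],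
      340282366920938463463375149208705171456⟩], ?_⟩
    decide +kernel
  · refine ⟨[
    ⟨[⟨.fref, 0, false, false⟩, ⟨.rot, 0, false, false⟩, ⟨.rot, 1, false, false⟩,
      ⟨.rot, 1, false, false⟩, ⟨.rot, 1, false, false⟩, ⟨.rot, 0, false, false⟩,
      ⟨.fref, 0, false, false⟩, ⟨.fref, 0, true, false⟩, ⟨.ref, 0, true, false⟩,
      ⟨.rot, 0, false, false⟩, ⟨.rot, 0, false, false⟩, ⟨.rot, 0, false, true⟩],
      [60, 61, 62, 63, 64, 65, 66, 67], [63], [66, 61, 63],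
      340282366920938463463374795548760211456⟩], ?_⟩
    decide +kernel
  · refine ⟨[
    ⟨[⟨.rot, 0, false, false⟩, ⟨.rot, 0, false, false⟩, ⟨.rot, 0, false, false⟩,
      ⟨.fref, 0, false, false⟩, ⟨.ref, 0, true, false⟩, ⟨.ref, 1, true, false⟩,
      ⟨.ref, 0, true, false⟩, ⟨.ref, 1, true, false⟩, ⟨.rot, 0, false, false⟩,
      ⟨.rot, 0, false, false⟩, ⟨.rot, 0, false, false⟩, ⟨.rot, 0, false, false⟩],
      [61, 62, 63, 64, 65, 66, 67], [64, 65, 66, 67], [63],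
      340282366920938463463374593161153478656⟩,
    ⟨[⟨.rot, 0, false, false⟩, ⟨.rot, 0, false, false⟩, ⟨.frot, 0, false, false⟩,
      ⟨.rot, 0, false, false⟩, ⟨.ref, 0, false, false⟩, ⟨.ref, 0, true, false⟩,
      ⟨.ref, 0, true, false⟩, ⟨.ref, 0, true, false⟩, ⟨.ref, 0, true, false⟩,
      ⟨.rot, 0, false, false⟩, ⟨.rot, 0, false, false⟩, ⟨.rot, 0, false, false⟩],
      [62, 63, 64, 65, 66, 67], [62, 63, 64, 65, 66], [63],
      340282366920938463463374660732727238656⟩], ?_⟩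
    decide +kernel
  · refine ⟨[
    ⟨[⟨.frot, 0, false, false⟩, ⟨.rot, 0, false, false⟩, ⟨.ref, 0, false, false⟩,
      ⟨.rot, 0, false, false⟩, ⟨.rot, 0, false, false⟩, ⟨.rot, 0, false, false⟩,
      ⟨.rot, 0, false, false⟩, ⟨.ref, 0, false, false⟩, ⟨.ref, 0, true, false⟩,
      ⟨.ref, 0, true, false⟩, ⟨.ref, 0, true, false⟩, ⟨.ref, 0, true, true⟩],
      [62, 63, 64, 65, 66], [65, 66, 67, 68, 69, 70], [62],
      340282366920938463463376358752949108736⟩,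
    ⟨[⟨.rot, 0, false, false⟩, ⟨.frot, 0, false, false⟩, ⟨.ref, 0, false, false⟩,
      ⟨.rot, 0, false, false⟩, ⟨.rot, 0, false, false⟩, ⟨.rot, 0, false, false⟩,
      ⟨.rot, 0, false, false⟩, ⟨.ref, 0, false, false⟩, ⟨.ref, 0, true, false⟩,
      ⟨.ref, 0, true, false⟩, ⟨.ref, 0, true, false⟩, ⟨.ref, 0, true, true⟩],
      [62, 63, 64, 65, 66], [64, 65, 66, 67, 68, 69], [63],
      340282366920938463463376077342350770176⟩], ?_⟩
    decide +kernel
  · refine ⟨[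
    ⟨[⟨.rot, 0, false, false⟩, ⟨.rot, 0, false, false⟩, ⟨.rot, 0, false, false⟩,
      ⟨.ref, 0, false, false⟩, ⟨.fref, 0, true, false⟩, ⟨.ref, 0, true, false⟩,
      ⟨.ref, 0, true, false⟩, ⟨.ref, 0, true, false⟩, ⟨.ref, 0, true, false⟩,
      ⟨.ref, 0, true, false⟩, ⟨.rot, 0, false, false⟩, ⟨.rot, 0, false, false⟩],
      [62, 63, 64, 65, 66], [64, 65, 66, 67, 68, 69], [67],
      340282366920938463463373664023162208256⟩,
    ⟨[⟨.ref, 0, false, false⟩, ⟨.ref, 0, true, false⟩, ⟨.rot, 0, false, false⟩,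
      ⟨.frot, 0, false, false⟩, ⟨.rot, 0, false, false⟩, ⟨.ref, 0, false, false⟩,
      ⟨.rot, 0, false, false⟩, ⟨.rot, 0, false, false⟩, ⟨.ref, 0, false, false⟩,
      ⟨.ref, 0, true, false⟩, ⟨.ref, 0, true, false⟩, ⟨.ref, 0, true, false⟩],
      [62, 63, 64, 65], [60, 61, 62, 63, 64, 65, 66], [65],
      340282366920938463463376152649822765056⟩], ?_⟩
    decide +kernel
  · refine ⟨[
    ⟨[⟨.ref, 0, false, false⟩, ⟨.frot, 0, false, false⟩, ⟨.ref, 0, false, false⟩,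
      ⟨.frot, 0, false, false⟩, ⟨.rot, 0, false, false⟩, ⟨.ref, 1, false, false⟩,
      ⟨.rot, 0, false, false⟩, ⟨.ref, 1, false, false⟩, ⟨.ref, 0, true, false⟩,
      ⟨.ref, 0, true, false⟩, ⟨.ref, 0, true, false⟩, ⟨.ref, 0, true, true⟩],
      [61, 62], [64, 65, 66, 67, 68, 69, 70, 71], [65, 66],
      340282366920938465183056919820408979456⟩,
    ⟨[⟨.ref, 0, false, false⟩, ⟨.frot, 0, false, false⟩, ⟨.ref, 1, false, false⟩,
      ⟨.frot, 0, false, false⟩, ⟨.rot, 0, false, false⟩, ⟨.ref, 0, false, false⟩,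
      ⟨.rot, 0, false, false⟩, ⟨.ref, 1, false, false⟩, ⟨.ref, 0, true, false⟩,
      ⟨.ref, 0, true, false⟩, ⟨.ref, 0, true, false⟩, ⟨.ref, 0, true, true⟩],
      [61, 62], [64, 65, 66, 67, 68, 69, 70, 71], [67, 66],
      340282366920938461331095961169565843456⟩], ?_⟩
    decide +kernel
  · refine ⟨[
    ⟨[⟨.ref, 0, false, false⟩, ⟨.ref, 0, true, false⟩, ⟨.frot, 0, false, false⟩,
      ⟨.fref, 0, false, false⟩, ⟨.frot, 0, false, false⟩, ⟨.ref, 0, false, false⟩,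
      ⟨.frot, 0, false, false⟩, ⟨.ref, 0, false, false⟩, ⟨.ref, 0, true, false⟩,
      ⟨.ref, 0, true, false⟩, ⟨.ref, 0, true, false⟩, ⟨.ref, 0, true, false⟩],
      [], [65, 66, 67, 68, 69, 70, 71, 72], [62, 67, 62, 61],
      340282366920938463417958135314602131456⟩,
    ⟨[⟨.ref, 0, false, false⟩, ⟨.ref, 0, true, false⟩, ⟨.rot, 0, false, false⟩,
      ⟨.ref, 0, false, false⟩, ⟨.fref, 0, true, false⟩, ⟨.frot, 0, false, false⟩,
      ⟨.rot, 0, false, false⟩, ⟨.ref, 0, false, false⟩, ⟨.ref, 0, true, false⟩,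
      ⟨.ref, 0, true, false⟩, ⟨.ref, 0, true, false⟩, ⟨.ref, 0, true, false⟩],
      [66, 67], [61, 62, 63, 64, 65, 66, 67, 68], [63, 62],
      340282366920938463553275843696130195456⟩], ?_⟩
    decide +kernel
  · refine ⟨[
    ⟨[⟨.ref, 0, false, false⟩, ⟨.ref, 0, true, false⟩, ⟨.fref, 0, true, false⟩,
      ⟨.frot, 0, false, false⟩, ⟨.ref, 1, false, false⟩, ⟨.fref, 0, true, false⟩,
      ⟨.rot, 0, false, false⟩, ⟨.ref, 1, false, false⟩, ⟨.ref, 0, true, false⟩,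
      ⟨.ref, 0, true, false⟩, ⟨.ref, 0, true, false⟩, ⟨.ref, 0, true, true⟩],
      [63], [60, 61, 62, 63, 64, 65, 66, 67], [65, 65, 62],
      340282366920938463470097056054229139456⟩,
    ⟨[⟨.ref, 0, false, false⟩, ⟨.ref, 1, true, false⟩, ⟨.fref, 0, true, false⟩,
      ⟨.frot, 0, false, false⟩, ⟨.ref, 1, false, false⟩, ⟨.fref, 0, true, false⟩,
      ⟨.rot, 0, false, false⟩, ⟨.ref, 0, false, false⟩, ⟨.ref, 0, true, false⟩,
      ⟨.ref, 0, true, false⟩, ⟨.ref, 0, true, false⟩, ⟨.ref, 0, true, true⟩],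
      [63], [60, 61, 62, 63, 64, 65, 66, 67], [65, 65, 62],
      340282366920938463465923795714308243456⟩], ?_⟩
    decide +kernel
  · refine ⟨[
    ⟨[⟨.fref, 0, false, false⟩, ⟨.fref, 0, true, false⟩, ⟨.ref, 1, true, false⟩,
      ⟨.fref, 0, true, false⟩, ⟨.frot, 0, false, false⟩, ⟨.ref, 0, false, false⟩,
      ⟨.ref, 1, true, false⟩, ⟨.ref, 0, true, false⟩, ⟨.ref, 0, true, false⟩,
      ⟨.ref, 0, true, false⟩, ⟨.ref, 0, true, false⟩, ⟨.ref, 0, true, false⟩],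
      [], [57, 58, 59, 60, 61, 62, 63, 64], [65, 61, 65, 61],
      340282366920938464600569644317481107456⟩,
    ⟨[⟨.fref, 0, false, false⟩, ⟨.fref, 0, true, false⟩, ⟨.ref, 1, true, false⟩,
      ⟨.fref, 0, true, false⟩, ⟨.frot, 0, false, false⟩, ⟨.ref, 1, false, false⟩,
      ⟨.ref, 0, true, false⟩, ⟨.ref, 0, true, false⟩, ⟨.ref, 0, true, false⟩,
      ⟨.ref, 0, true, false⟩, ⟨.ref, 0, true, false⟩, ⟨.ref, 0, true, false⟩],
      [], [57, 58, 59, 60, 61, 62, 63, 64], [65, 61, 65, 61],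
      340282366920938462882708663087798419456⟩], ?_⟩
    decide +kernel
  · refine ⟨[
    ⟨[⟨.ref, 0, false, false⟩, ⟨.ref, 1, true, false⟩, ⟨.fref, 0, true, false⟩,
      ⟨.ref, 1, true, false⟩, ⟨.fref, 0, true, false⟩, ⟨.fref, 0, true, false⟩,
      ⟨.fref, 0, true, false⟩, ⟨.ref, 1, true, false⟩, ⟨.ref, 0, true, false⟩,
      ⟨.ref, 1, true, false⟩, ⟨.ref, 0, true, false⟩, ⟨.ref, 0, true, true⟩],
      [], [57, 58, 59, 60, 61, 62, 63, 64], [62, 61, 66, 64],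
      340282366920938463466185441744148627456⟩,
    ⟨[⟨.ref, 1, false, false⟩, ⟨.ref, 1, true, false⟩, ⟨.fref, 0, true, false⟩,
      ⟨.ref, 1, true, false⟩, ⟨.fref, 0, true, false⟩, ⟨.fref, 0, true, false⟩,
      ⟨.fref, 0, true, false⟩, ⟨.ref, 1, true, false⟩, ⟨.ref, 0, true, false⟩,
      ⟨.ref, 0, true, false⟩, ⟨.ref, 0, true, false⟩, ⟨.ref, 0, true, true⟩],
      [], [57, 58, 59, 60, 61, 62, 63, 64], [62, 61, 66, 64],
      340282366920938463483627055419750547456⟩], ?_⟩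
    decide +kernel

/-! ### The distinguished coefficients -/

theorem checkLane_2 : and (checkLane 12 7 0 true 2 1)
    (checkLane 12 7 0 false 4 0) = true := by
  decide +kernel

theorem checkLane_3 : and (checkLane 12 7 1 true 10 1)
    (checkLane 12 7 1 false 12 1) = true := by
  decide +kernel

theorem checkLane_4 : and (checkLane 14 9 2 true 26 1)
    (checkLane 14 9 2 false 28 0) = true := by
  decide +kernel

theorem checkLane_5 : and (checkLane 21 16 3 true 58 4)
    (checkLane 21 16 3 false 60 2) = true := by
  decide +kernel

theorem checkLane_6 : and (checkLane 30 25 4 true 122 28)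
    (checkLane 30 25 4 false 124 68) = true := by
  decide +kernel

theorem checkLane_7 : and (checkLane 42 37 5 true 250 966)
    (checkLane 42 37 5 false 252 2628) = true := by
  decide +kernel

theorem checkLane_8 : and (checkLane 58 53 6 true 506 366468)
    (checkLane 58 53 6 false 508 458880) = true := by
  decide +kernel

theorem checkLane_9 : and (checkLane 76 71 7 true 1018 359616276)
    (checkLane 76 71 7 false 1020 490213932) = true := by
  decide +kernel

theorem checkLane_10 : and (checkLane 98 93 8 true 2042 595372941856)
    (checkLane 98 93 8 false 2044 2000044737578) = true := by
  decide +kernel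

theorem checkLane_11 : and (checkLane 123 118 9 true 4090 18128730243333160)
    (checkLane 123 118 9 false 4092 64511753120566768) = true := by
  decide +kernel

theorem checkLane_12 : and (checkLane 152 147 10 true 8186 18030683474081274074352)
    (checkLane 152 147 10 false 8188 27972130746059470588680) = true := by
  decide +kernel

/-- Sets of rotations are sequenceable. -/
theorem sequenceable_of_forall_rotation {m k : ℕ} (hm : m.Prime) (hm3 : 3 < m) (hk : k ≤ 12)
    {S : Finset (DihedralGroup m)} (hS : ∀ g ∈ S, dRef g = false)
    (h1 : (1 : DihedralGroup m) ∉ S) (hcard : S.card = k) : Sequenceable S := by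
  interval_cases k
  · rw [Finset.card_eq_zero] at hcard
    subst hcard
    exact ⟨[], by simp, by simp, fun i j hij hj _ =>
        absurd hj (by simp only [List.length_nil]; omega)⟩
  · obtain ⟨g, rfl⟩ := Finset.card_eq_one.mp hcard
    refine ⟨[g], by simp, by simp, fun i j hij hj hn => ?_⟩
    simp only [List.length_singleton] at hj hn
    omega
  · exact sequenceable_of_checkLane hm hm3 (by norm_num) (by norm_num) (by norm_num)
      (by decide +kernel) (by decide +kernel) (by decide +kernel) (by decide +kernel)
      (by decide +kernel) checkLane_2 hS h1 hcard
  · exact sequenceable_of_checkLane hm hm3 (by norm_num) (by norm_num) (by norm_num)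
      (by decide +kernel) (by decide +kernel) (by decide +kernel) (by decide +kernel)
      (by decide +kernel) checkLane_3 hS h1 hcard
  · exact sequenceable_of_checkLane hm hm3 (by norm_num) (by norm_num) (by norm_num)
      (by decide +kernel) (by decide +kernel) (by decide +kernel) (by decide +kernel)
      (by decide +kernel) checkLane_4 hS h1 hcard
  · exact sequenceable_of_checkLane hm hm3 (by norm_num) (by norm_num) (by norm_num)
      (by decide +kernel) (by decide +kernel) (by decide +kernel) (by decide +kernel)
      (by decide +kernel) checkLane_5 hS h1 hcard
  · exact sequenceable_of_checkLane hm hm3 (by norm_num) (by norm_num) (by norm_num)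
      (by decide +kernel) (by decide +kernel) (by decide +kernel) (by decide +kernel)
      (by decide +kernel) checkLane_6 hS h1 hcard
  · exact sequenceable_of_checkLane hm hm3 (by norm_num) (by norm_num) (by norm_num)
      (by decide +kernel) (by decide +kernel) (by decide +kernel) (by decide +kernel)
      (by decide +kernel) checkLane_7 hS h1 hcard
  · exact sequenceable_of_checkLane hm hm3 (by norm_num) (by norm_num) (by norm_num)
      (by decide +kernel) (by decide +kernel) (by decide +kernel) (by decide +kernel)
      (by decide +kernel) checkLane_8 hS h1 hcard
  · exact sequenceable_of_checkLane hm hm3 (by norm_num) (by norm_num) (by norm_num)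
      (by decide +kernel) (by decide +kernel) (by decide +kernel) (by decide +kernel)
      (by decide +kernel) checkLane_9 hS h1 hcard
  · exact sequenceable_of_checkLane hm hm3 (by norm_num) (by norm_num) (by norm_num)
      (by decide +kernel) (by decide +kernel) (by decide +kernel) (by decide +kernel)
      (by decide +kernel) checkLane_10 hS h1 hcard
  · exact sequenceable_of_checkLane hm hm3 (by norm_num) (by norm_num) (by norm_num)
      (by decide +kernel) (by decide +kernel) (by decide +kernel) (by decide +kernel)
      (by decide +kernel) checkLane_11 hS h1 hcard
  · exact sequenceable_of_checkLane hm hm3 (by norm_num) (by norm_num) (by norm_num)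
      (by decide +kernel) (by decide +kernel) (by decide +kernel) (by decide +kernel)
      (by decide +kernel) checkLane_12 hS h1 hcard

theorem exists_certs {k r f : ℕ} (hk : k ≤ 12) (hf : 0 < f) (h : r + f = k) :
    ∃ cs, checkCerts (2 ^ 128) r f cs = true := by
  interval_cases k
  · omega
  · exact exists_certs_1 r f hf h
  · exact exists_certs_2 r f hf h
  · exact exists_certs_3 r f hf h
  · exact exists_certs_4 r f hf h
  · exact exists_certs_5 r f hf h
  · exact exists_certs_6 r f hf h
  · exact exists_certs_7 r f hf h
  · exact exists_certs_8 r f hf h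
  · exact exists_certs_9 r f hf h
  · exact exists_certs_10 r f hf h
  · exact exists_certs_11 r f hf h
  · exact exists_certs_12 r f hf h

/-- for `k ≤ 12` and prime `m > 3`, every `k`-subset of non-identity elements of
the dihedral group `D_{2m}` is sequenceable. -/
theorem stmt8 (m : ℕ) (hm : m.Prime) (hm3 : 3 < m) (k : ℕ) (hk : k ≤ 12)
    (S : Finset (DihedralGroup m)) (h1 : (1 : DihedralGroup m) ∉ S) (hcard : S.card = k) :
    Sequenceable S := by
  rcases Nat.eq_zero_or_pos (S.filter fun g => dRef g = true).card with h0 | hpos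
  · refine sequenceable_of_forall_rotation hm hm3 hk (fun g hg => ?_) h1 hcard
    rw [Finset.card_eq_zero, Finset.filter_eq_empty_iff] at h0
    exact Bool.eq_false_iff.mpr (h0 hg)
  · have h : (S.filter fun g => dRef g = false).card + (S.filter fun g => dRef g = true).card =
        k := by
      rw [add_comm, ← hcard, ← Finset.card_filter_add_card_filter_not (s := S)
        (fun g => dRef g = true)]
      simp only [Bool.not_eq_true]
    obtain ⟨cs, hcs⟩ := exists_certs hk hpos h
    exact sequenceable_of_checkCerts hm hm3 h1 rfl rfl cs hcs
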